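/- arXiv:2405.15904 — 10 statements merged into one kernel-verified Lean document; each statement's English description precedes it below -/
import Mathlib

section
/- For every integer k ≥ 4 and every n ≥ k, every edge-coloring of K_n in which each cycle on k vertices receives at least 3 distinct colors uses at least (n-1)/(k-2) colors; that is, f(K_n, C_k, 3) ≥ (n-1)/(k-2). -/
open Finset

/-- The number of colors used by an edge-coloring `c` of the complete graph `K_n`. -/
def usedColors (n : ℕ) (c : Sym2 (Fin n) → ℕ) : ℕ :=
  (((Finset.univ : Finset (Sym2 (Fin n))).filter fun e => ¬ e.IsDiag).image c).card

/-- `v` lists `k` distinct vertices: it is injective on `{0, …, k-1}`. -/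
def InjOnFirst (n k : ℕ) (v : ℕ → Fin n) : Prop :=
  ∀ i j, i < k → j < k → v i = v j → i = j

/-- The number of distinct colors on the cycle `v 0 — ⋯ — v (m-1) — v 0`. -/
def cycleColorCount (n m : ℕ) (c : Sym2 (Fin n) → ℕ) (v : ℕ → Fin n) : ℕ :=
  ((Finset.range m).image fun i => c s(v i, v ((i + 1) % m))).card

/-- Reversing the second part of a path whose two ends are adjacent to the two vertices around the
cut produces a Hamiltonian cycle on its vertices, so every vertex is the start of a path. -/
lemma List.IsChain.exists_perm_cons_of_crossing {V : Type*} {r : V → V → Prop}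
    (hr : ∀ a b, r a b → r b a) {x y : List V} (hl : (x ++ y).IsChain r) (hx : x ≠ []) (hy : y ≠ [])
    (hhead : r (x.head hx) (y.head hy)) (hlast : r (x.getLast hx) (y.getLast hy))
    {u : V} (hu : u ∈ x ++ y) :
    ∃ t : List V, (u :: t).Perm (x ++ y) ∧ (u :: t).IsChain r := by
  obtain ⟨hcx, hcy, -⟩ := List.isChain_append.1 hl
  have hcy' : y.reverse.IsChain r :=
    List.isChain_reverse.2 (hcy.imp fun a b hab => hr a b hab)
  have hcycle : (x ++ y.reverse).IsChain r := by
    refine List.isChain_append.2 ⟨hcx, hcy', ?_⟩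
    intro a ha b hb
    rw [List.getLast?_eq_getLast_of_ne_nil hx] at ha
    rw [List.head?_reverse, List.getLast?_eq_getLast_of_ne_nil hy] at hb
    simp only [Option.mem_def, Option.some.injEq] at ha hb
    exact ha ▸ hb ▸ hlast
  have hclose : ∀ a ∈ (x ++ y.reverse).getLast?, ∀ b ∈ (x ++ y.reverse).head?, r a b := by
    intro a ha b hb
    rw [List.getLast?_append_of_ne_nil _ (by simpa using hy), List.getLast?_reverse,
      List.head?_eq_some_head hy] at ha
    rw [List.head?_append_of_ne_nil _ hx, List.head?_eq_some_head hx] at hb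
    simp only [Option.mem_def, Option.some.injEq] at ha hb
    exact hr _ _ (ha ▸ hb ▸ hhead)
  have hperm : (x ++ y.reverse).Perm (x ++ y) := (List.reverse_perm y).append_left x
  obtain ⟨s, t, hst⟩ := List.append_of_mem (hperm.mem_iff.2 hu)
  rw [hst] at hcycle hclose hperm
  refine ⟨t ++ s, (List.perm_append_comm (l₁ := u :: t) (l₂ := s)).trans hperm, ?_⟩
  obtain ⟨hs, ht, -⟩ := List.isChain_append.1 hcycle
  rw [← List.cons_append]
  refine List.isChain_append.2 ⟨ht, hs, ?_⟩
  intro a ha b hb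
  refine hclose a ?_ b ?_
  · rwa [List.getLast?_append_of_ne_nil _ (by simp)]
  · cases s with
    | nil => simp at hb
    | cons => simpa using hb

namespace SimpleGraph

variable {V : Type*} [DecidableEq V] (G : SimpleGraph V) [DecidableRel G.Adj]

/-- If the degrees within `S` of the two ends of a path on `S`, all of whose neighbours in `S` lie
on the path, sum to at least its length, then some cut of the path is crossed by both ends. -/
lemma exists_crossing {S : Finset V} {l : List V} (hne : l ≠ [])
    (hhead : ∀ w ∈ S, G.Adj (l.head hne) w → w ∈ l)
    (hlast : ∀ w ∈ S, G.Adj (l.getLast hne) w → w ∈ l)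
    (hdeg : l.length ≤ #{w ∈ S | G.Adj (l.head hne) w} + #{w ∈ S | G.Adj (l.getLast hne) w}) :
    ∃ (x y : List V) (hx : x ≠ []) (hy : y ≠ []), l = x ++ y ∧
      G.Adj (x.head hx) (y.head hy) ∧ G.Adj (x.getLast hx) (y.getLast hy) := by
  have hpos : 0 < l.length := List.length_pos_iff.2 hne
  set p : ℕ → V := fun i => l.getD i (l.head hne) with hp
  have hp_eq : ∀ i (hi : i < l.length), p i = l[i] := fun i hi => by simp [hp, hi]
  have hp_head : l.head hne = l[0] := by rw [List.head_eq_getElem]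
  have hp_last : l.getLast hne = l[l.length - 1] := by rw [List.getLast_eq_getElem]
  set A := {i ∈ range (l.length - 1) | G.Adj (l.head hne) (p (i + 1))} with hA
  set B := {i ∈ range (l.length - 1) | G.Adj (l.getLast hne) (p i)} with hB
  have hcardA : #{w ∈ S | G.Adj (l.head hne) w} ≤ #A := by
    refine (card_le_card (t := A.image fun i => p (i + 1)) fun w hw => ?_).trans card_image_le
    obtain ⟨hwS, hw⟩ := mem_filter.1 hw
    obtain ⟨i, hi, rfl⟩ := List.mem_iff_getElem.1 (hhead w hwS hw)
    obtain _ | i := i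
    · exact absurd (hp_head ▸ hw) (G.irrefl)
    · exact mem_image.2 ⟨i, mem_filter.2 ⟨mem_range.2 (by omega), by rwa [hp_eq _ hi]⟩, hp_eq _ hi⟩
  have hcardB : #{w ∈ S | G.Adj (l.getLast hne) w} ≤ #B := by
    refine (card_le_card (t := B.image p) fun w hw => ?_).trans card_image_le
    obtain ⟨hwS, hw⟩ := mem_filter.1 hw
    obtain ⟨i, hi, rfl⟩ := List.mem_iff_getElem.1 (hlast w hwS hw)
    by_cases hil : i = l.length - 1
    · subst hil
      exact absurd (hp_last ▸ hw) (G.irrefl)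
    · exact mem_image.2 ⟨i, mem_filter.2 ⟨mem_range.2 (by omega), by rwa [hp_eq _ hi]⟩, hp_eq _ hi⟩
  obtain ⟨i, hi⟩ : (A ∩ B).Nonempty := by
    rw [← card_pos]
    have hunion : #(A ∪ B) ≤ l.length - 1 := by
      simpa using card_le_card (union_subset (filter_subset _ _) (filter_subset _ _) :
        A ∪ B ⊆ range (l.length - 1))
    have := card_union_add_card_inter A B
    omega
  simp only [hA, hB, mem_inter, mem_filter, mem_range] at hi
  obtain ⟨⟨hil, hiA⟩, -, hiB⟩ := hi
  have hx : l.take (i + 1) ≠ [] := by simp [hne]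
  have hy : l.drop (i + 1) ≠ [] := by simp; omega
  refine ⟨l.take (i + 1), l.drop (i + 1), hx, hy, (List.take_append_drop _ _).symm, ?_, ?_⟩
  · rw [List.head_take, List.head_drop, ← hp_eq]
    exact hiA
  · rw [List.getLast_drop, List.getLast_eq_getElem hx, G.adj_comm]
    rw [hp_eq _ (by omega)] at hiB
    have hlen : (l.take (i + 1)).length - 1 = i := by simp; omega
    simpa only [List.getElem_take, hlen] using hiB

/-- **Erdős–Gallai theorem for paths**: if no path in `G` has more than `m + 1` vertices, then the
average degree of every induced subgraph is at most `m`. -/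
theorem sum_card_adj_le_of_path_length_le {m : ℕ}
    (hG : ∀ l : List V, l.Nodup → l.IsChain G.Adj → l.length ≤ m + 1) (S : Finset V) :
    ∑ v ∈ S, #{w ∈ S | G.Adj v w} ≤ m * #S := by
  induction S using Finset.strongInduction with
  | H S ih =>
  obtain rfl | ⟨s, hs⟩ := S.eq_empty_or_nonempty
  · simp
  by_cases hlow : ∃ v ∈ S, 2 * #{w ∈ S | G.Adj v w} ≤ m
  · obtain ⟨v, hv, hdeg⟩ := hlow
    have hrest : ∑ u ∈ S.erase v, #{w ∈ S | G.Adj u w} =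
        ∑ u ∈ S.erase v, #{w ∈ S.erase v | G.Adj u w} + #{w ∈ S | G.Adj v w} := by
      have hsplit : ∀ u, #{w ∈ S | G.Adj u w} =
          #{w ∈ S.erase v | G.Adj u w} + if G.Adj v u then 1 else 0 := by
        intro u
        conv_lhs => rw [← insert_erase hv, filter_insert]
        simp only [G.adj_comm v u]
        split_ifs
        · rw [card_insert_of_notMem (by simp)]
        · rfl
      have herase : {u ∈ S.erase v | G.Adj v u} = {u ∈ S | G.Adj v u} := by
        rw [filter_erase, erase_eq_of_notMem (by simp)]
      rw [sum_congr rfl fun u _ => hsplit u, sum_add_distrib, ← card_filter, herase]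
    have := ih _ (erase_ssubset hv)
    rw [← add_sum_erase _ _ hv, hrest, ← card_erase_add_one hv, mul_add]
    omega
  push Not at hlow
  obtain ⟨l, ⟨hne, hnd, hch, hsub⟩, hmax⟩ : ∃ l : List V,
      (l ≠ [] ∧ l.Nodup ∧ l.IsChain G.Adj ∧ ∀ v ∈ l, v ∈ S) ∧
        ∀ l' : List V, l'.Nodup → l'.IsChain G.Adj → (∀ v ∈ l', v ∈ S) →
          l'.length ≤ l.length := by
    obtain ⟨l, ⟨hl, hl'⟩, hmin⟩ := (measure fun l : List V => m + 1 - l.length).wf.has_min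
      {l | l ≠ [] ∧ l.Nodup ∧ l.IsChain G.Adj ∧ ∀ v ∈ l, v ∈ S} ⟨[s], by simp [hs]⟩
    refine ⟨l, ⟨hl, hl'⟩, fun l' hnd hch hsub => ?_⟩
    by_contra! hlt
    refine hmin l' ⟨List.ne_nil_of_length_pos (by omega), hnd, hch, hsub⟩ ?_
    have := hG l' hnd hch
    change m + 1 - l'.length < m + 1 - l.length
    omega
  have hstart : ∀ u t, (u :: t).Perm l → (u :: t).IsChain G.Adj →
      ∀ w ∈ S, G.Adj u w → w ∈ l := by
    intro u t hperm hchain w hw huw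
    by_contra hwl
    have := hmax (w :: u :: t) (List.nodup_cons.2 ⟨by rwa [hperm.mem_iff], hperm.nodup_iff.2 hnd⟩)
      (List.isChain_cons_cons.2 ⟨huw.symm, hchain⟩) (by
        intro v hv
        obtain rfl | hv := List.mem_cons.1 hv
        · exact hw
        · exact hsub v (hperm.mem_iff.1 hv))
    rw [List.length_cons, hperm.length_eq] at this
    omega
  have hclosed : ∀ u ∈ l, ∀ w ∈ S, G.Adj u w → w ∈ l := by
    have hhead := hstart (l.head hne) l.tail (by simp) (by simpa using hch)
    have hlast := hstart (l.getLast hne) l.dropLast.reverse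
      (by
        rw [← List.reverse_concat', List.dropLast_concat_getLast]
        exact List.reverse_perm l)
      (by
        rw [← List.reverse_concat', List.dropLast_concat_getLast]
        exact List.isChain_reverse.2 (hch.imp fun _ _ h => h.symm))
    obtain ⟨x, y, hx, hy, rfl, hxy, hxy'⟩ := G.exists_crossing hne hhead hlast (by
      have := hG l hnd hch
      have := hlow _ (hsub _ (List.head_mem hne))
      have := hlow _ (hsub _ (List.getLast_mem hne))
      omega)
    intro u hu
    obtain ⟨t, hperm, hchain⟩ :=
      hch.exists_perm_cons_of_crossing (fun _ _ h => h.symm) hx hy hxy hxy' hu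
    exact hstart u t hperm hchain
  have hTS : l.toFinset ⊆ S := fun v hv => hsub v (List.mem_toFinset.1 hv)
  have hcardT : #l.toFinset ≤ m + 1 := (List.toFinset_card_le l).trans (hG l hnd hch)
  have hinside : ∑ v ∈ l.toFinset, #{w ∈ S | G.Adj v w} ≤ m * #l.toFinset := by
    rw [mul_comm, ← smul_eq_mul]
    refine sum_le_card_nsmul _ _ _ fun v hv => ?_
    have hss : {w ∈ S | G.Adj v w} ⊆ l.toFinset.erase v := by
      intro w hw
      obtain ⟨hwS, hw⟩ := mem_filter.1 hw
      exact mem_erase.2 ⟨hw.ne', List.mem_toFinset.2 (hclosed v (List.mem_toFinset.1 hv) w hwS hw)⟩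
    have := card_le_card hss
    rw [card_erase_of_mem hv] at this
    omega
  have houtside : ∑ v ∈ S \ l.toFinset, #{w ∈ S | G.Adj v w} =
      ∑ v ∈ S \ l.toFinset, #{w ∈ S \ l.toFinset | G.Adj v w} := by
    refine sum_congr rfl fun v hv => congrArg card ?_
    ext w
    simp only [mem_filter, mem_sdiff, List.mem_toFinset] at hv ⊢
    exact ⟨fun h => ⟨⟨h.1, fun hw => hv.2 (hclosed w hw v hv.1 h.2.symm)⟩, h.2⟩,
      fun h => ⟨h.1.1, h.2⟩⟩
  have := ih (S \ l.toFinset)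
    (sdiff_ssubset hTS ⟨l.head hne, List.mem_toFinset.2 (List.head_mem hne)⟩)
  rw [← sum_sdiff hTS, ← card_sdiff_add_card_eq_card hTS, houtside, mul_add]
  omega

end SimpleGraph

/-- The graph of the edges of color `a`. -/
def colorGraph {V : Type*} (c : Sym2 V → ℕ) (a : ℕ) : SimpleGraph V where
  Adj u w := u ≠ w ∧ c s(u, w) = a
  symm := ⟨fun u w h => ⟨h.1.symm, by rw [Sym2.eq_swap]; exact h.2⟩⟩
  loopless := ⟨fun _ h => h.1 rfl⟩

instance {V : Type*} [DecidableEq V] (c : Sym2 V → ℕ) (a : ℕ) :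
    DecidableRel (colorGraph c a).Adj :=
  fun u w => inferInstanceAs (Decidable (u ≠ w ∧ c s(u, w) = a))

/-- A monochromatic path on `k` vertices closes up to a `k`-cycle with at most two colors. -/
lemma length_lt_of_isChain_colorGraph {n k : ℕ} (hk : 0 < k) {c : Sym2 (Fin n) → ℕ}
    (h : ∀ v : ℕ → Fin n, InjOnFirst n k v → 3 ≤ cycleColorCount n k c v) {a : ℕ}
    {l : List (Fin n)} (hnd : l.Nodup) (hch : l.IsChain (colorGraph c a).Adj) :
    l.length < k := by
  by_contra! hlen
  have hpos : 0 < l.length := by omega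
  set v : ℕ → Fin n := fun i => l.getD i l[0] with hv
  have hv_eq : ∀ i (hi : i < l.length), v i = l[i] := fun i hi => by simp [hv, hi]
  have hinj : InjOnFirst n k v := by
    intro i j hi hj hij
    rw [hv_eq i (by omega), hv_eq j (by omega)] at hij
    exact (hnd.getElem_inj_iff).1 hij
  have hcard : cycleColorCount n k c v ≤ #{a, c s(v (k - 1), v 0)} := by
    refine card_le_card fun b hb => ?_
    obtain ⟨i, hi, rfl⟩ := mem_image.1 hb
    rw [mem_range] at hi
    obtain hik | rfl : i + 1 < k ∨ i = k - 1 := by omega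
    · rw [Nat.mod_eq_of_lt hik, hv_eq i (by omega), hv_eq (i + 1) (by omega)]
      exact mem_insert.2 (Or.inl (List.isChain_iff_getElem.1 hch i (by omega)).2)
    · rw [Nat.sub_add_cancel hk, Nat.mod_self]
      simp
  have := h v hinj
  have := card_le_two (a := a) (b := c s(v (k - 1), v 0))
  omega

/-- For `k ≥ 4` and `n ≥ k`, every edge-coloring of `K_n` in which every
cycle on `k` vertices receives at least 3 colors uses at least `(n-1)/(k-2)` colors. -/
theorem generalized_ramsey_cycle_lower (k n : ℕ) (hk : 4 ≤ k) (hn : k ≤ n)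
    (c : Sym2 (Fin n) → ℕ)
    (h : ∀ v : ℕ → Fin n, InjOnFirst n k v → 3 ≤ cycleColorCount n k c v) :
    ((n : ℝ) - 1) / ((k : ℝ) - 2) ≤ usedColors n c := by
  obtain ⟨m, rfl⟩ := Nat.exists_eq_add_of_le' (show 2 ≤ k by omega)
  set U := ((univ : Finset (Sym2 (Fin n))).filter fun e => ¬ e.IsDiag).image c
  have hdeg : ∀ v : Fin n, ∑ a ∈ U, #{w | (colorGraph c a).Adj v w} = n - 1 := by
    intro v
    have hmaps : ∀ w ∈ univ.erase v, c s(v, w) ∈ U := fun w hw =>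
      mem_image.2 ⟨s(v, w), by simpa using (ne_of_mem_erase hw).symm, rfl⟩
    have hfib := card_eq_sum_card_fiberwise hmaps
    rw [card_erase_of_mem (mem_univ v), card_univ, Fintype.card_fin] at hfib
    rw [hfib]
    refine sum_congr rfl fun a _ => congrArg card ?_
    ext w
    simp [colorGraph, eq_comm]
  have hle : n * (n - 1) ≤ n * (m * #U) := calc
    n * (n - 1) = ∑ a ∈ U, ∑ v : Fin n, #{w | (colorGraph c a).Adj v w} := by
      rw [sum_comm, sum_congr rfl fun v _ => hdeg v]
      simp
    _ ≤ ∑ _a ∈ U, m * #(univ : Finset (Fin n)) := sum_le_sum fun a _ =>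
      (colorGraph c a).sum_card_adj_le_of_path_length_le (fun l hnd hch =>
        Nat.le_of_lt_succ (length_lt_of_isChain_colorGraph (by omega) h hnd hch)) univ
    _ = n * (m * #U) := by
      rw [sum_const, card_univ, Fintype.card_fin, smul_eq_mul]
      ring
  have hle' : n ≤ m * #U + 1 := by
    have := Nat.le_of_mul_le_mul_left hle (by omega)
    omega
  have hm : (0 : ℝ) < m := by exact_mod_cast (show 0 < m by omega)
  have hreal : (n : ℝ) ≤ m * #U + 1 := by exact_mod_cast hle'
  rw [show ((m + 2 : ℕ) : ℝ) - 2 = m by push_cast; ring, div_le_iff₀ hm]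
  change (n : ℝ) - 1 ≤ #U * m
  linarith
end

section
/- For every fixed integer k ≥ 3 there exists a constant C = C(k) such that for all n, every edge-coloring of the complete bipartite graph K_{n,n} in which each cycle on 2k vertices receives at least 3 distinct colors uses at least n/(2(k-1)) − C colors; that is, f(K_{n,n}, C_{2k}, 3) ≥ n/(2(k-1)) + O(1). -/
open Finset

/-- The number of colors used by an edge-coloring `c` of the complete bipartite graph
`K_{n,n}`, where `c i j` is the color of the edge joining left vertex `i` to right
vertex `j`. -/
def usedColorsBip (n : ℕ) (c : Fin n → Fin n → ℕ) : ℕ :=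
  ((Finset.univ : Finset (Fin n × Fin n)).image fun p => c p.1 p.2).card

/-- The number of distinct colors on the cycle `C_{2k}` in `K_{n,n}` with left vertices
`a 0, …, a (k-1)` and right vertices `b 0, …, b (k-1)`, whose edges are
`a i — b i` and `a (i+1) — b i` (indices mod `k`). -/
def bipCycleColorCount (n k : ℕ) (c : Fin n → Fin n → ℕ) (a b : ℕ → Fin n) : ℕ :=
  (((Finset.range k).image fun i => c (a i) (b i)) ∪
    ((Finset.range k).image fun i => c (a ((i + 1) % k)) (b i))).card

/-- A bipartite graph with more than `d * (|A| + |B|)` edges has a nonempty subgraph of minimum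
degree greater than `d`. -/
theorem exists_subgraph_min_degree {α β : Type*} [DecidableEq α] [DecidableEq β]
    (R : α → β → Prop) [∀ a, DecidablePred (R a)] [∀ b, DecidablePred (fun a => R a b)]
    (d : ℕ) (A : Finset α) (B : Finset β)
    (h : d * (#A + #B) < ∑ a ∈ A, #(B.bipartiteAbove R a)) :
    ∃ (A' : Finset α) (B' : Finset β), A'.Nonempty ∧
      (∀ a ∈ A', d < #(B'.bipartiteAbove R a)) ∧
      (∀ b ∈ B', d < #(A'.bipartiteBelow R b)) := by
  induction hm : #A + #B generalizing A B with
  | zero =>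
    have hA : A = ∅ := Finset.card_eq_zero.mp (by omega)
    simp [hA] at h
  | succ m ih =>
    by_cases hA : ∃ a ∈ A, #(B.bipartiteAbove R a) ≤ d
    · obtain ⟨a, ha, had⟩ := hA
      have hcard := Finset.card_erase_add_one ha
      have hsum := Finset.add_sum_erase A (fun a => #(B.bipartiteAbove R a)) ha
      refine ih (A.erase a) B ?_ (by omega)
      have : #A + #B = #(A.erase a) + #B + 1 := by omega
      rw [this, mul_add] at h
      omega
    by_cases hB : ∃ b ∈ B, #(A.bipartiteBelow R b) ≤ d
    · obtain ⟨b, hb, hbd⟩ := hB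
      have hcard := Finset.card_erase_add_one hb
      have hsum := Finset.add_sum_erase B (fun b => #(A.bipartiteBelow R b)) hb
      refine ih A (B.erase b) ?_ (by omega)
      rw [Finset.sum_card_bipartiteAbove_eq_sum_card_bipartiteBelow] at h ⊢
      have : #A + #B = #A + #(B.erase b) + 1 := by omega
      rw [this, mul_add] at h
      omega
    push Not at hA hB
    refine ⟨A, B, ?_, hA, hB⟩
    rw [Finset.nonempty_iff_ne_empty]
    rintro rfl
    simp at h

/-- In a bipartite graph of minimum degree greater than `d`, there is a path
`a 0, b 0, a 1, b 1, …, a j, b j` for every `j ≤ d`. -/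
theorem exists_alternating_path {α β : Type*} [DecidableEq α] [DecidableEq β]
    (R : α → β → Prop) [∀ a, DecidablePred (R a)] [∀ b, DecidablePred (fun a => R a b)]
    (d : ℕ) (A : Finset α) (B : Finset β) (hne : A.Nonempty)
    (hA : ∀ a ∈ A, d < #(B.bipartiteAbove R a))
    (hB : ∀ b ∈ B, d < #(A.bipartiteBelow R b)) (j : ℕ) (hj : j ≤ d) :
    ∃ (a : ℕ → α) (b : ℕ → β), Set.InjOn a (Set.Iic j) ∧ Set.InjOn b (Set.Iic j) ∧
      (∀ i ≤ j, R (a i) (b i)) ∧ (∀ i < j, R (a (i + 1)) (b i)) ∧ b j ∈ B := by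
  induction j with
  | zero =>
    obtain ⟨x, hx⟩ := hne
    obtain ⟨y, hy⟩ := Finset.card_pos.mp ((Nat.zero_le d).trans_lt (hA x hx))
    rw [Finset.mem_bipartiteAbove] at hy
    refine ⟨fun _ => x, fun _ => y, ?_, ?_, ?_, ?_, hy.1⟩
    · exact fun i hi i' hi' _ => (Nat.le_zero.mp hi).trans (Nat.le_zero.mp hi').symm
    · exact fun i hi i' hi' _ => (Nat.le_zero.mp hi).trans (Nat.le_zero.mp hi').symm
    · exact fun _ _ => hy.2
    · exact fun i hi => absurd hi (Nat.not_lt_zero i)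
  | succ j ih =>
    obtain ⟨a, b, ha, hb, hab, hab', hbj⟩ := ih (by omega)
    obtain ⟨x, hx, hxa⟩ := Finset.exists_mem_notMem_of_card_lt_card
      (s := (Finset.range (j + 1)).image a) (t := A.bipartiteBelow R (b j))
      (lt_of_le_of_lt (Finset.card_image_le.trans (by simpa using hj)) (hB _ hbj))
    rw [Finset.mem_bipartiteBelow] at hx
    obtain ⟨y, hy, hyb⟩ := Finset.exists_mem_notMem_of_card_lt_card
      (s := (Finset.range (j + 1)).image b) (t := B.bipartiteAbove R x)
      (lt_of_le_of_lt (Finset.card_image_le.trans (by simpa using hj)) (hA _ hx.1))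
    rw [Finset.mem_bipartiteAbove] at hy
    simp only [Finset.mem_image, Finset.mem_range, not_exists, not_and] at hxa hyb
    refine ⟨Function.update a (j + 1) x, Function.update b (j + 1) y, ?_, ?_, ?_, ?_, ?_⟩
    · intro i hi i' hi' h
      simp only [Set.mem_Iic, Set.InjOn, Function.update_apply] at *
      grind
    · intro i hi i' hi' h
      simp only [Set.mem_Iic, Set.InjOn, Function.update_apply] at *
      grind
    · intro i hi
      simp only [Function.update_apply]
      grind
    · intro i hi
      simp only [Function.update_apply]
      grind
    · simpa using hy.1

/-- If every `C_{2k}` receives at least three colors, every color class has at most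
`2 (k - 1) n` edges. -/
theorem card_color_class_le (k : ℕ) (hk : 1 ≤ k) (n : ℕ) (c : Fin n → Fin n → ℕ)
    (hc : ∀ a b : ℕ → Fin n, InjOnFirst n k a → InjOnFirst n k b →
      3 ≤ bipCycleColorCount n k c a b) (χ : ℕ) :
    #{p : Fin n × Fin n | c p.1 p.2 = χ} ≤ (k - 1) * (n + n) := by
  by_contra! hlt
  have hsum : #{p : Fin n × Fin n | c p.1 p.2 = χ} =
      ∑ x : Fin n, #((univ : Finset (Fin n)).bipartiteAbove (fun x y => c x y = χ) x) := by
    simp only [Finset.bipartiteAbove, Finset.card_filter, Fintype.sum_prod_type]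
  obtain ⟨A, B, hne, hA, hB⟩ := exists_subgraph_min_degree (fun x y => c x y = χ) (k - 1)
    (univ : Finset (Fin n)) (univ : Finset (Fin n)) (by simpa [← hsum] using hlt)
  obtain ⟨a, b, ha, hb, hab, hab', -⟩ :=
    exists_alternating_path (fun x y => c x y = χ) (k - 1) A B hne hA hB (k - 1) le_rfl
  have hcount := hc a b
    (fun i j hi hj h => ha (Set.mem_Iic.mpr (by omega)) (Set.mem_Iic.mpr (by omega)) h)
    (fun i j hi hj h => hb (Set.mem_Iic.mpr (by omega)) (Set.mem_Iic.mpr (by omega)) h)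
  have hsub : ((Finset.range k).image fun i => c (a i) (b i)) ∪
      ((Finset.range k).image fun i => c (a ((i + 1) % k)) (b i)) ⊆
      {χ, c (a 0) (b (k - 1))} := by
    intro z hz
    simp only [Finset.mem_union, Finset.mem_image, Finset.mem_range, Finset.mem_insert,
      Finset.mem_singleton] at hz ⊢
    rcases hz with ⟨i, hi, rfl⟩ | ⟨i, hi, rfl⟩
    · exact Or.inl (hab i (by omega))
    · rcases Nat.lt_or_ge (i + 1) k with h | h
      · rw [Nat.mod_eq_of_lt h]
        exact Or.inl (hab' i (by omega))
      · obtain rfl : k = i + 1 := by omega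
        simp
  have := (Finset.card_le_card hsub).trans Finset.card_le_two
  unfold bipCycleColorCount at hcount
  omega

/-- For fixed `k ≥ 3` there is a constant `C` such that for all `n`,
every edge-coloring of `K_{n,n}` in which every cycle on `2k` vertices receives at
least 3 colors uses at least `n/(2(k-1)) − C` colors. -/
theorem generalized_ramsey_bipartite_cycle_lower (k : ℕ) (hk : 3 ≤ k) :
    ∃ C : ℝ, ∀ n : ℕ, ∀ c : Fin n → Fin n → ℕ,
      (∀ a b : ℕ → Fin n, InjOnFirst n k a → InjOnFirst n k b →
        3 ≤ bipCycleColorCount n k c a b) →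
      (n : ℝ) / (2 * ((k : ℝ) - 1)) - C ≤ usedColorsBip n c := by
  refine ⟨0, fun n c hc => ?_⟩
  have hcard := Finset.card_le_mul_card_image
    (f := fun p : Fin n × Fin n => c p.1 p.2) univ ((k - 1) * (n + n))
    (fun χ _ => card_color_class_le k (by omega) n c hc χ)
  change _ ≤ _ * usedColorsBip n c at hcard
  rw [Finset.card_univ, Fintype.card_prod, Fintype.card_fin] at hcard
  have hk' : (0 : ℝ) < 2 * ((k : ℝ) - 1) := by
    have : (3 : ℝ) ≤ k := by exact_mod_cast hk
    linarith
  rw [sub_zero, div_le_iff₀ hk']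
  rcases Nat.eq_zero_or_pos n with rfl | hn
  · simpa using mul_nonneg (Nat.cast_nonneg _) hk'.le
  · have hreal : (n : ℝ) * n ≤ ((k : ℝ) - 1) * (n + n) * usedColorsBip n c := by
      have h : ((n * n : ℕ) : ℝ) ≤ ((k - 1) * (n + n) * usedColorsBip n c : ℕ) := by
        exact_mod_cast hcard
      push_cast [Nat.cast_sub (show 1 ≤ k by omega)] at h
      exact h
    have hn' : (0 : ℝ) < n := by exact_mod_cast hn
    refine le_of_mul_le_mul_left ?_ hn'
    linarith
end

section
/- For every integer k ≥ 2 and every n ≥ k+2, every edge-coloring of the complete k-uniform hypergraph K_n^k in which each set of k+2 vertices spans edges of at least C(k+2,k) − 1 distinct colors uses at least ((k²+k−1)/(k²+k))·(n−k+1) colors; that is, f(K_n^k, K_{k+2}^k, C(k+2,k)−1) ≥ ((k²+k−1)/(k²+k))·n + O(1). -/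
open Finset

/-- The number of colors used by an edge-coloring `c` of the complete `k`-uniform
hypergraph `K_n^k` (whose edges are the `k`-element subsets of `Fin n`). -/
def usedColorsHyp (n k : ℕ) (c : Finset (Fin n) → ℕ) : ℕ :=
  (((Finset.univ : Finset (Fin n)).powersetCard k).image c).card

/-- If `f` takes at least `#P - 1` values on `P`, then at most one unordered pair of distinct
elements of `P` has equal values. -/
lemma pair_eq_of_card_sub_one_le_card_image {β γ : Type*} [DecidableEq β] [DecidableEq γ]
    {P : Finset β} {f : β → γ} (hP : #P - 1 ≤ #(P.image f)) {a b a' b' : β}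
    (ha : a ∈ P) (hb : b ∈ P) (ha' : a' ∈ P) (hb' : b' ∈ P) (hab : a ≠ b) (hab' : a' ≠ b')
    (hf : f a = f b) (hf' : f a' = f b') : ({a, b} : Finset β) = {a', b'} := by
  have key : ∀ x ∈ P, ∀ y ∈ P, x ≠ y → f x = f y → x = a' ∨ x = b' := by
    intro x hx y hy hxy hfxy
    have himage : (P.erase x).image f = P.image f := by
      refine subset_antisymm (image_subset_image (erase_subset _ _)) fun z hz ↦ ?_
      obtain ⟨w, hw, rfl⟩ := mem_image.1 hz
      by_cases hwx : w = x
      · exact mem_image.2 ⟨y, mem_erase.2 ⟨hxy.symm, hy⟩, by rw [hwx, hfxy]⟩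
      · exact mem_image_of_mem f (mem_erase.2 ⟨hwx, hw⟩)
    have hinj : Set.InjOn f (P.erase x) := by
      rw [← card_image_iff]
      refine le_antisymm card_image_le ?_
      rwa [himage, card_erase_of_mem hx]
    by_contra! hne
    exact hab' (hinj (mem_coe.2 (mem_erase.2 ⟨hne.1.symm, ha'⟩))
      (mem_coe.2 (mem_erase.2 ⟨hne.2.symm, hb'⟩)) hf')
  have h₁ := key a ha b hb hab hf
  have h₂ := key b hb a ha hab.symm hf.symm
  ext x
  simp only [mem_insert, mem_singleton]
  grind

/-- `T` is the union of two edges of the same color whose intersection is `A`, each exceeding `A`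
by one vertex. -/
def IsMonoCherry {α : Type*} [DecidableEq α] (c : Finset α → ℕ) (A T : Finset α) : Prop :=
  ∃ u w, u ∉ A ∧ w ∉ A ∧ u ≠ w ∧ T = insert u (insert w A) ∧ c (insert u A) = c (insert w A)

lemma IsMonoCherry.card_eq {α : Type*} [DecidableEq α] {c : Finset α → ℕ} {A T : Finset α}
    (h : IsMonoCherry c A T) : #T = #A + 2 := by
  obtain ⟨u, w, hu, hw, huw, rfl, -⟩ := h
  rw [card_insert_of_notMem (by simp [huw, hu]), card_insert_of_notMem hw]

/-- Two monochromatic cherries lying in a common set that admits at most one color coincidence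
are equal. -/
lemma IsMonoCherry.unique {α : Type*} [DecidableEq α] {c : Finset α → ℕ} {k : ℕ}
    {A A' T T' S : Finset α} (hT : IsMonoCherry c A T) (hT' : IsMonoCherry c A' T')
    (hA : #A + 1 = k) (hA' : #A' + 1 = k) (hTS : T ⊆ S) (hTS' : T' ⊆ S)
    (hS : #(S.powersetCard k) - 1 ≤ #((S.powersetCard k).image c)) : A = A' ∧ T = T' := by
  obtain ⟨u, w, hu, hw, huw, rfl, hc⟩ := hT
  obtain ⟨u', w', hu', hw', huw', rfl, hc'⟩ := hT'
  have hne : ∀ {B : Finset α} {x y : α}, x ∉ B → x ≠ y → insert x B ≠ insert y B := by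
    intro B x y hx hxy heq
    have := heq ▸ mem_insert_self x B
    grind
  have hpair := pair_eq_of_card_sub_one_le_card_image hS
    (a := insert u A) (b := insert w A) (a' := insert u' A') (b' := insert w' A')
    (mem_powersetCard.2 ⟨by grind, by rw [card_insert_of_notMem hu, hA]⟩)
    (mem_powersetCard.2 ⟨by grind, by rw [card_insert_of_notMem hw, hA]⟩)
    (mem_powersetCard.2 ⟨by grind, by rw [card_insert_of_notMem hu', hA']⟩)
    (mem_powersetCard.2 ⟨by grind, by rw [card_insert_of_notMem hw', hA']⟩)
    (hne hu huw) (hne hu' huw') hc hc'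
  have hinter : ∀ {B : Finset α} {x y : α}, x ∉ B → y ∉ B → x ≠ y →
      insert x B ∩ insert y B = B := by
    intro B x y hx hy hxy
    ext z
    grind
  have hunion : ∀ (B : Finset α) (x y : α),
      insert x B ∪ insert y B = insert x (insert y B) := by
    intro B x y
    ext z
    grind
  have hcases : (insert u A = insert u' A' ∧ insert w A = insert w' A') ∨
      (insert u A = insert w' A' ∧ insert w A = insert u' A') := by
    have h₁ : insert u A ∈ ({insert u' A', insert w' A'} : Finset (Finset α)) := by
      simp [← hpair]
    have h₂ : insert w A ∈ ({insert u' A', insert w' A'} : Finset (Finset α)) := by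
      simp [← hpair]
    have h₃ := hne hu huw
    simp only [mem_insert, mem_singleton] at h₁ h₂
    grind
  have hA_eq := hinter hu hw huw
  have hA_eq' := hinter hu' hw' huw'
  rw [← hunion, ← hunion]
  rcases hcases with ⟨h₁, h₂⟩ | ⟨h₁, h₂⟩
  · rw [h₁, h₂] at hA_eq ⊢
    exact ⟨hA_eq.symm.trans hA_eq', rfl⟩
  · rw [h₁, h₂] at hA_eq ⊢
    exact ⟨hA_eq.symm.trans ((inter_comm _ _).trans hA_eq'), union_comm _ _⟩

/-- The edges through `A` number at most their colors plus the monochromatic cherries with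
core `A`. -/
lemma card_compl_le_colors_add_cherries {α : Type*} [Fintype α] [DecidableEq α]
    (c : Finset α → ℕ) (A : Finset α) [DecidablePred (IsMonoCherry c A)] :
    #Aᶜ ≤ #(((univ : Finset α).powersetCard (#A + 1)).image c) +
      #{T : Finset α | IsMonoCherry c A T} := by
  rcases isEmpty_or_nonempty α with _ | _
  · simp [Subsingleton.elim Aᶜ ∅]
  set I := Aᶜ.image fun v ↦ c (insert v A)
  have hrep : ∀ i ∈ I, ∃ v ∈ Aᶜ, c (insert v A) = i := fun i hi ↦ mem_image.1 hi
  choose! r hrA hrc using hrep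
  have hcI : ∀ v ∈ Aᶜ, c (insert v A) ∈ I := fun v hv ↦
    mem_image_of_mem (fun v ↦ c (insert v A)) hv
  have hIle : #(I.image r) ≤ #(((univ : Finset α).powersetCard (#A + 1)).image c) := by
    refine card_image_le.trans (card_le_card fun i hi ↦ ?_)
    obtain ⟨v, hv, rfl⟩ := mem_image.1 hi
    exact mem_image_of_mem c (mem_powersetCard.2
      ⟨subset_univ _, card_insert_of_notMem (mem_compl.1 hv)⟩)
  have hrest : #(Aᶜ \ I.image r) ≤ #{T : Finset α | IsMonoCherry c A T} := by
    refine card_le_card_of_injOn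
      (fun v ↦ insert v (insert (r (c (insert v A))) A)) ?_ ?_
    · intro v hv
      obtain ⟨hvA, hvr⟩ := mem_sdiff.1 (mem_coe.1 hv)
      refine mem_coe.2 (mem_filter.2 ⟨mem_univ _, v, _, mem_compl.1 hvA,
        mem_compl.1 (hrA _ (hcI v hvA)), ?_, rfl, (hrc _ (hcI v hvA)).symm⟩)
      intro heq
      exact hvr (mem_image.2 ⟨_, hcI v hvA, heq.symm⟩)
    · intro v hv v' hv' heq
      obtain ⟨hvA, hvr⟩ := mem_sdiff.1 (mem_coe.1 hv)
      obtain ⟨hvA', -⟩ := mem_sdiff.1 (mem_coe.1 hv')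
      have hmem : v ∈ insert v' (insert (r (c (insert v' A))) A) := by
        rw [← show _ = insert v' (insert (r (c (insert v' A))) A) from heq]
        exact mem_insert_self _ _
      rcases mem_insert.1 hmem with h | h
      · exact h
      rcases mem_insert.1 h with h | h
      · exact absurd (mem_image.2 ⟨_, hcI v' hvA', h.symm⟩) hvr
      · exact absurd h (mem_compl.1 hvA)
  have := card_le_card_sdiff_add_card (s := Aᶜ) (t := I.image r)
  omega

/-- If each `k + 2` vertices span at most one color coincidence, then the `k`-subsets of the
monochromatic cherries are all distinct. -/
lemma succ_mul_sum_card_cherries_le {α : Type*} [Fintype α] [DecidableEq α] {k : ℕ}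
    (hk : 1 ≤ k) (hn : k + 2 ≤ Fintype.card α) (c : Finset α → ℕ)
    [∀ A, DecidablePred (IsMonoCherry c A)]
    (h : ∀ S : Finset α, #S = k + 2 →
      (k + 2).choose k - 1 ≤ #((S.powersetCard k).image c)) :
    (k + 1) * ∑ A ∈ (univ : Finset α).powersetCard (k - 1),
      #{T : Finset α | IsMonoCherry c A T} ≤ (Fintype.card α).choose k := by
  set Z := ((univ : Finset α).powersetCard (k - 1)).sigma
    fun A ↦ {T : Finset α | IsMonoCherry c A T} with hZ
  have hmem : ∀ z ∈ Z, #z.1 + 1 = k ∧ IsMonoCherry c z.1 z.2 := by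
    intro z hz
    simp only [hZ, mem_sigma, mem_powersetCard, mem_filter, mem_univ, true_and] at hz
    exact ⟨by have := hz.1.2; omega, hz.2⟩
  have hcard : ∀ z ∈ Z, #z.2 = k + 1 := by
    intro z hz
    have := (hmem z hz).2.card_eq
    have := (hmem z hz).1
    omega
  have hdisj : (Z : Set (Σ _ : Finset α, Finset α)).PairwiseDisjoint
      fun z ↦ z.2.powersetCard k := by
    intro z hz z' hz' hne
    refine disjoint_left.2 fun g hg hg' ↦ hne ?_
    rw [mem_powersetCard] at hg hg'
    have hunion : #(z.2 ∪ z'.2) ≤ k + 2 := by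
      have h₁ := card_union_add_card_inter z.2 z'.2
      have h₂ := card_le_card (subset_inter hg.1 hg'.1)
      have h₃ := hcard z hz
      have h₄ := hcard z' hz'
      omega
    obtain ⟨S, hS, hScard⟩ := exists_superset_card_eq hunion hn
    have hSc := h S hScard
    rw [← hScard, ← card_powersetCard] at hSc
    obtain ⟨h₁, h₂⟩ := (hmem z hz).2.unique (hmem z' hz').2 (hmem z hz).1 (hmem z' hz').1
      (subset_union_left.trans hS) (subset_union_right.trans hS) hSc
    exact Sigma.ext h₁ (heq_of_eq h₂)
  calc (k + 1) * ∑ A ∈ (univ : Finset α).powersetCard (k - 1),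
        #{T : Finset α | IsMonoCherry c A T} = ∑ z ∈ Z, #(z.2.powersetCard k) := by
        rw [← card_sigma, sum_congr rfl fun z hz ↦ by
          rw [card_powersetCard, hcard z hz, Nat.choose_succ_self_right], sum_const,
          smul_eq_mul, mul_comm]
    _ = #(Z.biUnion fun z ↦ z.2.powersetCard k) := (card_biUnion hdisj).symm
    _ ≤ #((univ : Finset α).powersetCard k) := by
        refine card_le_card fun g hg ↦ ?_
        obtain ⟨z, -, hz⟩ := mem_biUnion.1 hg
        exact mem_powersetCard.2 ⟨subset_univ _, (mem_powersetCard.1 hz).2⟩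
    _ = (Fintype.card α).choose k := by rw [card_powersetCard, card_univ]

/-- For `k ≥ 2` and `n ≥ k+2`, every edge-coloring of `K_n^k` in which
every set of `k+2` vertices spans edges of at least `C(k+2,k) − 1` distinct colors uses
at least `((k²+k−1)/(k²+k))·(n−k+1)` colors. -/
theorem generalized_ramsey_hypergraph_clique_lower (k n : ℕ) (hk : 2 ≤ k)
    (hn : k + 2 ≤ n) (c : Finset (Fin n) → ℕ)
    (h : ∀ S : Finset (Fin n), S.card = k + 2 →
      (k + 2).choose k - 1 ≤ ((S.powersetCard k).image c).card) :
    ((k ^ 2 + k - 1 : ℝ) / (k ^ 2 + k : ℝ)) * ((n : ℝ) - k + 1) ≤ usedColorsHyp n k c := by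
  classical
  obtain ⟨j, rfl⟩ : ∃ j, k = j + 1 := ⟨k - 1, by omega⟩
  obtain ⟨m, rfl⟩ : ∃ m, n = j + m := ⟨n - j, by omega⟩
  set C := usedColorsHyp (j + m) (j + 1) c
  set X := ∑ A ∈ (univ : Finset (Fin (j + m))).powersetCard j,
    #{T : Finset (Fin (j + m)) | IsMonoCherry c A T}
  set M := (j + m).choose j
  have hcherries : (j + 1 + 1) * X ≤ (j + m).choose (j + 1) := by
    simpa using succ_mul_sum_card_cherries_le (by omega) (by simpa using hn) c h
  have hchoose : (j + m).choose (j + 1) * (j + 1) = M * m := by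
    rw [Nat.choose_succ_right_eq, Nat.add_sub_cancel_left]
  have hcolors : M * m ≤ M * C + X := by
    have hsum : ∑ A ∈ (univ : Finset (Fin (j + m))).powersetCard j, m ≤
        ∑ A ∈ (univ : Finset (Fin (j + m))).powersetCard j,
          (C + #{T : Finset (Fin (j + m)) | IsMonoCherry c A T}) := by
      refine sum_le_sum fun A hA ↦ ?_
      have hAcard := (mem_powersetCard.1 hA).2
      have := card_compl_le_colors_add_cherries c A
      rw [card_compl, Fintype.card_fin, hAcard, Nat.add_sub_cancel_left] at this
      exact this
    simpa [sum_add_distrib] using hsum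
  have hMpos : 0 < M := Nat.choose_pos (by omega)
  have hmain : ((j + 1) * (j + 2)) * m ≤ ((j + 1) * (j + 2)) * C + m := by
    refine Nat.le_of_mul_le_mul_left ?_ hMpos
    calc M * ((j + 1) * (j + 2) * m) = (j + 1) * (j + 2) * (M * m) := by ring
      _ ≤ (j + 1) * (j + 2) * (M * C + X) := Nat.mul_le_mul_left _ hcolors
      _ = M * ((j + 1) * (j + 2) * C) + (j + 1 + 1) * X * (j + 1) := by ring
      _ ≤ M * ((j + 1) * (j + 2) * C) + (j + m).choose (j + 1) * (j + 1) := by gcongr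
      _ = M * ((j + 1) * (j + 2) * C + m) := by rw [hchoose]; ring
  have hreal : ((j + 1 : ℝ) * (j + 2)) * m ≤ ((j + 1) * (j + 2)) * C + m := by
    exact_mod_cast hmain
  push_cast
  rw [div_mul_eq_mul_div, div_le_iff₀ (by positivity)]
  linarith
end

section
/- There exists a constant C such that for all n ≥ 6 there is an edge-coloring of K_n using at most n²/4 + C·n colors in which every path on 6 vertices receives at least 4 distinct colors; that is, f(K_n, P_6, 4) ≤ n²/4 + O(n). -/
open Finset

/-- The number of distinct colors on the path `v 0 — v 1 — ⋯ — v (k-1)` on `k` vertices. -/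
def pathColorCount (n k : ℕ) (c : Sym2 (Fin n) → ℕ) (v : ℕ → Fin n) : ℕ :=
  ((Finset.range (k - 1)).image fun i => c s(v i, v (i + 1))).card

open Function

/-- A family of quadruples of points, each listing four distinct points, such that any two
distinct points lie in at most one quadruple. -/
def IsPacking {I V : Type} (p : I → Fin 4 → V) : Prop :=
  (∀ i, Injective (p i)) ∧
    ∀ i j a b a' b', a ≠ b → p i a = p j a' → p i b = p j b' → i = j

/-- There is a packing of `b` quadruples on `v` points. -/
def HasPacking (v b : ℕ) : Prop :=
  ∃ p : Fin b → Fin 4 → Fin v, IsPacking p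

theorem IsPacking.comp {I J V W : Type} {p : I → Fin 4 → V} (hp : IsPacking p)
    {f : V → W} (hf : Injective f) {g : J → I} (hg : Injective g) :
    IsPacking fun j a => f (p (g j) a) :=
  ⟨fun j => hf.comp (hp.1 (g j)), fun _ _ a b a' b' hab h h' =>
    hg (hp.2 _ _ a b a' b' hab (hf h) (hf h'))⟩

theorem IsPacking.hasPacking {I V : Type} [Fintype I] [Fintype V] {p : I → Fin 4 → V}
    (hp : IsPacking p) {v b : ℕ} (hv : Fintype.card V = v) (hb : Fintype.card I = b) :
    HasPacking v b :=
  ⟨_, hp.comp (Fintype.equivFinOfCardEq hv).injective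
    (Fintype.equivFinOfCardEq hb).symm.injective⟩

theorem HasPacking.exists_isPacking {v b : ℕ} (h : HasPacking v b) {V : Type} [Fintype V]
    (hV : Fintype.card V = v) : ∃ p : Fin b → Fin 4 → V, IsPacking p := by
  obtain ⟨p, hp⟩ := h
  exact ⟨_, hp.comp (Fintype.equivFinOfCardEq hV).symm.injective injective_id⟩

theorem HasPacking.mono {v w b : ℕ} (h : HasPacking v b) (hvw : v ≤ w) : HasPacking w b := by
  obtain ⟨p, hp⟩ := h
  exact ⟨_, hp.comp (Fin.castLE_injective hvw) injective_id⟩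

theorem hasPacking_zero (v : ℕ) : HasPacking v 0 :=
  ⟨fun i => i.elim0, fun i => i.elim0, fun i => i.elim0⟩

/-- A group divisible design with five groups of size three and blocks of size four, obtained from
the relative difference set `{0, 1, 3, 7}` in `ℤ/15`. -/
def fiveGroupDesign (k : Fin 15) (a : Fin 4) : Fin 5 × Fin 3 :=
  let s : ℕ := k + ![0, 1, 3, 7] a
  (Fin.ofNat 5 s, Fin.ofNat 3 s)

/-- A transversal design with four groups of size three, on the first four of five groups. -/
def fourGroupDesign (k : Fin 3 × Fin 3) (a : Fin 4) : Fin 5 × Fin 3 :=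
  (a.castSucc, ![k.1, k.2, k.1 + k.2, k.1 - k.2] a)

theorem fiveGroupDesign_fst_injective (k : Fin 15) :
    Injective fun a => (fiveGroupDesign k a).1 := by
  revert k; unfold Injective; decide +kernel

theorem fiveGroupDesign_isPacking : IsPacking fiveGroupDesign := by
  refine ⟨fun k a b h => fiveGroupDesign_fst_injective k (congrArg Prod.fst h), ?_⟩
  intro k k' a b a' b' hab ha hb
  let D : Fin 4 → ℕ := ![0, 1, 3, 7]
  have hD : ∀ a b a' b', a ≠ b → (D a + D b') % 15 = (D b + D a') % 15 → a = a' := by decide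
  have hmod : ∀ {a a'}, fiveGroupDesign k a = fiveGroupDesign k' a' →
      (k + D a) % 15 = (k' + D a') % 15 := by
    intro a a' h
    have h5 : (k + D a) % 5 = (k' + D a') % 5 := congrArg (fun P => (P.1 : ℕ)) h
    have h3 : (k + D a) % 3 = (k' + D a') % 3 := congrArg (fun P => (P.2 : ℕ)) h
    omega
  have ha' := hmod ha
  have hb' := hmod hb
  obtain rfl := hD a b a' b' hab (by omega)
  exact Fin.ext (by omega)

theorem fourGroupDesign_isPacking : IsPacking fourGroupDesign := by
  refine ⟨fun k a b h => Fin.castSucc_injective _ (congrArg Prod.fst h), ?_⟩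
  intro k k' a b a' b' hab ha hb
  obtain rfl : a = a' := Fin.castSucc_injective _ (congrArg Prod.fst ha)
  obtain rfl : b = b' := Fin.castSucc_injective _ (congrArg Prod.fst hb)
  revert k k' a b
  decide +kernel

/-- The point of group `g` on the line with parameters `x` and `z` in a transversal design with
five groups of size `m`. -/
def linePoint {m : ℕ} (x z : ZMod m) (g : Fin 5) : ZMod m :=
  if g = 4 then z else x + (g : ℕ) * z

theorem linePoint_inj {m : ℕ} (h2 : IsUnit (2 : ZMod m)) (h3 : IsUnit (3 : ZMod m))
    {x z x' z' : ZMod m} {g h : Fin 5} (hgh : g ≠ h)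
    (hg : linePoint x z g = linePoint x' z' g) (hh : linePoint x z h = linePoint x' z' h) :
    x = x' ∧ z = z' := by
  have key : z = z' := by
    fin_cases g <;> fin_cases h <;> simp [linePoint] at hgh hg hh <;> try assumption
    all_goals first
      | linear_combination hg - hh
      | linear_combination hh - hg
      | exact h2.mul_left_cancel (by linear_combination hg - hh)
      | exact h2.mul_left_cancel (by linear_combination hh - hg)
      | exact h3.mul_left_cancel (by linear_combination hg - hh)
      | exact h3.mul_left_cancel (by linear_combination hh - hg)
  subst key
  refine ⟨?_, rfl⟩
  unfold linePoint at hg hh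
  split_ifs at hg hh with h1 h2
  · exact absurd (h1.trans h2.symm) hgh
  · exact add_right_cancel hh
  all_goals exact add_right_cancel hg

/-- The index type of the blocks coming from the lines. -/
abbrev LineIndex {m : ℕ} (T : Finset (ZMod m)) : Type :=
  ZMod m × ((T × Fin 15) ⊕ ({z // z ∉ T} × (Fin 3 × Fin 3)))

/-- The direction of the line underlying a block. -/
def lineSlope {m : ℕ} {T : Finset (ZMod m)} : LineIndex T → ZMod m
  | (_, .inl (z, _)) => z
  | (_, .inr (z, _)) => z

/-- The block of the small design placed on a line. -/
def lineDesign {m : ℕ} {T : Finset (ZMod m)} : LineIndex T → Fin 4 → Fin 5 × Fin 3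
  | (_, .inl (_, k)) => fiveGroupDesign k
  | (_, .inr (_, k)) => fourGroupDesign k

/-- Five groups of points, the last one truncated to `T`, every point being tripled. -/
abbrev TruncatedPoint {m : ℕ} (T : Finset (ZMod m)) : Type :=
  (Fin 4 × (ZMod m × Fin 3)) ⊕ (T × Fin 3)

/-- Inclusion of the truncated point set in the full one. -/
def TruncatedPoint.toFull {m : ℕ} {T : Finset (ZMod m)} :
    TruncatedPoint T → Fin 5 × ZMod m × Fin 3
  | .inl (g, y, w) => (g.castSucc, y, w)
  | .inr (y, w) => (4, y, w)

theorem lineDesign_fst_injective {m : ℕ} {T : Finset (ZMod m)} (i : LineIndex T) :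
    Injective fun a => (lineDesign i a).1 := by
  obtain ⟨x, ⟨z, k⟩ | ⟨z, k⟩⟩ := i
  · exact fiveGroupDesign_fst_injective k
  · exact Fin.castSucc_injective _

theorem exists_truncated_lift {m : ℕ} {T : Finset (ZMod m)} (i : LineIndex T) (a : Fin 4) :
    ∃ P : TruncatedPoint T, P.toFull =
      ((lineDesign i a).1, linePoint i.1 (lineSlope i) (lineDesign i a).1, (lineDesign i a).2) := by
  by_cases h : (lineDesign i a).1 = 4
  · obtain ⟨x, ⟨z, k⟩ | ⟨z, k⟩⟩ := i
    · exact ⟨.inr (z, (lineDesign (x, .inl (z, k)) a).2),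
        by simp [TruncatedPoint.toFull, h, linePoint, lineSlope]⟩
    · exact absurd h (Fin.castSucc_lt_last a).ne
  · obtain ⟨g, hg⟩ := Fin.exists_castSucc_eq.2 h
    exact ⟨.inl (g, _, _), by rw [← hg]; rfl⟩

theorem exists_line_packing {m : ℕ} (h2 : IsUnit (2 : ZMod m)) (h3 : IsUnit (3 : ZMod m))
    (T : Finset (ZMod m)) :
    ∃ p : LineIndex T → Fin 4 → TruncatedPoint T, IsPacking p ∧
      ∀ i, Injective fun a => (p i a).toFull.1 := by
  choose p hp using exists_truncated_lift (T := T)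
  have hgroup : ∀ i, Injective fun a => (p i a).toFull.1 := fun i => by
    simpa only [hp] using lineDesign_fst_injective i
  refine ⟨p, ⟨fun i a b h => hgroup i (by simp only [h]), ?_⟩, hgroup⟩
  intro i j a b a' b' hab ha hb
  have ha' := hp i a
  have hb' := hp i b
  rw [ha, hp, Prod.mk.injEq, Prod.mk.injEq] at ha'
  rw [hb, hp, Prod.mk.injEq, Prod.mk.injEq] at hb'
  obtain ⟨ga, la, wa⟩ := ha'
  obtain ⟨gb, lb, wb⟩ := hb'
  rw [ga] at la
  rw [gb] at lb
  obtain ⟨hx, hz⟩ := linePoint_inj h2 h3 ((lineDesign_fst_injective i).ne hab) la lb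
  have da : lineDesign i a = lineDesign j a' := Prod.ext ga.symm wa.symm
  have db : lineDesign i b = lineDesign j b' := Prod.ext gb.symm wb.symm
  obtain ⟨x, ⟨z, k⟩ | ⟨z, k⟩⟩ := i <;> obtain ⟨x', ⟨z', k'⟩ | ⟨z', k'⟩⟩ := j <;>
    simp only [lineSlope] at hx hz
  · have hk := fiveGroupDesign_isPacking.2 k k' a b a' b' hab da db
    rw [hx, hk, Subtype.ext hz]
  · exact absurd (hz ▸ z.2) z'.2
  · exact absurd (hz ▸ z'.2) z.2
  · have hk := fourGroupDesign_isPacking.2 k k' a b a' b' hab da db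
    rw [hx, hk, Subtype.ext hz]

theorem HasPacking.truncated {m t b d : ℕ} [NeZero m] (h2 : IsUnit (2 : ZMod m))
    (h3 : IsUnit (3 : ZMod m)) (htm : t ≤ m) (hb : HasPacking (3 * m) b)
    (hd : HasPacking (3 * t) d) :
    HasPacking (3 * (4 * m + t)) (m * (t * 15 + (m - t) * 9) + (4 * b + d)) := by
  obtain ⟨T, hT⟩ : ∃ T : Finset (ZMod m), T.card = t := by
    obtain ⟨T, -, hT⟩ := Finset.exists_subset_card_eq (s := (univ : Finset (ZMod m)))
      (n := t) (by rwa [card_univ, ZMod.card])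
    exact ⟨T, hT⟩
  obtain ⟨p, hp, hpg⟩ := exists_line_packing h2 h3 T
  obtain ⟨q, hq⟩ := hb.exists_isPacking (V := ZMod m × Fin 3) (by simp [ZMod.card, mul_comm])
  obtain ⟨r, hr⟩ := hd.exists_isPacking (V := T × Fin 3) (by simp [hT, mul_comm])
  let P : LineIndex T ⊕ ((Fin 4 × Fin b) ⊕ Fin d) → Fin 4 → TruncatedPoint T
    | .inl i => p i
    | .inr (.inl (g, i)) => fun a => .inl (g, q i a)
    | .inr (.inr i) => fun a => .inr (r i a)
  have hgroup : ∀ i a b, (P (.inr i) a).toFull.1 = (P (.inr i) b).toFull.1 := by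
    rintro (⟨g, i⟩ | i) a b <;> rfl
  have hP : IsPacking P := by
    constructor
    · rintro (i | ⟨g, i⟩ | i)
      · exact hp.1 i
      · exact fun a b h => hq.1 i (Prod.ext_iff.1 (Sum.inl_injective h)).2
      · exact fun a b h => hr.1 i (Sum.inr_injective h)
    · rintro (i | i) (j | j) a b a' b' hab ha hb
      · exact congrArg _ (hp.2 i j a b a' b' hab ha hb)
      · refine absurd (hpg i ?_) hab
        change (P (.inl i) a).toFull.1 = (P (.inl i) b).toFull.1
        rw [ha, hb, hgroup]
      · have hab' : a' = b' := hpg j (by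
          change (P (.inl j) a').toFull.1 = (P (.inl j) b').toFull.1
          rw [← ha, ← hb, hgroup])
        subst hab'
        have hinj : Injective (P (.inr i)) := by
          rcases i with ⟨g, i⟩ | i
          · exact fun a b h => hq.1 i (Prod.ext_iff.1 (Sum.inl_injective h)).2
          · exact fun a b h => hr.1 i (Sum.inr_injective h)
        exact absurd (hinj (ha.trans hb.symm)) hab
      · rcases i with ⟨g, i⟩ | i <;> rcases j with ⟨g', j⟩ | j <;>
          simp only [P, Sum.inl.injEq, Sum.inr.injEq, Prod.mk.injEq, reduceCtorEq] at ha hb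
        · rw [ha.1, hq.2 i j a b a' b' hab ha.2 hb.2]
        · rw [hr.2 i j a b a' b' hab ha hb]
  refine hP.hasPacking ?_ ?_
  · simp [ZMod.card, hT]; ring
  · have hc : Fintype.card {z // z ∉ T} = m - t := by
      rw [Fintype.card_subtype_compl, ZMod.card, Fintype.card_coe, hT]
    simp only [Fintype.card_sum, Fintype.card_prod, ZMod.card, Fintype.card_coe, hT, hc,
      Fintype.card_fin]

/-- Near-optimal packings of quadruples exist on `3 * u` points. -/
theorem exists_dense_packing (u : ℕ) :
    ∃ b, HasPacking (3 * u) b ∧ 3 * u ^ 2 ≤ 4 * b + 300 * u := by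
  induction u using Nat.strong_induction_on with
  | _ u ih =>
    by_cases hu : u < 100
    · exact ⟨0, hasPacking_zero _, by nlinarith⟩
    obtain ⟨k, t, hk, htm, hut⟩ : ∃ k t, 4 ≤ k ∧ t ≤ 6 * k + 1 ∧ u = 4 * (6 * k + 1) + t :=
      ⟨(u - 4) / 24, u - 4 * (6 * ((u - 4) / 24) + 1), by omega, by omega, by omega⟩
    obtain ⟨m, hm⟩ : ∃ m, m = 6 * k + 1 := ⟨_, rfl⟩
    rw [← hm] at htm hut
    have : NeZero m := ⟨by omega⟩
    have hunit : (6 : ZMod m) * (-k) = 1 := by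
      have h : ((6 * k + 1 : ℕ) : ZMod m) = 0 := by rw [← hm]; exact ZMod.natCast_self m
      push_cast at h
      linear_combination -h
    have h2 : IsUnit (2 : ZMod m) :=
      IsUnit.of_mul_eq_one (3 * (-k)) (by linear_combination hunit)
    have h3 : IsUnit (3 : ZMod m) :=
      IsUnit.of_mul_eq_one (2 * (-k)) (by linear_combination hunit)
    obtain ⟨b, hb, hb'⟩ := ih m (by omega)
    obtain ⟨d, hd, hd'⟩ := ih t (by omega)
    refine ⟨_, hut ▸ hb.truncated h2 h3 htm hd, ?_⟩
    obtain ⟨s, rfl⟩ := Nat.exists_eq_add_of_le htm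
    rw [hut, Nat.add_sub_cancel_left]
    nlinarith

/-- The two edges `e` and `f` are complementary in a quadruple of the packing. -/
def IsOpposite {I V : Type} (p : I → Fin 4 → V) (e f : Sym2 V) : Prop :=
  ∃ i a b c d, [a, b, c, d].Nodup ∧ e = s(p i a, p i b) ∧ f = s(p i c, p i d)

theorem IsOpposite.symm {I V : Type} {p : I → Fin 4 → V} {e f : Sym2 V}
    (h : IsOpposite p e f) : IsOpposite p f e := by
  obtain ⟨i, a, b, c, d, hn, he, hf⟩ := h
  refine ⟨i, c, d, a, b, ?_, hf, he⟩
  revert hn; clear he hf; revert a b c d; decide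

/-- Equal pairs of points determine the quadruple and the positions in it. -/
theorem IsPacking.mk_eq_mk {I V : Type} {p : I → Fin 4 → V} (hp : IsPacking p) {i j : I}
    {a b c d : Fin 4} (hab : a ≠ b) (h : s(p i a, p i b) = s(p j c, p j d)) :
    i = j ∧ s(a, b) = s(c, d) := by
  rw [Sym2.eq_iff] at h
  obtain ⟨h, h'⟩ | ⟨h, h'⟩ := h
  all_goals
    obtain rfl := hp.2 i j _ _ _ _ hab h h'
    refine ⟨rfl, ?_⟩
    rw [hp.1 i h, hp.1 i h']
  exact Sym2.eq_swap

/-- Merging the two edges of each perfect matching of each quadruple. -/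
theorem IsPacking.exists_merging {I V : Type} {p : I → Fin 4 → V} (hp : IsPacking p) :
    ∃ c : Sym2 V → Sym2 V,
      (∀ e, ¬ e.IsDiag → ¬ (c e).IsDiag ∧ ∀ i a, a ≠ 0 → c e ≠ s(p i 0, p i a)) ∧
      ∀ e f, c e = c f → e = f ∨ IsOpposite p e f := by
  classical
  let σ : Fin 4 → Fin 4 := ![0, 2, 1, 1]
  let τ : Fin 4 → Fin 4 := ![0, 3, 3, 2]
  have hστ : ∀ a, a ≠ 0 → [0, a, σ a, τ a].Nodup := by decide
  have hne : ∀ a, a ≠ 0 → σ a ≠ τ a := by decide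
  have hinj : ∀ a b, a ≠ 0 → s(σ a, τ a) = s(σ b, τ b) → a = b := by decide
  have hzero : ∀ a b, a ≠ 0 → s(σ a, τ a) ≠ s(0, b) := by decide
  let c : Sym2 V → Sym2 V := fun e =>
    if h : ∃ x : I × Fin 4, x.2 ≠ 0 ∧ e = s(p x.1 0, p x.1 x.2) then
      s(p h.choose.1 (σ h.choose.2), p h.choose.1 (τ h.choose.2)) else e
  have hc : ∀ e, (∃ i a, a ≠ 0 ∧ e = s(p i 0, p i a) ∧ c e = s(p i (σ a), p i (τ a))) ∨
      ((∀ i a, a ≠ 0 → e ≠ s(p i 0, p i a)) ∧ c e = e) := by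
    intro e
    by_cases h : ∃ x : I × Fin 4, x.2 ≠ 0 ∧ e = s(p x.1 0, p x.1 x.2)
    · exact .inl ⟨_, _, h.choose_spec.1, h.choose_spec.2, dif_pos h⟩
    · exact .inr ⟨fun i a ha he => h ⟨(i, a), ha, he⟩, dif_neg h⟩
  refine ⟨c, fun e he => ?_, fun e f hef => ?_⟩
  · obtain ⟨i, a, ha, -, hce⟩ | ⟨hR, hce⟩ := hc e
    · rw [hce]
      refine ⟨fun h => hne a ha (hp.1 i (Sym2.mk_isDiag_iff.1 h)), fun j b hb h => ?_⟩
      exact hzero a b ha (hp.mk_eq_mk (hne a ha) h).2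
    · rw [hce]
      exact ⟨he, hR⟩
  · obtain ⟨i, a, ha, hea, hce⟩ | ⟨-, hce⟩ := hc e <;>
      obtain ⟨j, b, hb, hfb, hcf⟩ | ⟨-, hcf⟩ := hc f <;> rw [hce, hcf] at hef
    · obtain ⟨rfl, h⟩ := hp.mk_eq_mk (hne a ha) hef
      rw [hea, hfb, hinj a b ha h]
      exact .inl rfl
    · exact .inr ⟨i, 0, a, σ a, τ a, hστ a ha, hea, hef.symm⟩
    · exact .inr (IsOpposite.symm ⟨j, 0, b, σ b, τ b, hστ b hb, hfb, hef⟩)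
    · exact .inl hef

theorem four_le_card_image_of_unique_collision {α : Type} [DecidableEq α] (F : ℕ → α)
    (h : ∀ k l k' l', k < l → l < 5 → k' < l' → l' < 5 → F k = F l → F k' = F l' →
      k = k' ∧ l = l') :
    4 ≤ ((range 5).image F).card := by
  obtain ⟨r, hr, hinj⟩ : ∃ r < 5, Set.InjOn F ((range 5).erase r) := by
    by_cases hc : ∃ k l, k < l ∧ l < 5 ∧ F k = F l
    · obtain ⟨k, l, hkl, hl, hF⟩ := hc
      refine ⟨l, hl, fun x hx y hy hxy => ?_⟩
      simp only [coe_erase, coe_range, Set.mem_sdiff, Set.mem_Iio, Set.mem_singleton_iff] at hx hy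
      obtain hlt | heq | hlt := lt_trichotomy x y
      · exact absurd (h k l x y hkl hl hlt hy.1 hF hxy).2.symm hy.2
      · exact heq
      · exact absurd (h k l y x hkl hl hlt hx.1 hF hxy.symm).2.symm hx.2
    · push Not at hc
      refine ⟨0, by norm_num, fun x hx y hy hxy => ?_⟩
      simp only [coe_erase, coe_range, Set.mem_sdiff, Set.mem_Iio, Set.mem_singleton_iff] at hx hy
      obtain hlt | heq | hlt := lt_trichotomy x y
      · exact absurd hxy (hc x y hlt hy.1)
      · exact heq
      · exact absurd hxy.symm (hc y x hlt hx.1)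
  calc 4 = ((range 5).erase r).card := by rw [card_erase_of_mem (mem_range.2 hr)]; rfl
    _ = (((range 5).erase r).image F).card := (card_image_of_injOn hinj).symm
    _ ≤ _ := card_le_card (image_subset_image (erase_subset _ _))

/-- Two opposite edges of a path are not adjacent, and their four ends are exactly the vertices of
the path in their common quadruple. -/
theorem IsOpposite.exists_of_path {I : Type} {n : ℕ} {p : I → Fin 4 → Fin n} (hp : IsPacking p)
    {v : ℕ → Fin n} (hv : InjOnFirst n 6 v) {k l : ℕ} (hkl : k < l) (hl : l < 5)
    (h : IsOpposite p s(v k, v (k + 1)) s(v l, v (l + 1))) :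
    k + 1 < l ∧ ∃ i, ∀ x < 6, v x ∈ Set.range (p i) ↔ x = k ∨ x = k + 1 ∨ x = l ∨ x = l + 1 := by
  obtain ⟨i, a, b, c, d, hn, he, hf⟩ := h
  have hall : ∀ y, y = a ∨ y = b ∨ y = c ∨ y = d := by
    revert hn; clear he hf; revert a b c d; decide
  simp only [List.nodup_cons, List.mem_cons, List.not_mem_nil, not_or] at hn
  have hpi := hp.1 i
  rw [Sym2.eq_iff] at he hf
  constructor
  · by_contra hlt
    obtain rfl : l = k + 1 := by omega
    rcases he with ⟨h1, h2⟩ | ⟨h1, h2⟩ <;> rcases hf with ⟨h3, h4⟩ | ⟨h3, h4⟩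
    · exact hn.2.1.1 (hpi (h2.symm.trans h3))
    · exact hn.2.1.2.1 (hpi (h2.symm.trans h3))
    · exact hn.1.2.1 (hpi (h2.symm.trans h3))
    · exact hn.1.2.2.1 (hpi (h2.symm.trans h3))
  · refine ⟨i, fun x hx => ⟨?_, ?_⟩⟩
    · rintro ⟨y, hy⟩
      have hx' : v x = v k ∨ v x = v (k + 1) ∨ v x = v l ∨ v x = v (l + 1) := by
        rw [← hy]
        rcases hall y with rfl | rfl | rfl | rfl <;> rcases he with ⟨h1, h2⟩ | ⟨h1, h2⟩ <;>
          rcases hf with ⟨h3, h4⟩ | ⟨h3, h4⟩ <;> simp [h1, h2, h3, h4]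
      rcases hx' with h | h | h | h
      · exact .inl (hv _ _ hx (by omega) h)
      · exact .inr (.inl (hv _ _ hx (by omega) h))
      · exact .inr (.inr (.inl (hv _ _ hx (by omega) h)))
      · exact .inr (.inr (.inr (hv _ _ hx (by omega) h)))
    · rintro (rfl | rfl | rfl | rfl) <;> rcases he with ⟨h1, h2⟩ | ⟨h1, h2⟩ <;>
        rcases hf with ⟨h3, h4⟩ | ⟨h3, h4⟩ <;> simp [h1, h2, h3, h4]

theorem IsPacking.eq_of_mem_range {I V : Type} {p : I → Fin 4 → V} (hp : IsPacking p) {i j : I}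
    {x y : V} (hxy : x ≠ y) (hxi : x ∈ Set.range (p i)) (hyi : y ∈ Set.range (p i))
    (hxj : x ∈ Set.range (p j)) (hyj : y ∈ Set.range (p j)) : i = j := by
  obtain ⟨a, rfl⟩ := hxi
  obtain ⟨b, rfl⟩ := hyi
  obtain ⟨a', ha⟩ := hxj
  obtain ⟨b', hb⟩ := hyj
  exact hp.2 i j a b a' b' (fun h => hxy (by rw [h])) ha.symm hb.symm

/-- Two pairs of disjoint edges of a path on six vertices share at least two vertices. -/
theorem exists_common_vertices {k l k' l' : ℕ} (hkl : k + 1 < l) (hl : l < 5)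
    (hkl' : k' + 1 < l') (hl' : l' < 5) :
    ∃ x y, x < 6 ∧ y < 6 ∧ x ≠ y ∧ (x = k ∨ x = k + 1 ∨ x = l ∨ x = l + 1) ∧
      (y = k ∨ y = k + 1 ∨ y = l ∨ y = l + 1) ∧ (x = k' ∨ x = k' + 1 ∨ x = l' ∨ x = l' + 1) ∧
      (y = k' ∨ y = k' + 1 ∨ y = l' ∨ y = l' + 1) := by
  let A : Finset ℕ := {k, k + 1, l, l + 1}
  let B : Finset ℕ := {k', k' + 1, l', l' + 1}
  have hA : A.card = 4 := by
    repeat rw [card_insert_of_notMem (by simp; omega)]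
    simp
  have hB : B.card = 4 := by
    repeat rw [card_insert_of_notMem (by simp; omega)]
    simp
  have hU : (A ∪ B).card ≤ 6 := by
    refine (card_le_card (t := range 6) fun x hx => ?_).trans (card_range 6).le
    simp only [A, B, mem_union, mem_insert, mem_singleton] at hx
    rw [mem_range]
    omega
  have hI : 1 < (A ∩ B).card := by
    have := card_union_add_card_inter A B
    omega
  obtain ⟨x, hx, y, hy, hxy⟩ := one_lt_card.1 hI
  simp only [A, B, mem_inter, mem_insert, mem_singleton] at hx hy
  exact ⟨x, y, by omega, by omega, hxy, hx.1, hy.1, hx.2, hy.2⟩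

theorem IsPacking.opposite_unique_of_path {I : Type} {n : ℕ} {p : I → Fin 4 → Fin n}
    (hp : IsPacking p) {v : ℕ → Fin n} (hv : InjOnFirst n 6 v) {k l k' l' : ℕ}
    (hkl : k < l) (hl : l < 5) (hkl' : k' < l') (hl' : l' < 5)
    (h : IsOpposite p s(v k, v (k + 1)) s(v l, v (l + 1)))
    (h' : IsOpposite p s(v k', v (k' + 1)) s(v l', v (l' + 1))) : k = k' ∧ l = l' := by
  obtain ⟨hlt, i, hi⟩ := h.exists_of_path hp hv hkl hl
  obtain ⟨hlt', j, hj⟩ := h'.exists_of_path hp hv hkl' hl'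
  obtain ⟨x, y, hx, hy, hxy, hxi, hyi, hxj, hyj⟩ := exists_common_vertices hlt hl hlt' hl'
  obtain rfl : i = j := hp.eq_of_mem_range (fun h => hxy (hv x y hx hy h))
    ((hi x hx).2 hxi) ((hi y hy).2 hyi) ((hj x hx).2 hxj) ((hj y hy).2 hyj)
  have key := fun x hx => (hi x hx).symm.trans (hj x hx)
  have := key k (by omega)
  have := key (k + 1) (by omega)
  have := key l (by omega)
  have := key (l + 1) (by omega)
  have := key k' (by omega)
  have := key (k' + 1) (by omega)
  have := key l' (by omega)
  have := key (l' + 1) (by omega)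
  omega

/-- A packing of `b` quadruples saves `3 * b` colors. -/
theorem HasPacking.exists_coloring {n b : ℕ} (h : HasPacking n b) :
    ∃ c : Sym2 (Fin n) → ℕ, usedColors n c + 3 * b ≤ n.choose 2 ∧
      ∀ v : ℕ → Fin n, InjOnFirst n 6 v → 4 ≤ pathColorCount n 6 c v := by
  obtain ⟨p, hp⟩ := h
  obtain ⟨c, hc, hcol⟩ := hp.exists_merging
  obtain ⟨f, hf⟩ := exists_injective_nat (Sym2 (Fin n))
  refine ⟨fun e => f (c e), ?_, fun v hv => ?_⟩
  · let S : Finset (Sym2 (Fin n)) := univ.filter fun e => ¬ e.IsDiag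
    let R : Finset (Sym2 (Fin n)) := (univ : Finset (Fin b × Fin 3)).image
      fun x => s(p x.1 0, p x.1 x.2.succ)
    have hS : S.card = n.choose 2 := by
      have := Sym2.card_subtype_not_diag (α := Fin n)
      rwa [Fintype.card_subtype, Fintype.card_fin] at this
    have hR : R.card = 3 * b := by
      rw [card_image_of_injective, card_univ, Fintype.card_prod, Fintype.card_fin,
        Fintype.card_fin, mul_comm]
      rintro ⟨i, a⟩ ⟨j, a'⟩ hij
      obtain ⟨rfl, h⟩ := hp.mk_eq_mk (Fin.succ_ne_zero a).symm hij
      rw [Sym2.congr_right] at h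
      rw [Fin.succ_injective _ h]
    have hRS : R ⊆ S := by
      intro e he
      obtain ⟨⟨i, a⟩, -, rfl⟩ := mem_image.1 he
      exact mem_filter.2 ⟨mem_univ _, fun hd =>
        (Fin.succ_ne_zero a).symm (hp.1 i (Sym2.mk_isDiag_iff.1 hd))⟩
    have himage : S.image (fun e => f (c e)) ⊆ (S \ R).image f := by
      intro y hy
      obtain ⟨e, he, rfl⟩ := mem_image.1 hy
      obtain ⟨hd, hne⟩ := hc e (mem_filter.1 he).2
      refine mem_image_of_mem f (mem_sdiff.2 ⟨mem_filter.2 ⟨mem_univ _, hd⟩, fun hmem => ?_⟩)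
      obtain ⟨⟨i, a⟩, -, h⟩ := mem_image.1 hmem
      exact hne i a.succ (Fin.succ_ne_zero a) h.symm
    calc usedColors n (fun e => f (c e)) + 3 * b ≤ (S \ R).card + R.card :=
          add_le_add ((card_le_card himage).trans card_image_le) hR.ge
      _ = n.choose 2 := by rw [card_sdiff_add_card_eq_card hRS, hS]
  · have hopp : ∀ k l, k < l → l < 5 →
        f (c s(v k, v (k + 1))) = f (c s(v l, v (l + 1))) →
        IsOpposite p s(v k, v (k + 1)) s(v l, v (l + 1)) := by
      intro k l hkl hl hF
      refine (hcol _ _ (hf hF)).resolve_left fun heq => ?_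
      rw [Sym2.eq_iff] at heq
      obtain ⟨h1, -⟩ | ⟨h1, -⟩ := heq
      · have := hv _ _ (by omega) (by omega) h1
        omega
      · have := hv _ _ (by omega) (by omega) h1
        omega
    exact four_le_card_image_of_unique_collision _ fun k l k' l' hkl hl hkl' hl' hF hF' =>
      hp.opposite_unique_of_path hv hkl hl hkl' hl' (hopp k l hkl hl hF) (hopp k' l' hkl' hl' hF')

/-- There is a constant `C` such that for all `n ≥ 6` there is an
edge-coloring of `K_n` with at most `n²/4 + C·n` colors in which every path on 6
vertices receives at least 4 distinct colors. -/
theorem generalized_ramsey_P6_upper :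
    ∃ C : ℝ, ∀ n : ℕ, 6 ≤ n →
      ∃ c : Sym2 (Fin n) → ℕ,
        (usedColors n c : ℝ) ≤ (n : ℝ) ^ 2 / 4 + C * n ∧
        ∀ v : ℕ → Fin n, InjOnFirst n 6 v → 4 ≤ pathColorCount n 6 c v := by
  refine ⟨76, fun n _ => ?_⟩
  obtain ⟨b, hb, hbu⟩ := exists_dense_packing (n / 3)
  obtain ⟨c, hc, hpath⟩ := (hb.mono (Nat.mul_div_le n 3)).exists_coloring
  refine ⟨c, ?_, hpath⟩
  have hn : n ≤ 3 * (n / 3) + 2 := by omega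
  have hn' : 3 * (n / 3) ≤ n := by omega
  generalize n / 3 = u at hbu hn hn'
  have hc' : (usedColors n c : ℝ) + 3 * b ≤ n * (n - 1) / 2 := by
    rw [← Nat.cast_choose_two]
    exact_mod_cast hc
  have hbu' : 3 * (u : ℝ) ^ 2 ≤ 4 * b + 300 * u := by exact_mod_cast hbu
  have h1 : (n : ℝ) ≤ 3 * u + 2 := by exact_mod_cast hn
  have h2 : 3 * (u : ℝ) ≤ n := by exact_mod_cast hn'
  have h3 : (0 : ℝ) ≤ u := u.cast_nonneg
  nlinarith
end

section
/- For all n ≥ 6, every edge-coloring of K_n in which each path on 6 vertices receives at least 4 distinct colors uses at least C(n−3,2)/2 colors; in particular f(K_n, P_6, 4) ≥ n²/4 + O(n). -/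
open Finset

/-- Every path on six vertices receives at least four colors. -/
def PathSixColoring {n : ℕ} (c : Sym2 (Fin n) → ℕ) : Prop :=
  ∀ a b d e f g : Fin n, [a, b, d, e, f, g].Nodup →
    4 ≤ ({c s(a, b), c s(b, d), c s(d, e), c s(e, f), c s(f, g)} : Finset ℕ).card

theorem pathSixColoring_of_pathColorCount {n : ℕ} {c : Sym2 (Fin n) → ℕ}
    (h : ∀ v : ℕ → Fin n, InjOnFirst n 6 v → 4 ≤ pathColorCount n 6 c v) :
    PathSixColoring c := by
  intro a b d e f g hnd
  have key := h (fun i => [a, b, d, e, f, g].getD i a) (by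
    intro i j hi hj hij
    have hi' : i < [a, b, d, e, f, g].length := hi
    have hj' : j < [a, b, d, e, f, g].length := hj
    simp only [List.getD_eq_getElem _ _ hi', List.getD_eq_getElem _ _ hj'] at hij
    exact (hnd.getElem_inj_iff).1 hij)
  refine key.trans (Finset.card_le_card ?_)
  intro x hx
  simp only [Finset.mem_image, Finset.mem_range] at hx
  obtain ⟨i, hi, rfl⟩ := hx
  have : i < 5 := hi
  interval_cases i <;> simp

namespace PathSixColoring

variable {n : ℕ} {c : Sym2 (Fin n) → ℕ}

theorem card_path_five (hc : PathSixColoring c) (hn : 6 ≤ n) {a b d e f : Fin n}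
    (hnd : [a, b, d, e, f].Nodup) :
    3 ≤ ({c s(a, b), c s(b, d), c s(d, e), c s(e, f)} : Finset ℕ).card := by
  obtain ⟨g, hg⟩ : ∃ g, g ∉ ({a, b, d, e, f} : Finset (Fin n)) := by
    by_contra! hall
    have h1 := Finset.card_le_card (fun x _ => hall x : (Finset.univ : Finset (Fin n)) ⊆ _)
    have h2 := Finset.card_le_five (a := a) (b := b) (c := d) (d := e) (e := f)
    simp only [Finset.card_univ, Fintype.card_fin] at h1
    omega
  have h6 := hc g a b d e f (by simp_all)
  have := Finset.card_insert_le (c s(g, a)) {c s(a, b), c s(b, d), c s(d, e), c s(e, f)}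
  omega

theorem card_path_four (hc : PathSixColoring c) (hn : 6 ≤ n) {a b d e : Fin n}
    (hnd : [a, b, d, e].Nodup) :
    2 ≤ ({c s(a, b), c s(b, d), c s(d, e)} : Finset ℕ).card := by
  obtain ⟨g, hg⟩ : ∃ g, g ∉ ({a, b, d, e} : Finset (Fin n)) := by
    by_contra! hall
    have h1 := Finset.card_le_card (fun x _ => hall x : (Finset.univ : Finset (Fin n)) ⊆ _)
    have h2 := Finset.card_le_four (a := a) (b := b) (c := d) (d := e)
    simp only [Finset.card_univ, Fintype.card_fin] at h1
    omega
  have h5 := hc.card_path_five hn (a := g) (b := a) (d := b) (e := d) (f := e) (by simp_all)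
  have := Finset.card_insert_le (c s(g, a)) {c s(a, b), c s(b, d), c s(d, e)}
  omega

/-- No monochromatic `P₄`. -/
theorem not_mono_path_four (hc : PathSixColoring c) (hn : 6 ≤ n) {a b d e : Fin n}
    (hnd : [a, b, d, e].Nodup) (h1 : c s(a, b) = c s(b, d)) (h2 : c s(b, d) = c s(d, e)) :
    False := by
  have := hc.card_path_four hn hnd
  simp [h1, h2] at this

/-- No monochromatic `P₃ + P₂`. -/
theorem not_mono_path_three_add_edge (hc : PathSixColoring c) (hn : 6 ≤ n) {a b d e f : Fin n}
    (hnd : [a, b, d, e, f].Nodup) (h1 : c s(a, b) = c s(b, d)) (h2 : c s(b, d) = c s(e, f)) :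
    False := by
  have := hc.card_path_five hn hnd
  have h3 : ({c s(a, b), c s(b, d), c s(d, e), c s(e, f)} : Finset ℕ) ⊆
      {c s(b, d), c s(d, e)} := by
    intro x hx
    simp only [Finset.mem_insert, Finset.mem_singleton] at hx ⊢
    grind
  have := (Finset.card_le_card h3).trans Finset.card_le_two
  omega

/-- No monochromatic `3 K₂`. -/
theorem not_mono_three_edges (hc : PathSixColoring c) {a b d e f g : Fin n}
    (hnd : [a, b, d, e, f, g].Nodup) (h1 : c s(a, b) = c s(d, e)) (h2 : c s(d, e) = c s(f, g)) :
    False := by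
  have := hc _ _ _ _ _ _ hnd
  have h3 : ({c s(a, b), c s(b, d), c s(d, e), c s(e, f), c s(f, g)} : Finset ℕ) ⊆
      {c s(b, d), c s(d, e), c s(e, f)} := by
    intro x hx
    simp only [Finset.mem_insert, Finset.mem_singleton] at hx ⊢
    grind
  have := (Finset.card_le_card h3).trans Finset.card_le_three
  omega

/-- No two monochromatic copies of `P₃` on disjoint vertex sets. -/
theorem not_two_cherries (hc : PathSixColoring c) {a b d e f g : Fin n}
    (hnd : [a, b, d, e, f, g].Nodup) (h1 : c s(a, b) = c s(b, d)) (h2 : c s(e, f) = c s(f, g)) :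
    False := by
  have := hc _ _ _ _ _ _ hnd
  have h3 : ({c s(a, b), c s(b, d), c s(d, e), c s(e, f), c s(f, g)} : Finset ℕ) ⊆
      {c s(b, d), c s(d, e), c s(f, g)} := by
    intro x hx
    simp only [Finset.mem_insert, Finset.mem_singleton] at hx ⊢
    grind
  have := (Finset.card_le_card h3).trans Finset.card_le_three
  omega

/-- No two monochromatic copies of `P₃` forming a `P₅`. -/
theorem not_two_cherries_common_end (hc : PathSixColoring c) (hn : 6 ≤ n) {a b d e f : Fin n}
    (hnd : [a, b, d, e, f].Nodup) (h1 : c s(a, b) = c s(b, d)) (h2 : c s(d, e) = c s(e, f)) :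
    False := by
  have := hc.card_path_five hn hnd
  have h3 : ({c s(a, b), c s(b, d), c s(d, e), c s(e, f)} : Finset ℕ) ⊆
      {c s(b, d), c s(e, f)} := by
    intro x hx
    simp only [Finset.mem_insert, Finset.mem_singleton] at hx ⊢
    grind
  have := (Finset.card_le_card h3).trans Finset.card_le_two
  omega

end PathSixColoring

/-- The vertex `u` is the center of a monochromatic `K_{1,3}`. -/
def IsMonoClaw {n : ℕ} (c : Sym2 (Fin n) → ℕ) (u : Fin n) : Prop :=
  ∃ x y z, [u, x, y, z].Nodup ∧ c s(u, x) = c s(u, y) ∧ c s(u, y) = c s(u, z)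

/-- The vertices `x, y, z` span a monochromatic triangle. -/
def IsMonoTriangle {n : ℕ} (c : Sym2 (Fin n) → ℕ) (x y z : Fin n) : Prop :=
  [x, y, z].Nodup ∧ c s(x, y) = c s(y, z) ∧ c s(y, z) = c s(x, z)

theorem IsMonoTriangle.rotate {n : ℕ} {c : Sym2 (Fin n) → ℕ} {x y z : Fin n}
    (h : IsMonoTriangle c x y z) : IsMonoTriangle c y z x := by
  obtain ⟨h1, h2, h3⟩ := h
  refine ⟨by simp at h1 ⊢; grind, ?_, ?_⟩ <;> grind [Sym2.eq_swap]

theorem IsMonoTriangle.swap {n : ℕ} {c : Sym2 (Fin n) → ℕ} {x y z : Fin n}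
    (h : IsMonoTriangle c x y z) : IsMonoTriangle c y x z := by
  obtain ⟨h1, h2, h3⟩ := h
  refine ⟨by simp at h1 ⊢; grind, ?_, ?_⟩ <;> grind [Sym2.eq_swap]

namespace PathSixColoring

variable {n : ℕ} {c : Sym2 (Fin n) → ℕ}

private theorem false_of_claw_of_cherry (hc : PathSixColoring c) (hn : 6 ≤ n)
    {u v a b x y z : Fin n} (hab : [u, v, a, b].Nodup)
    (hu : c s(u, a) = c s(u, b)) (hx : [u, v, x, y, z].Nodup)
    (h1 : c s(v, x) = c s(v, y)) (h2 : c s(v, y) = c s(v, z)) : False := by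
  -- `q` is a leaf at `v` outside `{a, b}` and `p` is another leaf.
  have key : ∃ p q, c s(v, p) = c s(v, q) ∧ [u, v, p, q].Nodup ∧ q ≠ a ∧ q ≠ b := by
    simp at hab hx
    by_cases hz : z = a ∨ z = b
    · by_cases hy : y = a ∨ y = b
      · exact ⟨y, x, h1.symm, by simp; grind, by grind, by grind⟩
      · exact ⟨x, y, h1, by simp; grind, by grind, by grind⟩
    · exact ⟨y, z, h2, by simp; grind, by grind, by grind⟩
  obtain ⟨p, q, hpq, hnd, hqa, hqb⟩ := key
  simp at hab hnd
  have e1 : c s(a, u) = c s(u, b) := by rw [← hu, Sym2.eq_swap]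
  have e2 : c s(b, u) = c s(u, a) := by rw [hu, Sym2.eq_swap]
  have e3 : c s(p, v) = c s(v, q) := by rw [← hpq, Sym2.eq_swap]
  by_cases hpa : p = a
  · subst hpa
    exact hc.not_two_cherries_common_end hn (by simp; grind) e2 e3
  by_cases hpb : p = b
  · subst hpb
    exact hc.not_two_cherries_common_end hn (by simp; grind) e1 e3
  exact hc.not_two_cherries (by simp; grind) e1 e3

theorem claw_center_unique (hc : PathSixColoring c) (hn : 6 ≤ n) {u v : Fin n}
    (hu : IsMonoClaw c u) (hv : IsMonoClaw c v) : u = v := by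
  by_contra huv
  obtain ⟨x, y, z, hxyz, h1, h2⟩ := hu
  obtain ⟨p, q, r, hpqr, h3, h4⟩ := hv
  simp at hxyz hpqr
  by_cases hvx : v = x ∨ v = y ∨ v = z
  · by_cases hup : u = p ∨ u = q ∨ u = r
    · have hd : ∃ a b, c s(u, a) = c s(u, v) ∧ c s(v, b) = c s(v, u) ∧ [a, u, v, b].Nodup := by
        have ha : ∃ a a', a ≠ a' ∧ c s(u, a) = c s(u, v) ∧ c s(u, a') = c s(u, v) ∧ a ≠ u ∧
            a ≠ v ∧ a' ≠ u ∧ a' ≠ v := by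
          rcases hvx with rfl | rfl | rfl
          · exact ⟨y, z, by grind⟩
          · exact ⟨x, z, by grind⟩
          · exact ⟨x, y, by grind⟩
        have hb : ∃ b, c s(v, b) = c s(v, u) ∧ b ≠ u ∧ b ≠ v := by
          rcases hup with rfl | rfl | rfl
          · exact ⟨q, by grind⟩
          · exact ⟨p, by grind⟩
          · exact ⟨p, by grind⟩
        obtain ⟨a, a', ha⟩ := ha
        obtain ⟨b, hb⟩ := hb
        by_cases hab : a = b
        · exact ⟨a', b, by grind, by grind, by simp; grind⟩
        · exact ⟨a, b, by grind, by grind, by simp; grind⟩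
      obtain ⟨a, b, ha, hb, hnd⟩ := hd
      exact hc.not_mono_path_four hn hnd (by rw [← ha, Sym2.eq_swap])
        (by rw [hb, Sym2.eq_swap])
    · have ha : ∃ a a', c s(u, a) = c s(u, a') ∧ [u, v, a, a'].Nodup := by
        rcases hvx with rfl | rfl | rfl
        · exact ⟨y, z, by grind, by simp; grind⟩
        · exact ⟨x, z, by grind, by simp; grind⟩
        · exact ⟨x, y, by grind, by simp; grind⟩
      obtain ⟨a, a', ha, hnd⟩ := ha
      exact hc.false_of_claw_of_cherry hn hnd ha (by simp; grind) h3 h4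
  · have ha : ∃ a a', c s(v, a) = c s(v, a') ∧ [v, u, a, a'].Nodup := by
      by_cases hp : u = p
      · exact ⟨q, r, by grind, by simp; grind⟩
      by_cases hq : u = q
      · exact ⟨p, r, by grind, by simp; grind⟩
      · exact ⟨p, q, by grind, by simp; grind⟩
    obtain ⟨a, a', ha, hnd⟩ := ha
    exact hc.false_of_claw_of_cherry hn hnd ha (by simp; grind) h1 h2

private theorem mem_of_triangle_of_common (hc : PathSixColoring c) (hn : 6 ≤ n)
    {x y z q r : Fin n} (h : IsMonoTriangle c x y z) (h' : IsMonoTriangle c x q r) :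
    y = q ∨ y = r := by
  by_contra hy
  obtain ⟨h1, h2, h3⟩ := h
  obtain ⟨h4, h5, h6⟩ := h'
  simp at h1 h4
  by_cases hz : z = q
  · subst hz
    exact hc.not_mono_path_four hn (a := y) (b := x) (d := z) (e := r) (by simp; grind)
      (by grind [Sym2.eq_swap]) (by grind [Sym2.eq_swap])
  by_cases hz : z = r
  · subst hz
    exact hc.not_mono_path_four hn (a := y) (b := x) (d := z) (e := q) (by simp; grind)
      (by grind [Sym2.eq_swap]) (by grind [Sym2.eq_swap])
  exact hc.not_two_cherries_common_end hn (a := y) (b := z) (d := x) (e := q) (f := r)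
    (by simp; grind) (by grind [Sym2.eq_swap]) (by grind [Sym2.eq_swap])

theorem mem_of_triangle (hc : PathSixColoring c) (hn : 6 ≤ n) {x y z p q r : Fin n}
    (h : IsMonoTriangle c x y z) (h' : IsMonoTriangle c p q r) : x = p ∨ x = q ∨ x = r := by
  by_contra hx
  have hcommon : ∀ {p q r : Fin n}, IsMonoTriangle c p q r → x ≠ p → x ≠ q → x ≠ r →
      y ≠ p ∧ z ≠ p := by
    intro p q r h' hp hq hr
    refine ⟨?_, ?_⟩
    · rintro rfl
      rcases hc.mem_of_triangle_of_common hn h.swap h' with h | h <;> grind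
    · rintro rfl
      rcases hc.mem_of_triangle_of_common hn h.rotate.rotate h' with h | h <;> grind
  have k1 := hcommon h' (by grind) (by grind) (by grind)
  have k2 := hcommon h'.rotate (by grind) (by grind) (by grind)
  have k3 := hcommon h'.rotate.rotate (by grind) (by grind) (by grind)
  obtain ⟨h1, h2, h3⟩ := h
  obtain ⟨h4, h5, h6⟩ := h'
  simp at h1 h4
  exact hc.not_two_cherries (by simp; grind) h2 h5

private theorem claw_or_triangle_of_adjacent (hc : PathSixColoring c) (hn : 6 ≤ n)
    {u a b p q : Fin n} (hua : u ≠ a) (hub : u ≠ b) (hab : a ≠ b) (hpq : p ≠ q)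
    (h1 : s(p, q) ≠ s(u, a)) (h2 : s(p, q) ≠ s(u, b))
    (e1 : c s(u, a) = c s(u, b)) (e2 : c s(u, b) = c s(p, q)) :
    (IsMonoClaw c u ∧ (u = p ∨ u = q)) ∨ IsMonoTriangle c u a b ∧ s(p, q) = s(a, b) := by
  simp only [ne_eq, Sym2.eq_iff, not_or, not_and] at h1 h2
  have key : ∀ p q : Fin n, p ≠ q → c s(u, b) = c s(p, q) → p ≠ u → q ≠ u → q ≠ a → q ≠ b →
      False := by
    intro p q hpq e2 hpu hqu hqa hqb
    by_cases hpa : p = a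
    · subst hpa
      exact hc.not_mono_path_four hn (a := b) (b := u) (d := p) (e := q) (by simp; grind)
        (by grind [Sym2.eq_swap]) (by grind [Sym2.eq_swap])
    by_cases hpb : p = b
    · subst hpb
      exact hc.not_mono_path_four hn (a := a) (b := u) (d := p) (e := q) (by simp; grind)
        (by grind [Sym2.eq_swap]) (by grind [Sym2.eq_swap])
    exact hc.not_mono_path_three_add_edge hn (a := a) (b := u) (d := b) (e := p) (f := q)
      (by simp; grind) (by grind [Sym2.eq_swap]) e2
  by_cases hup : u = p
  · subst hup
    exact .inl ⟨⟨a, b, q, by simp; grind, e1, e2⟩, .inl rfl⟩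
  by_cases huq : u = q
  · subst huq
    exact .inl ⟨⟨a, b, p, by simp; grind, e1, by grind [Sym2.eq_swap]⟩, .inr rfl⟩
  have k1 := key p q hpq e2
  have k2 := key q p hpq.symm (by grind [Sym2.eq_swap])
  have hs : s(p, q) = s(a, b) := by
    rw [Sym2.eq_iff]
    grind
  exact .inr ⟨⟨by simp; grind, by grind, by grind⟩, hs⟩

/-- Two disjoint edges of the same color form a complete color class. -/
private theorem false_of_disjoint (hc : PathSixColoring c) (hn : 6 ≤ n)
    {a b x y p q : Fin n} (hnd : [a, b, x, y].Nodup) (hpq : p ≠ q)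
    (h1 : s(p, q) ≠ s(a, b)) (h2 : s(p, q) ≠ s(x, y))
    (e1 : c s(a, b) = c s(x, y)) (e2 : c s(x, y) = c s(p, q)) : False := by
  have key : ∀ a b x y p q : Fin n, [a, b, x, y].Nodup → p ≠ q → s(p, q) ≠ s(a, b) →
      c s(a, b) = c s(x, y) → c s(x, y) = c s(p, q) → p ≠ a := by
    intro a b x y p q hnd hpq h1 e1 e2 hpa
    subst hpa
    simp at hnd
    have hb : q ≠ b := by rintro rfl; exact h1 rfl
    rcases hc.claw_or_triangle_of_adjacent hn (u := p) (a := b) (b := q) (p := x) (q := y)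
      (by grind) (by grind) (by grind) (by grind) (by rw [ne_eq, Sym2.eq_iff]; grind)
      (by rw [ne_eq, Sym2.eq_iff]; grind) (by grind) (by grind) with h | h
    · grind
    · rw [Sym2.eq_iff] at h
      grind
  have swp : ∀ a b : Fin n, s(a, b) = s(b, a) := fun _ _ => Sym2.eq_swap
  simp at hnd
  have := key a b x y p q (by simp; grind) hpq h1 e1 e2
  have := key b a x y p q (by simp; grind) hpq (by grind) (by grind) e2
  have := key x y a b p q (by simp; grind) hpq h2 (by grind) (by grind)
  have := key y x a b p q (by simp; grind) hpq (by grind) (by grind) (by grind)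
  have := key a b x y q p (by simp; grind) hpq.symm (by grind) e1 (by grind)
  have := key b a x y q p (by simp; grind) hpq.symm (by grind) (by grind) (by grind)
  have := key x y a b q p (by simp; grind) hpq.symm (by grind) (by grind) (by grind)
  have := key y x a b q p (by simp; grind) hpq.symm (by grind) (by grind) (by grind)
  exact hc.not_mono_three_edges (by simp; grind) e1 e2

/-- Three edges of the same color form a claw or a triangle. -/
theorem claw_or_triangle (hc : PathSixColoring c) (hn : 6 ≤ n) {e₁ e₂ e₃ : Sym2 (Fin n)}
    (d₁ : ¬ e₁.IsDiag) (d₂ : ¬ e₂.IsDiag) (d₃ : ¬ e₃.IsDiag)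
    (h₁₂ : e₁ ≠ e₂) (h₁₃ : e₁ ≠ e₃) (h₂₃ : e₂ ≠ e₃) (c₁ : c e₁ = c e₂) (c₂ : c e₂ = c e₃) :
    (∃ u, IsMonoClaw c u ∧ u ∈ e₁) ∨
      ∃ x y z, IsMonoTriangle c x y z ∧ e₁ = s(x, y) ∧ e₂ = s(x, z) ∧ e₃ = s(y, z) := by
  have adj : ∀ u a b : Fin n, e₁ = s(u, a) → e₂ = s(u, b) →
      (∃ u, IsMonoClaw c u ∧ u ∈ e₁) ∨
      ∃ x y z, IsMonoTriangle c x y z ∧ e₁ = s(x, y) ∧ e₂ = s(x, z) ∧ e₃ = s(y, z) := by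
    rintro u a b rfl rfl
    induction e₃ using Sym2.ind with | _ p q => ?_
    simp only [Sym2.mk_isDiag_iff] at d₁ d₂ d₃
    rcases hc.claw_or_triangle_of_adjacent hn d₁ d₂ (by rintro rfl; exact h₁₂ rfl) d₃
      h₁₃.symm h₂₃.symm c₁ c₂ with h | h
    · exact .inl ⟨u, h.1, by simp⟩
    · exact .inr ⟨u, a, b, h.1, rfl, rfl, h.2⟩
  induction e₁ using Sym2.ind with | _ a b => ?_
  induction e₂ using Sym2.ind with | _ x y => ?_
  by_cases hax : a = x
  · exact adj a b y rfl (by rw [hax])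
  by_cases hay : a = y
  · exact adj a b x rfl (by rw [hay, Sym2.eq_swap])
  by_cases hbx : b = x
  · exact adj b a y Sym2.eq_swap (by rw [hbx])
  by_cases hby : b = y
  · exact adj b a x Sym2.eq_swap (by rw [hby, Sym2.eq_swap])
  induction e₃ using Sym2.ind with | _ p q => ?_
  simp only [Sym2.mk_isDiag_iff] at d₁ d₂ d₃
  exact (hc.false_of_disjoint hn (by simp; grind) d₃ h₁₃.symm h₂₃.symm c₁ c₂).elim

/-- Some set of at most two vertices meets every monochromatic claw in its center and every
monochromatic triangle. -/
theorem exists_hitting_set (hc : PathSixColoring c) (hn : 6 ≤ n) :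
    ∃ S : Finset (Fin n), S.card ≤ 2 ∧ (∀ u, IsMonoClaw c u → u ∈ S) ∧
      ∀ x y z, IsMonoTriangle c x y z → x ∈ S ∨ y ∈ S ∨ z ∈ S := by
  have hu : ∃ u, ∀ v, IsMonoClaw c v → v = u := by
    by_cases h : ∃ u, IsMonoClaw c u
    · obtain ⟨u, hu⟩ := h
      exact ⟨u, fun v hv => hc.claw_center_unique hn hv hu⟩
    · exact ⟨⟨0, by omega⟩, fun v hv => (h ⟨v, hv⟩).elim⟩
  have ht : ∃ t, ∀ x y z, IsMonoTriangle c x y z → t = x ∨ t = y ∨ t = z := by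
    by_cases h : ∃ x y z, IsMonoTriangle c x y z
    · obtain ⟨t, y, z, ht⟩ := h
      exact ⟨t, fun _ _ _ h' => hc.mem_of_triangle hn ht h'⟩
    · exact ⟨⟨0, by omega⟩, fun x y z hv => (h ⟨x, y, z, hv⟩).elim⟩
  obtain ⟨u, hu⟩ := hu
  obtain ⟨t, ht⟩ := ht
  refine ⟨{u, t}, Finset.card_le_two, fun v hv => by simp [hu v hv], fun x y z h => ?_⟩
  rcases ht x y z h with rfl | rfl | rfl <;> simp

end PathSixColoring

/-- For all `n ≥ 6`, every edge-coloring of `K_n` in which every path on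
6 vertices receives at least 4 distinct colors uses at least `C(n−3,2)/2` colors. -/
theorem generalized_ramsey_P6_lower (n : ℕ) (hn : 6 ≤ n) (c : Sym2 (Fin n) → ℕ)
    (h : ∀ v : ℕ → Fin n, InjOnFirst n 6 v → 4 ≤ pathColorCount n 6 c v) :
    ((n - 3).choose 2 : ℝ) / 2 ≤ usedColors n c := by
  have hc := pathSixColoring_of_pathColorCount h
  obtain ⟨S, hS, hclaw, htri⟩ := hc.exists_hitting_set hn
  -- The edges avoiding `S`.
  set E : Finset (Sym2 (Fin n)) := Sᶜ.sym2.filter fun e => ¬ e.IsDiag with hE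
  have hmem : ∀ e ∈ E, ∀ v ∈ e, v ∉ S := by
    intro e he v hv
    have := Finset.mem_sym2_iff.1 (Finset.mem_filter.1 he).1 v hv
    simpa using this
  have hclass : ∀ k ∈ E.image c, (E.filter fun e => c e = k).card ≤ 2 := by
    intro k _
    by_contra! hk
    obtain ⟨e₁, e₂, e₃, m₁, m₂, m₃, h₁₂, h₁₃, h₂₃⟩ := Finset.two_lt_card_iff.1 hk
    simp only [Finset.mem_filter] at m₁ m₂ m₃
    have dg : ∀ e ∈ E, ¬ e.IsDiag := fun e he => (Finset.mem_filter.1 he).2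
    rcases hc.claw_or_triangle hn (dg _ m₁.1) (dg _ m₂.1) (dg _ m₃.1) h₁₂ h₁₃ h₂₃
      (m₁.2.trans m₂.2.symm) (m₂.2.trans m₃.2.symm) with ⟨u, hu, hue⟩ | ⟨x, y, z, ht, r₁, r₂, -⟩
    · exact hmem _ m₁.1 u hue (hclaw u hu)
    · rcases htri x y z ht with hx | hx | hx
      · exact hmem _ m₁.1 x (by simp [r₁]) hx
      · exact hmem _ m₁.1 y (by simp [r₁]) hx
      · exact hmem _ m₂.1 z (by simp [r₂]) hx
  have hcard := Finset.card_le_mul_card_image E 2 hclass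
  have hEcard : E.card = (Sᶜ.card).choose 2 := by
    rw [← Sym2.card_image_offDiag]
    congr 1
    ext e
    induction e using Sym2.ind with | _ a b => ?_
    simp only [hE, Finset.mem_filter, Finset.mk_mem_sym2_iff, Sym2.mk_isDiag_iff,
      Finset.mem_image, Finset.mem_offDiag, Prod.exists]
    grind
  have hsub : (E.image c).card ≤ usedColors n c := by
    refine Finset.card_le_card (Finset.image_subset_image ?_)
    exact Finset.filter_subset_filter _ (Finset.subset_univ _)
  have hmono : (n - 3).choose 2 ≤ (Sᶜ.card).choose 2 := by
    refine Nat.choose_le_choose 2 ?_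
    rw [Finset.card_compl, Fintype.card_fin]
    omega
  have hfinal : (n - 3).choose 2 ≤ 2 * usedColors n c := by omega
  have : ((n - 3).choose 2 : ℝ) ≤ 2 * usedColors n c := by exact_mod_cast hfinal
  linarith
end

section
/- In every edge-coloring of K_n (n ≥ 6) in which each path on 6 vertices receives at least 4 distinct colors, there is a set S of at most 3 vertices such that the induced coloring on K_n − S is a proper edge-coloring (no two adjacent edges share a color). Equivalently, there do not exist two vertex-disjoint pairs of adjacent edges, each pair monochromatic. -/
open Finset

/-- In a `(P_6,4)`-coloring, two monochromatic pairs of adjacent edges are never vertex-disjoint: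
joining them by an edge would give a path on 6 vertices with at most 3 colors. -/
theorem ne_color_of_disjoint_cherry {n : ℕ} {c : Sym2 (Fin n) → ℕ}
    (h : ∀ v : ℕ → Fin n, InjOnFirst n 6 v → 4 ≤ pathColorCount n 6 c v)
    {a b d x y z : Fin n} (hnd : [b, a, d, y, x, z].Nodup) (habd : c s(a, b) = c s(a, d)) :
    c s(x, y) ≠ c s(x, z) := by
  intro hxyz
  have hinj : InjOnFirst n 6 fun i => [b, a, d, y, x, z].getD i a := by
    intro i j hi hj hij
    have hi' : i < [b, a, d, y, x, z].length := hi
    have hj' : j < [b, a, d, y, x, z].length := hj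
    simp only [List.getD_eq_getElem _ _ hi', List.getD_eq_getElem _ _ hj'] at hij
    exact (hnd.getElem_inj_iff).1 hij
  have hcount := h _ hinj
  have hsub : ((range (6 - 1)).image fun i =>
      c s([b, a, d, y, x, z].getD i a, [b, a, d, y, x, z].getD (i + 1) a)) ⊆
      {c s(a, b), c s(d, y), c s(x, y)} := by
    intro k hk
    obtain ⟨i, hi, rfl⟩ := mem_image.1 hk
    have hi5 : i < 5 := mem_range.1 hi
    interval_cases i <;> simp [habd, hxyz, Sym2.eq_swap (a := b), Sym2.eq_swap (a := y)]
  exact absurd (hcount.trans ((card_le_card hsub).trans card_le_three)) (by norm_num)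

/-- In every `(P_6,4)`-coloring of `K_n` (`n ≥ 6`) there is a set `S` of
at most 3 vertices such that the coloring restricted to the vertices outside `S` is a
proper edge-coloring: no two adjacent edges avoiding `S` share a color. -/
theorem P6_coloring_almost_proper (n : ℕ) (hn : 6 ≤ n) (c : Sym2 (Fin n) → ℕ)
    (h : ∀ v : ℕ → Fin n, InjOnFirst n 6 v → 4 ≤ pathColorCount n 6 c v) :
    ∃ S : Finset (Fin n), S.card ≤ 3 ∧
      ∀ a b d : Fin n, a ∉ S → b ∉ S → d ∉ S → a ≠ b → a ≠ d → b ≠ d →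
        c s(a, b) ≠ c s(a, d) := by
  by_cases hproper : ∀ a b d : Fin n, a ≠ b → a ≠ d → b ≠ d → c s(a, b) ≠ c s(a, d)
  · exact ⟨∅, by simp, fun a b d _ _ _ => hproper a b d⟩
  · push Not at hproper
    obtain ⟨a, b, d, hab, had, hbd, heq⟩ := hproper
    refine ⟨{a, b, d}, card_le_three, fun x y z hx hy hz hxy hxz hyz => ?_⟩
    refine ne_color_of_disjoint_cherry h ?_ heq
    simp only [mem_insert, mem_singleton, not_or] at hx hy hz
    simp only [List.nodup_cons, List.mem_cons, List.not_mem_nil, List.nodup_nil]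
    grind
end

section
/- Let n ≥ 6 and consider a proper edge-coloring of K_n in which every path on 6 vertices receives at least 4 distinct colors. Then every color is used on at most 2 edges, and consequently the coloring uses at least C(n,2)/2 colors. -/
open Finset

/-- Two distinct edges of the same color in a proper edge-coloring are disjoint. -/
lemma disjoint_of_color_eq {V C : Type*} {c : Sym2 V → C}
    (hproper : ∀ a b d : V, a ≠ b → a ≠ d → b ≠ d → c s(a, b) ≠ c s(a, d))
    {a b x y : V} (hab : a ≠ b) (hxy : x ≠ y) (hne : s(a, b) ≠ s(x, y))
    (hc : c s(a, b) = c s(x, y)) : a ≠ x ∧ a ≠ y ∧ b ≠ x ∧ b ≠ y := by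
  have key : ∀ p q r : V, p ≠ q → p ≠ r → s(p, q) ≠ s(p, r) → c s(p, q) ≠ c s(p, r) :=
    fun p q r hpq hpr hqr => hproper p q r hpq hpr fun e => hqr (by rw [e])
  refine ⟨?_, ?_, ?_, ?_⟩ <;> rintro rfl
  · exact key _ _ _ hab hxy hne hc
  · rw [Sym2.eq_swap (a := x)] at hne hc
    exact key _ _ _ hab hxy.symm hne hc
  · rw [Sym2.eq_swap (a := a)] at hne hc
    exact key _ _ _ hab.symm hxy hne hc
  · rw [Sym2.eq_swap (a := a), Sym2.eq_swap (a := x)] at hne hc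
    exact key _ _ _ hab.symm hxy.symm hne hc

/-- A path on 6 vertices whose first, third and fifth edges share a color has at most 3 colors. -/
lemma pathColorCount_six_le_three {n : ℕ} {c : Sym2 (Fin n) → ℕ} {v : ℕ → Fin n}
    (h₂ : c s(v 0, v 1) = c s(v 2, v 3)) (h₄ : c s(v 0, v 1) = c s(v 4, v 5)) :
    pathColorCount n 6 c v ≤ 3 := by
  have hsub : ((Finset.range (6 - 1)).image fun i => c s(v i, v (i + 1))) ⊆
      {c s(v 0, v 1), c s(v 1, v 2), c s(v 3, v 4)} := by
    intro x hx
    obtain ⟨i, hi, rfl⟩ := Finset.mem_image.1 hx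
    have hi' : i < 5 := Finset.mem_range.1 hi
    interval_cases i <;> simp [h₂, ← h₄]
  exact (Finset.card_le_card hsub).trans Finset.card_le_three

/-- In a proper edge-coloring where every path on 6 vertices has at least 4 colors, every color
class has at most 2 edges. -/
lemma card_colorClass_le_two {n : ℕ} {c : Sym2 (Fin n) → ℕ}
    (hproper : ∀ a b d : Fin n, a ≠ b → a ≠ d → b ≠ d → c s(a, b) ≠ c s(a, d))
    (h : ∀ v : ℕ → Fin n, InjOnFirst n 6 v → 4 ≤ pathColorCount n 6 c v) (col : ℕ) :
    #{e : Sym2 (Fin n) | ¬ e.IsDiag ∧ c e = col} ≤ 2 := by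
  by_contra! hcard
  obtain ⟨e, f, g, he, hf, hg, hef, heg, hfg⟩ := Finset.two_lt_card_iff.1 hcard
  simp only [Finset.mem_filter, Finset.mem_univ, true_and] at he hf hg
  induction e with | _ a₁ b₁
  induction f with | _ a₂ b₂
  induction g with | _ a₃ b₃
  simp only [Sym2.mk_isDiag_iff] at he hf hg
  obtain ⟨h₁, rfl⟩ := he
  obtain ⟨h₂, hc₂⟩ := hf
  obtain ⟨h₃, hc₃⟩ := hg
  have d₁₂ := disjoint_of_color_eq hproper h₁ h₂ hef hc₂.symm
  have d₁₃ := disjoint_of_color_eq hproper h₁ h₃ heg hc₃.symm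
  have d₂₃ := disjoint_of_color_eq hproper h₂ h₃ hfg (hc₂.trans hc₃.symm)
  let v : ℕ → Fin n := fun i => [a₁, b₁, a₂, b₂, a₃, b₃].getD i a₁
  have hinj : InjOnFirst n 6 v := by
    have hnodup : [a₁, b₁, a₂, b₂, a₃, b₃].Nodup := by
      simp; tauto
    intro i j hi hj hij
    simp only [v] at hij
    rw [List.getD_eq_getElem _ _ (by simpa using hi),
      List.getD_eq_getElem _ _ (by simpa using hj)] at hij
    exact hnodup.getElem_inj_iff.1 hij
  have hle : pathColorCount n 6 c v ≤ 3 := pathColorCount_six_le_three hc₂.symm hc₃.symm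
  have hge := h v hinj
  omega

/-- In a proper `(P_6,4)`-coloring of `K_n` (`n ≥ 6`), every color is
used on at most 2 edges, and consequently at least `C(n,2)/2` colors are used. -/
theorem proper_P6_coloring_color_classes (n : ℕ) (hn : 6 ≤ n)
    (c : Sym2 (Fin n) → ℕ)
    (hproper : ∀ a b d : Fin n, a ≠ b → a ≠ d → b ≠ d → c s(a, b) ≠ c s(a, d))
    (h : ∀ v : ℕ → Fin n, InjOnFirst n 6 v → 4 ≤ pathColorCount n 6 c v) :
    (∀ col : ℕ, {e : Sym2 (Fin n) | ¬ e.IsDiag ∧ c e = col}.ncard ≤ 2) ∧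
    ((n.choose 2 : ℝ) / 2 ≤ usedColors n c) := by
  refine ⟨fun col => ?_, ?_⟩
  · rw [Set.ncard_eq_toFinset_card']
    simpa using card_colorClass_le_two hproper h col
  · have hle : n.choose 2 ≤ 2 * usedColors n c := by
      have hedges : #{e : Sym2 (Fin n) | ¬ e.IsDiag} = n.choose 2 := by
        rw [← Fintype.card_subtype, Sym2.card_subtype_not_diag, Fintype.card_fin]
      rw [← hedges]
      refine Finset.card_le_mul_card_image _ 2 fun col _ => ?_
      rw [Finset.filter_filter]
      exact card_colorClass_le_two hproper h col
    have hle' : (n.choose 2 : ℝ) ≤ 2 * usedColors n c := by exact_mod_cast hle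
    linarith
end

section
/- There exists a constant C such that for all n ≥ 7, every edge-coloring of K_n in which each path on 7 vertices receives at least 5 distinct colors uses at least n²/2 − C·n colors; combined with the trivial upper bound f(K_n, P_7, 5) ≤ C(n,2), this gives f(K_n, P_7, 5) = n²/2 + O(n). -/
open Finset

/-- A list of distinct vertices extends to a list of `k` distinct vertices, if `k ≤ n`. -/
theorem exists_nodup_append {n k : ℕ} (hk : k ≤ n) (L : List (Fin n)) (hL : L.Nodup)
    (hlen : L.length ≤ k) : ∃ M : List (Fin n), (L ++ M).Nodup ∧ (L ++ M).length = k := by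
  obtain ⟨T, hT, hcard⟩ := Finset.exists_subset_card_eq (s := L.toFinsetᶜ) (n := k - L.length) (by
    rw [Finset.card_compl, List.toFinset_card_of_nodup hL, Fintype.card_fin]
    omega)
  refine ⟨T.toList, List.nodup_append'.2 ⟨hL, T.nodup_toList, fun x hx hx' => ?_⟩, ?_⟩
  · have := hT (Finset.mem_toList.1 hx')
    simp [hx] at this
  · simp [hcard]
    omega

/-- In a coloring where every `P_7` has at least five colors, no path on at most seven vertices
has two independent repetitions of colors. -/
theorem not_two_repetitions {n : ℕ} (hn : 7 ≤ n) {c : Sym2 (Fin n) → ℕ}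
    (hc : ∀ v : ℕ → Fin n, InjOnFirst n 7 v → 5 ≤ pathColorCount n 7 c v)
    (L : List (Fin n)) (hL : L.Nodup) (hlen : L.length ≤ 7) (i j k l : ℕ)
    (hi : i + 1 < L.length) (hj : j + 1 < L.length) (hk : k + 1 < L.length)
    (hl : l + 1 < L.length) (hjl : j ≠ l) (hij : i ≠ j) (hil : i ≠ l) (hkj : k ≠ j) (hkl : k ≠ l)
    (h₁ : c s(L[i], L[i + 1]) = c s(L[j], L[j + 1]))
    (h₂ : c s(L[k], L[k + 1]) = c s(L[l], L[l + 1])) : False := by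
  obtain ⟨M, hM, hMlen⟩ := exists_nodup_append hn L hL hlen
  have hget : ∀ m (hm : m < L.length), (L ++ M).getD m ⟨0, by omega⟩ = L[m] := by
    intro m hm
    simp [List.getElem?_append_left hm, List.getElem?_eq_getElem hm]
  have hinj : InjOnFirst n 7 (fun m => (L ++ M).getD m ⟨0, by omega⟩) := by
    intro p q hp hq hpq
    simp only [List.getD_eq_getElem _ _ (hMlen.symm ▸ hp : p < (L ++ M).length),
      List.getD_eq_getElem _ _ (hMlen.symm ▸ hq : q < (L ++ M).length)] at hpq
    exact (hM.getElem_inj_iff).1 hpq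
  have h5 := hc _ hinj
  rw [pathColorCount] at h5
  set g : ℕ → ℕ := fun m => c s((L ++ M).getD m ⟨0, by omega⟩, (L ++ M).getD (m + 1) ⟨0, by omega⟩)
    with hg
  have hgL : ∀ m (hm : m + 1 < L.length), g m = c s(L[m], L[m + 1]) := by
    intro m hm
    simp only [hg]
    rw [hget m (by omega), hget (m + 1) hm]
  have e₁ : g i = g j := by rw [hgL i hi, hgL j hj, h₁]
  have e₂ : g k = g l := by rw [hgL k hk, hgL l hl, h₂]
  have hsub : (Finset.range 6).image g ⊆ (((Finset.range 6).erase j).erase l).image g := by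
    intro x hx
    obtain ⟨m, hm, rfl⟩ := Finset.mem_image.1 hx
    rw [Finset.mem_range] at hm
    by_cases hmj : m = j
    · exact Finset.mem_image.2 ⟨i, by simp; omega, by rw [hmj, e₁]⟩
    by_cases hml : m = l
    · exact Finset.mem_image.2 ⟨k, by simp; omega, by rw [hml, e₂]⟩
    exact Finset.mem_image.2 ⟨m, by simp; omega, rfl⟩
  have hcard := (Finset.card_le_card hsub).trans Finset.card_image_le
  rw [Finset.card_erase_of_mem (by simp; omega), Finset.card_erase_of_mem (by simp; omega),
    Finset.card_range] at hcard
  change 5 ≤ ((Finset.range 6).image g).card at h5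
  omega

/-- If deleting at most `3n` edges leaves a rainbow graph, then the coloring
uses at least `C(n,2) - 3n` colors. -/
theorem choose_two_le_usedColors_add {n : ℕ} {c : Sym2 (Fin n) → ℕ}
    (B : Finset (Sym2 (Fin n))) (hB : B.card ≤ 3 * n)
    (hinj : ∀ e f, ¬ e.IsDiag → ¬ f.IsDiag → e ∉ B → f ∉ B → c e = c f → e = f) :
    n.choose 2 ≤ usedColors n c + 3 * n := by
  set E := (Finset.univ : Finset (Sym2 (Fin n))).filter fun e => ¬ e.IsDiag with hE
  have hEcard : E.card = n.choose 2 := by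
    rw [hE, ← Fintype.card_subtype, Sym2.card_subtype_not_diag, Fintype.card_fin]
  have himage : ((E \ B).image c).card = (E \ B).card := by
    refine Finset.card_image_of_injOn fun e he f hf hef => ?_
    simp only [hE, Finset.coe_sdiff, Set.mem_sdiff, Finset.mem_coe, Finset.mem_filter,
      Finset.mem_univ, true_and] at he hf
    exact hinj e f he.1 hf.1 he.2 hf.2 hef
  have hle : ((E \ B).image c).card ≤ usedColors n c :=
    Finset.card_le_card (Finset.image_subset_image Finset.sdiff_subset)
  have := Finset.le_card_sdiff B E
  omega

/-- A monochromatic path with two edges forces the edges disjoint from it to be rainbow. -/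
theorem eq_of_color_eq_of_disjoint_cherry {n : ℕ} (hn : 7 ≤ n) {c : Sym2 (Fin n) → ℕ}
    (hc : ∀ v : ℕ → Fin n, InjOnFirst n 7 v → 5 ≤ pathColorCount n 7 c v)
    {a v b x y z w : Fin n} (hav : a ≠ v) (hvb : v ≠ b) (hab : a ≠ b) (hcol : c s(a, v) = c s(v, b))
    (hxy : x ≠ y) (hzw : z ≠ w)
    (hx : x ∉ [a, v, b]) (hy : y ∉ [a, v, b]) (hz : z ∉ [a, v, b]) (hw : w ∉ [a, v, b])
    (h : c s(x, y) = c s(z, w)) : s(x, y) = s(z, w) := by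
  by_contra hne
  simp only [List.mem_cons, List.not_mem_nil, or_false, not_or] at hx hy hz hw
  have cherry : ∀ p q r : Fin n, p ∉ [a, v, b] → q ∉ [a, v, b] → r ∉ [a, v, b] →
      p ≠ q → q ≠ r → p ≠ r → c s(p, q) = c s(q, r) → False := by
    intro p q r hp hq hr hpq hqr hpr hcol'
    simp only [List.mem_cons, List.not_mem_nil, or_false, not_or] at hp hq hr
    exact not_two_repetitions hn hc [a, v, b, p, q, r] (by simp; grind) (by simp) 0 1 3 4
      (by simp) (by simp) (by simp) (by simp) (by simp) (by simp) (by simp) (by simp) (by simp)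
      hcol hcol'
  by_cases h1 : x = z
  · subst h1
    exact cherry y x w (by simp [hy]) (by simp [hx]) (by simp [hw]) hxy.symm hzw
      (by rintro rfl; exact hne rfl) (by rwa [Sym2.eq_swap])
  by_cases h2 : x = w
  · subst h2
    exact cherry y x z (by simp [hy]) (by simp [hx]) (by simp [hz]) hxy.symm hzw.symm
      (by rintro rfl; exact hne Sym2.eq_swap)
      (by rw [Sym2.eq_swap, h, Sym2.eq_swap])
  by_cases h3 : y = z
  · subst h3
    exact cherry x y w (by simp [hx]) (by simp [hy]) (by simp [hw]) hxy hzw h2 h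
  by_cases h4 : y = w
  · subst h4
    exact cherry x y z (by simp [hx]) (by simp [hy]) (by simp [hz]) hxy hzw.symm h1
      (by rw [h, Sym2.eq_swap])
  exact not_two_repetitions hn hc [a, v, b, x, y, z, w] (by simp; grind) (by simp) 0 1 3 5
    (by simp) (by simp) (by simp) (by simp) (by simp) (by simp) (by simp) (by simp) (by simp)
    hcol h

/-- In a proper coloring, all edges at `u` whose color is repeated go to three vertices determined
by one of them. -/
theorem mem_of_repeated_color {n : ℕ} (hn : 7 ≤ n) {c : Sym2 (Fin n) → ℕ}
    (hc : ∀ v : ℕ → Fin n, InjOnFirst n 7 v → 5 ≤ pathColorCount n 7 c v)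
    (hproper : ∀ a v b : Fin n, a ≠ v → v ≠ b → a ≠ b → c s(a, v) ≠ c s(v, b))
    {u a b b' x y y' : Fin n} (hua : [u, a, b, b'].Nodup) (hab : c s(u, a) = c s(b, b'))
    (hux : [u, x, y, y'].Nodup) (hxy : c s(u, x) = c s(y, y')) : x ∈ [a, b, b'] := by
  by_contra hx
  have hau : c s(a, u) = c s(b, b') := by rw [Sym2.eq_swap, hab]
  have hau' : c s(a, u) = c s(b', b) := by rw [hau, Sym2.eq_swap]
  have hxy' : c s(u, x) = c s(y', y) := by rw [hxy, Sym2.eq_swap]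
  -- one endpoint of `y y'` is `a`
  have meets_a : ∀ z, z ≠ a → z ≠ u → z ≠ x → c s(u, x) = c s(a, z) → False := by
    intro z hza hzu hzx hcol
    by_cases hzb : z = b
    · exact not_two_repetitions hn hc [x, u, a, b, b'] (by simp at *; grind) (by simp) 0 2 1 3
        (by simp) (by simp) (by simp) (by simp) (by simp) (by simp) (by simp) (by simp) (by simp)
        (by simp [← hzb, ← hcol, Sym2.eq_swap]) hab
    by_cases hzb' : z = b'
    · exact not_two_repetitions hn hc [x, u, a, b', b] (by simp at *; grind) (by simp) 0 2 1 3
        (by simp) (by simp) (by simp) (by simp) (by simp) (by simp) (by simp) (by simp) (by simp)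
        (by simp [← hzb', ← hcol, Sym2.eq_swap]) (by simp [hab, Sym2.eq_swap])
    exact not_two_repetitions hn hc [z, a, u, x, b, b'] (by simp at *; grind) (by simp) 0 2 1 4
      (by simp) (by simp) (by simp) (by simp) (by simp) (by simp) (by simp) (by simp) (by simp)
      (by simp [hcol, Sym2.eq_swap]) hau
  -- `y y'` shares one endpoint with the edge of the same color as `u a`
  have meets : ∀ p q z, [u, a, q, p].Nodup → x ∉ [a, q, p] → c s(a, u) = c s(q, p) →
      z ∉ [u, a, x, p, q] → c s(u, x) = c s(p, z) → False := by
    intro p q z hnd hxn hq hz hcol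
    exact not_two_repetitions hn hc [a, u, x, q, p, z] (by simp at *; grind) (by simp) 0 3 1 4
      (by simp) (by simp) (by simp) (by simp) (by simp) (by simp) (by simp) (by simp) (by simp)
      hq hcol
  have hnd' : [u, a, b', b].Nodup := by simp at *; grind
  have hx' : x ∉ [a, b', b] := by simp at *; grind
  by_cases h1 : y = a
  · exact meets_a y' (by simp at *; grind) (by simp at *; grind) (by simp at *; grind) (h1 ▸ hxy)
  by_cases h2 : y' = a
  · exact meets_a y (by simp at *; grind) (by simp at *; grind) (by simp at *; grind) (h2 ▸ hxy')
  have hsame : s(y, y') ≠ s(b, b') := by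
    intro h
    exact hproper a u x (by simp at *; grind) (by simp at *; grind) (by simp at *; grind)
      (by rw [hau, hxy, h])
  rw [Ne, Sym2.eq_iff] at hsame
  by_cases h3 : y = b
  · exact meets b b' y' hnd' hx' hau' (by simp at *; grind) (h3 ▸ hxy)
  by_cases h4 : y = b'
  · exact meets b' b y' hua hx hau (by simp at *; grind) (h4 ▸ hxy)
  by_cases h5 : y' = b
  · exact meets b b' y hnd' hx' hau' (by simp at *; grind) (h5 ▸ hxy')
  by_cases h6 : y' = b'
  · exact meets b' b y hua hx hau (by simp at *; grind) (h6 ▸ hxy')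
  exact not_two_repetitions hn hc [a, u, x, b, b', y, y'] (by simp at *; grind) (by simp) 0 3 1 5
    (by simp) (by simp) (by simp) (by simp) (by simp) (by simp) (by simp) (by simp) (by simp)
    hau hxy

/-- If every `P_7` has at least five colors, then at least `C(n,2) - 3n` colors are used. -/
theorem choose_two_le_usedColors {n : ℕ} (hn : 7 ≤ n) {c : Sym2 (Fin n) → ℕ}
    (hc : ∀ v : ℕ → Fin n, InjOnFirst n 7 v → 5 ≤ pathColorCount n 7 c v) :
    n.choose 2 ≤ usedColors n c + 3 * n := by
  by_cases hproper : ∀ a v b : Fin n, a ≠ v → v ≠ b → a ≠ b → c s(a, v) ≠ c s(v, b)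
  · have key : ∀ u : Fin n, ∃ T : Finset (Fin n), T.card ≤ 3 ∧
        ∀ x y y', [u, x, y, y'].Nodup → c s(u, x) = c s(y, y') → x ∈ T := by
      intro u
      by_cases hu : ∃ a b b', [u, a, b, b'].Nodup ∧ c s(u, a) = c s(b, b')
      · obtain ⟨a, b, b', hnd, hab⟩ := hu
        exact ⟨{a, b, b'}, Finset.card_le_three, fun x y y' h h' => by
          simpa using mem_of_repeated_color hn hc hproper hnd hab h h'⟩
      · exact ⟨∅, by simp, fun x y y' h h' => (hu ⟨x, y, y', h, h'⟩).elim⟩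
    choose T hT hmem using key
    refine choose_two_le_usedColors_add
      (Finset.univ.biUnion fun u => (T u).image fun x => s(u, x)) ?_ ?_
    · refine (Finset.card_biUnion_le_card_mul _ _ 3 fun u _ =>
        Finset.card_image_le.trans (hT u)).trans ?_
      simp [mul_comm]
    · intro e f he hf heB hfB hef
      induction e using Sym2.ind with | _ x y
      induction f using Sym2.ind with | _ z w
      rw [Sym2.mk_isDiag_iff] at he hf
      by_contra hne
      have hnd : [x, y, z, w].Nodup := by
        have s₁ : s(x, y) = s(y, x) := Sym2.eq_swap
        have s₂ : s(z, w) = s(w, z) := Sym2.eq_swap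
        have h1 : x ≠ z := by
          rintro rfl
          exact hproper y x w (Ne.symm he) hf (by grind) (by rw [← s₁, hef])
        have h2 : x ≠ w := by
          rintro rfl
          exact hproper y x z (Ne.symm he) (Ne.symm hf) (by grind) (by rw [← s₁, hef, s₂])
        have h3 : y ≠ z := by
          rintro rfl
          exact hproper x y w he hf h2 hef
        have h4 : y ≠ w := by
          rintro rfl
          exact hproper x y z he (Ne.symm hf) h1 (by rw [hef, s₂])
        simp
        grind
      exact heB (Finset.mem_biUnion.2 ⟨x, Finset.mem_univ _,
        Finset.mem_image.2 ⟨y, hmem x y z w hnd hef, rfl⟩⟩)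
  · push Not at hproper
    obtain ⟨a, v, b, hav, hvb, hab, hcol⟩ := hproper
    refine choose_two_le_usedColors_add
      ((({a, v, b} : Finset (Fin n)) ×ˢ Finset.univ).image fun p => s(p.1, p.2)) ?_ ?_
    · refine Finset.card_image_le.trans ?_
      rw [Finset.card_product, Finset.card_univ, Fintype.card_fin]
      exact Nat.mul_le_mul_right _ Finset.card_le_three
    · intro e f he hf heB hfB hef
      induction e using Sym2.ind with | _ x y
      induction f using Sym2.ind with | _ z w
      rw [Sym2.mk_isDiag_iff] at he hf
      have hout : ∀ p q : Fin n,
          s(p, q) ∉ (({a, v, b} : Finset (Fin n)) ×ˢ Finset.univ).image (fun p => s(p.1, p.2)) →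
          p ∉ [a, v, b] ∧ q ∉ [a, v, b] := by
        intro p q hpq
        constructor
        · exact fun hp => hpq (Finset.mem_image.2 ⟨(p, q), by simpa using hp, rfl⟩)
        · exact fun hq => hpq (Finset.mem_image.2 ⟨(q, p), by simpa using hq, Sym2.eq_swap⟩)
      exact eq_of_color_eq_of_disjoint_cherry hn hc hav hvb hab hcol he hf
        (hout x y heB).1 (hout x y heB).2 (hout z w hfB).1 (hout z w hfB).2 hef

/-- A coloring with all colors distinct gives every path on `k` vertices `k - 1` colors. -/
theorem pathColorCount_of_injective {n : ℕ} {c : Sym2 (Fin n) → ℕ} (hc : Function.Injective c)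
    {k : ℕ} {v : ℕ → Fin n} (hv : InjOnFirst n k v) : pathColorCount n k c v = k - 1 := by
  rw [pathColorCount, Finset.card_image_of_injOn, Finset.card_range]
  intro i hi j hj hij
  simp only [Finset.coe_range, Set.mem_Iio] at hi hj
  rcases Sym2.eq_iff.1 (hc hij) with ⟨h, -⟩ | ⟨h, h'⟩
  · exact hv _ _ (by omega) (by omega) h
  · have := hv _ _ (by omega) (by omega) h
    have := hv _ _ (by omega) (by omega) h'
    omega

theorem usedColors_le_choose_two (n : ℕ) (c : Sym2 (Fin n) → ℕ) :
    usedColors n c ≤ n.choose 2 := by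
  refine Finset.card_image_le.trans_eq ?_
  rw [← Fintype.card_subtype, Sym2.card_subtype_not_diag, Fintype.card_fin]

/-- There is a constant `C` such that for all `n ≥ 7`, every
edge-coloring of `K_n` in which every path on 7 vertices receives at least 5 distinct
colors uses at least `n²/2 − C·n` colors; together with the trivial upper bound
`f(K_n, P_7, 5) ≤ C(n,2)` this gives `f(K_n, P_7, 5) = n²/2 + O(n)`. -/
theorem generalized_ramsey_P7 :
    ∃ C : ℝ, ∀ n : ℕ, 7 ≤ n →
      (∀ c : Sym2 (Fin n) → ℕ,
        (∀ v : ℕ → Fin n, InjOnFirst n 7 v → 5 ≤ pathColorCount n 7 c v) →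
        (n : ℝ) ^ 2 / 2 - C * n ≤ usedColors n c) ∧
      (∃ c : Sym2 (Fin n) → ℕ,
        (∀ v : ℕ → Fin n, InjOnFirst n 7 v → 5 ≤ pathColorCount n 7 c v) ∧
        usedColors n c ≤ n.choose 2) := by
  refine ⟨4, fun n hn => ⟨fun c hc => ?_, ?_⟩⟩
  · have h : ((n.choose 2 : ℕ) : ℝ) ≤ usedColors n c + 3 * n := by
      exact_mod_cast choose_two_le_usedColors hn hc
    rw [Nat.cast_choose_two] at h
    have : (0 : ℝ) ≤ n := n.cast_nonneg
    linarith
  · refine ⟨Fin.val ∘ Fintype.equivFin (Sym2 (Fin n)), fun v hv => ?_,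
      usedColors_le_choose_two n _⟩
    rw [pathColorCount_of_injective
      (Fin.val_injective.comp (Fintype.equivFin (Sym2 (Fin n))).injective) hv]
    norm_num
end

section
/- There exists a constant C such that for all n ≥ 8 there is a proper edge-coloring of K_n using at most 7n²/30 + C·n colors in which every path on 8 vertices receives at least 5 distinct colors; that is, f_proper(K_n, P_8, 5) ≤ 7n²/30 + O(n). -/
open Finset

/-- The coloring of the edges of `K_6` by one perfect matching `{01, 23, 45}` and, for any two edges
of that matching, the two other perfect matchings of their four ends. -/
def sixColor : Sym2 (Fin 6) → Fin 7 :=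
  Sym2.lift ⟨fun a b =>
    if a.val / 2 = b.val / 2 then 0
    else Fin.ofNat 7 (1 + 2 * (3 - a.val / 2 - b.val / 2) + (a.val + b.val) % 2),
    by decide⟩

/-- The edge of the perfect matching `{01, 23, 45}` containing a vertex. -/
def matchingEdge (x : Fin 6) : Fin 3 := Fin.ofNat 3 (x.val / 2)

set_option synthInstance.maxSize 1000 in
set_option synthInstance.maxHeartbeats 200000 in
theorem sixColor_repeat : ∀ a b c d : Fin 6, a ≠ b → c ≠ d → s(a, b) ≠ s(c, d) →
    sixColor s(a, b) = sixColor s(c, d) →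
    (a ≠ c ∧ a ≠ d ∧ b ≠ c ∧ b ≠ d) ∧
      ∃ k : Fin 3, ∀ x : Fin 6, (x = a ∨ x = b ∨ x = c ∨ x = d) ↔ matchingEdge x ≠ k := by
  decide +kernel

/-- The `p`-th vertex of a path lies on its `i`-th or its `j`-th edge. -/
def OnEdges (i j p : ℕ) : Prop := p = i ∨ p = i + 1 ∨ p = j ∨ p = j + 1

theorem onEdges_ext {i j i' j' : ℕ} (h : i + 1 < j) (h' : i' + 1 < j')
    (H : ∀ p, OnEdges i j p ↔ OnEdges i' j' p) : j = j' := by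
  unfold OnEdges at H
  have h1 := H i
  have h2 := H i'
  have h3 := H (j + 1)
  have h4 := H (j' + 1)
  omega

theorem not_onEdges_exactly_two {i₁ j₁ i₂ j₂ i₃ j₃ : ℕ}
    (h₁ : i₁ + 1 < j₁) (h₂ : i₂ + 1 < j₂) (h₃ : i₃ + 1 < j₃)
    (h₁₂ : j₁ ≠ j₂) (h₁₃ : j₁ ≠ j₃) (h₂₃ : j₂ ≠ j₃)
    (H₁ : ∀ p, OnEdges i₁ j₁ p → ¬ (OnEdges i₂ j₂ p ↔ OnEdges i₃ j₃ p))
    (H₂ : ∀ p, OnEdges i₂ j₂ p → ¬ (OnEdges i₁ j₁ p ↔ OnEdges i₃ j₃ p))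
    (H₃ : ∀ p, OnEdges i₃ j₃ p → ¬ (OnEdges i₁ j₁ p ↔ OnEdges i₂ j₂ p)) : False := by
  unfold OnEdges at H₁ H₂ H₃
  have a1 := H₁ i₁
  have a2 := H₁ (i₁ + 1)
  have a3 := H₁ j₁
  have a4 := H₁ (j₁ + 1)
  have b1 := H₂ i₂
  have b2 := H₂ (i₂ + 1)
  have b3 := H₂ j₂
  have b4 := H₂ (j₂ + 1)
  have c1 := H₃ i₃
  have c2 := H₃ (i₃ + 1)
  have c3 := H₃ j₃
  have c4 := H₃ (j₃ + 1)
  clear H₁ H₂ H₃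
  simp only [true_or, or_true, forall_const] at *
  rcases lt_trichotomy i₁ i₂ with h | h | h <;>
    rcases lt_trichotomy i₁ i₃ with h' | h' | h' <;>
    rcases lt_trichotomy i₂ i₃ with h'' | h'' | h'' <;> omega

section Coloring

variable {X : Type*}

open Classical in
/-- Given sets of points with labels in `Fin 6`, color the pairs inside each set as in `sixColor`,
with fresh colors for every set, and give every remaining pair a color of its own. -/
noncomputable def blockColor (𝓑 : Finset (Finset X)) (label : Finset X → X → Fin 6) (e : Sym2 X) :
    (Finset X × Fin 7) ⊕ Sym2 X :=
  if h : ∃ B ∈ 𝓑, ∀ x ∈ e, x ∈ B then .inl (h.choose, sixColor (e.map (label h.choose)))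
  else .inr e

variable {𝓑 : Finset (Finset X)} {label : Finset X → X → Fin 6}

/-- Two different pairs of the same color are disjoint pairs of a common block, and their ends are
the points of the block outside some edge of the matching of `sixColor`. -/
theorem blockColor_repeat (hlabel : ∀ B ∈ 𝓑, Set.InjOn (label B) B) {a b c d : X} (hab : a ≠ b)
    (hcd : c ≠ d) (hne : s(a, b) ≠ s(c, d))
    (h : blockColor 𝓑 label s(a, b) = blockColor 𝓑 label s(c, d)) :
    (a ≠ c ∧ a ≠ d ∧ b ≠ c ∧ b ≠ d) ∧ ∃ B ∈ 𝓑, ∃ k : Fin 3,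
      ∀ x, (x = a ∨ x = b ∨ x = c ∨ x = d) ↔ x ∈ B ∧ matchingEdge (label B x) ≠ k := by
  unfold blockColor at h
  split_ifs at h with h₁ h₂
  · obtain ⟨hB, hm₁⟩ := h₁.choose_spec
    obtain ⟨-, hm₂⟩ := h₂.choose_spec
    simp only [Sum.inl.injEq, Prod.mk.injEq] at h
    obtain ⟨hBB, hc⟩ := h
    rw [← hBB] at hm₂ hc
    generalize h₁.choose = B at hB hm₁ hm₂ hc
    simp only [Sym2.mem_iff, forall_eq_or_imp, forall_eq] at hm₁ hm₂
    obtain ⟨ha, hb⟩ := hm₁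
    obtain ⟨hc', hd⟩ := hm₂
    have inj := hlabel B hB
    have key : ∀ {x y}, x ∈ B → y ∈ B → (label B x = label B y ↔ x = y) :=
      fun hx hy => inj.eq_iff hx hy
    simp only [Sym2.map_mk] at hc
    have := sixColor_repeat (label B a) (label B b) (label B c) (label B d)
      (by rwa [Ne, key ha hb]) (by rwa [Ne, key hc' hd])
      (by simpa [Sym2.eq_iff, key, ha, hb, hc', hd] using hne) hc
    obtain ⟨hd4, k, hk⟩ := this
    simp only [Ne, key, ha, hb, hc', hd] at hd4
    refine ⟨hd4, B, hB, k, fun x => ⟨fun hx => ?_, fun hx => ?_⟩⟩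
    · have hxB : x ∈ B := by rcases hx with rfl | rfl | rfl | rfl <;> assumption
      exact ⟨hxB, (hk _).1 (by simpa [key, hxB, ha, hb, hc', hd] using hx)⟩
    · simpa [key, hx.1, ha, hb, hc', hd] using (hk _).2 hx.2
  · exact absurd (Sum.inr.inj h) hne

theorem blockColor_proper (hlabel : ∀ B ∈ 𝓑, Set.InjOn (label B) B)
    {a b d : X} (hab : a ≠ b) (had : a ≠ d) (hbd : b ≠ d) :
    blockColor 𝓑 label s(a, b) ≠ blockColor 𝓑 label s(a, d) := fun h =>
  (blockColor_repeat hlabel hab had (by simp [hbd, had]) h).1.1 rfl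

/-- A function on seven numbers with at most four values has three repetitions. -/
theorem exists_three_repeats {α : Type*} [DecidableEq α] (f : ℕ → α)
    (h : #((range 7).image f) < 5) :
    ∃ i₁ j₁ i₂ j₂ i₃ j₃, i₁ < j₁ ∧ i₂ < j₂ ∧ i₃ < j₃ ∧ j₁ < 7 ∧ j₂ < 7 ∧ j₃ < 7 ∧
      j₁ ≠ j₂ ∧ j₁ ≠ j₃ ∧ j₂ ≠ j₃ ∧ f i₁ = f j₁ ∧ f i₂ = f j₂ ∧ f i₃ = f j₃ := by
  classical
  have hcard := card_filter_add_card_filter_not (s := range 7) (fun j => ∃ i < j, f i = f j)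
  have hfirst : #{j ∈ range 7 | ¬ ∃ i < j, f i = f j} ≤ #((range 7).image f) := by
    refine card_le_card_of_injOn f (fun j hj => ?_) (fun j hj j' hj' e => ?_)
    · exact mem_coe.2 (mem_image_of_mem f (mem_filter.1 (mem_coe.1 hj)).1)
    · simp only [coe_filter, Set.mem_ofPred_eq, not_exists, not_and] at hj hj'
      rcases lt_trichotomy j j' with hlt | heq | hlt
      · exact absurd e (hj'.2 j hlt)
      · exact heq
      · exact absurd e.symm (hj.2 j' hlt)
  rw [card_range] at hcard
  obtain ⟨j₁, hj₁, j₂, hj₂, j₃, hj₃, h₁₂, h₁₃, h₂₃⟩ := two_lt_card.1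
    (show 2 < #{j ∈ range 7 | ∃ i < j, f i = f j} by omega)
  simp only [mem_filter, mem_range] at hj₁ hj₂ hj₃
  obtain ⟨hj₁, i₁, hi₁, e₁⟩ := hj₁
  obtain ⟨hj₂, i₂, hi₂, e₂⟩ := hj₂
  obtain ⟨hj₃, i₃, hi₃, e₃⟩ := hj₃
  exact ⟨i₁, j₁, i₂, j₂, i₃, j₃, hi₁, hi₂, hi₃, hj₁, hj₂, hj₃, h₁₂, h₁₃, h₂₃, e₁, e₂, e₃⟩

/-- If the blocks have six points and pairwise share at most one, every path on eight vertices
receives at least five colors. -/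
theorem five_le_card_blockColor [DecidableEq X] (hlabel : ∀ B ∈ 𝓑, Set.InjOn (label B) B)
    (hcard : ∀ B ∈ 𝓑, #B = 6)
    (hlin : ∀ B ∈ 𝓑, ∀ B' ∈ 𝓑, B ≠ B' → #(B ∩ B') ≤ 1) (v : ℕ → X)
    (hv : ∀ i j, i < 8 → j < 8 → v i = v j → i = j) :
    5 ≤ #((range 7).image fun i => blockColor 𝓑 label s(v i, v (i + 1))) := by
  by_contra! hlt
  obtain ⟨i₁, j₁, i₂, j₂, i₃, j₃, hi₁, hi₂, hi₃, hj₁, hj₂, hj₃, h₁₂, h₁₃, h₂₃, e₁, e₂, e₃⟩ :=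
    exists_three_repeats _ hlt
  have hne : ∀ {i j}, i < 8 → j < 8 → i ≠ j → v i ≠ v j := fun hi hj hij h => hij (hv _ _ hi hj h)
  have hrep : ∀ i j, i < j → j < 7 →
      blockColor 𝓑 label s(v i, v (i + 1)) = blockColor 𝓑 label s(v j, v (j + 1)) →
      i + 1 < j ∧ ∃ B ∈ 𝓑, ∃ k : Fin 3, ∃ V ⊆ (range 8).image v, #V = 4 ∧
        (∀ p < 8, v p ∈ V ↔ OnEdges i j p) ∧
        (∀ x, x ∈ V ↔ x ∈ B ∧ matchingEdge (label B x) ≠ k) := by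
    intro i j hij hj h
    have n₁ : v i ≠ v (i + 1) := hne (by omega) (by omega) (by omega)
    have n₂ : v j ≠ v (j + 1) := hne (by omega) (by omega) (by omega)
    have n₃ : v i ≠ v j := hne (by omega) (by omega) (by omega)
    have n₄ : v i ≠ v (j + 1) := hne (by omega) (by omega) (by omega)
    obtain ⟨⟨-, -, n₅, n₆⟩, B, hB, k, hk⟩ := blockColor_repeat hlabel n₁ n₂
      (by simp [n₃, n₄]) h
    have : i + 1 ≠ j := fun h => n₅ (by rw [h])
    refine ⟨by omega, B, hB, k, {v i, v (i + 1), v j, v (j + 1)}, ?_, ?_, ?_, ?_⟩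
    · intro x hx
      simp only [mem_insert, mem_singleton] at hx
      rcases hx with rfl | rfl | rfl | rfl <;> exact mem_image_of_mem v (mem_range.2 (by omega))
    · rw [card_insert_of_notMem, card_insert_of_notMem, card_insert_of_notMem, card_singleton] <;>
        simp [n₁, n₂, n₃, n₄, n₅, n₆]
    · intro p hp
      have key : ∀ q < 8, v p = v q ↔ p = q := fun q hq => ⟨hv p q hp hq, fun h => by rw [h]⟩
      simp only [mem_insert, mem_singleton, OnEdges, key i (by omega), key (i + 1) (by omega),
        key j (by omega), key (j + 1) (by omega)]
    · intro x
      rw [← hk]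
      simp only [mem_insert, mem_singleton]
  obtain ⟨l₁, B₁, hB₁, k₁, V₁, s₁, c₁, p₁, m₁⟩ := hrep i₁ j₁ hi₁ hj₁ e₁
  obtain ⟨l₂, B₂, hB₂, k₂, V₂, s₂, c₂, p₂, m₂⟩ := hrep i₂ j₂ hi₂ hj₂ e₂
  obtain ⟨l₃, B₃, hB₃, k₃, V₃, s₃, c₃, p₃, m₃⟩ := hrep i₃ j₃ hi₃ hj₃ e₃
  have hV₁ : V₁ ⊆ B₁ := fun x hx => ((m₁ x).1 hx).1
  have hV₂ : V₂ ⊆ B₂ := fun x hx => ((m₂ x).1 hx).1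
  have hV₃ : V₃ ⊆ B₃ := fun x hx => ((m₃ x).1 hx).1
  have hP : #((range 8).image v) ≤ 8 := card_image_le.trans (card_range 8).le
  -- two repetitions in one block miss different edges of its matching, hence cover the block
  have hk : ∀ {i j i' j' : ℕ} {B : Finset X} {k k' : Fin 3} {V V' : Finset X},
      j < 7 → j' < 7 → j ≠ j' → i + 1 < j → i' + 1 < j' →
      (∀ p < 8, v p ∈ V ↔ OnEdges i j p) → (∀ p < 8, v p ∈ V' ↔ OnEdges i' j' p) →
      (∀ x, x ∈ V ↔ x ∈ B ∧ matchingEdge (label B x) ≠ k) →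
      (∀ x, x ∈ V' ↔ x ∈ B ∧ matchingEdge (label B x) ≠ k') → k ≠ k' := by
    rintro i j i' j' B k k' V V' hj hj' hjj l l' p p' m m' rfl
    refine hjj (onEdges_ext l l' fun q => ?_)
    by_cases hq : q < 8
    · rw [← p q hq, ← p' q hq, m, m']
    · unfold OnEdges
      omega
  have hcover : ∀ {B : Finset X} {k k' : Fin 3} {V V' : Finset X}, k ≠ k' →
      (∀ x, x ∈ V ↔ x ∈ B ∧ matchingEdge (label B x) ≠ k) →
      (∀ x, x ∈ V' ↔ x ∈ B ∧ matchingEdge (label B x) ≠ k') → B ⊆ V ∪ V' := by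
    intro B k k' V V' hkk m m' x hx
    rw [mem_union, m, m']
    by_cases h : matchingEdge (label B x) = k
    · exact .inr ⟨hx, h ▸ hkk⟩
    · exact .inl ⟨hx, h⟩
  have htwo : ∀ {B B' : Finset X} {V V' V'' : Finset X}, B ∈ 𝓑 → B' ∈ 𝓑 → B ≠ B' → B ⊆ V ∪ V' →
      V ⊆ (range 8).image v → V' ⊆ (range 8).image v → V'' ⊆ (range 8).image v →
      V'' ⊆ B' → #V'' = 4 → False := by
    intro B B' V V' V'' hB hB' hBB hcov s s' s'' hs hc
    have h1 := card_le_card (union_subset (hcov.trans (union_subset s s')) s'')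
    have h2 := card_union_add_card_inter B V''
    have h3 := card_le_card (inter_subset_inter (Subset.refl B) hs)
    have h4 := hlin B hB B' hB' hBB
    have h5 := hcard B hB
    omega
  by_cases h12 : B₁ = B₂
  · subst h12
    have hk₁₂ := hk hj₁ hj₂ h₁₂ l₁ l₂ p₁ p₂ m₁ m₂
    by_cases h13 : B₁ = B₃
    · subst h13
      have hk₁₃ := hk hj₁ hj₃ h₁₃ l₁ l₃ p₁ p₃ m₁ m₃
      have hk₂₃ := hk hj₂ hj₃ h₂₃ l₂ l₃ p₂ p₃ m₂ m₃
      have hthree : ∀ k k₁ k₂ k₃ : Fin 3, k₁ ≠ k₂ → k₁ ≠ k₃ → k₂ ≠ k₃ →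
          (k ≠ k₁ → ¬ (k ≠ k₂ ↔ k ≠ k₃)) := by decide
      refine not_onEdges_exactly_two l₁ l₂ l₃ h₁₂ h₁₃ h₂₃ ?_ ?_ ?_ <;> intro p hp <;>
        have hp8 : p < 8 := by unfold OnEdges at hp; omega
      all_goals
        rw [← p₁ p hp8, m₁] at *
        rw [← p₂ p hp8, m₂] at *
        rw [← p₃ p hp8, m₃] at *
        simp only [hp.1, true_and]
      · exact hthree _ _ _ _ hk₁₂ hk₁₃ hk₂₃ hp.2
      · exact hthree _ _ _ _ hk₁₂.symm hk₂₃ hk₁₃ hp.2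
      · exact hthree _ _ _ _ hk₁₃.symm hk₂₃.symm hk₁₂ hp.2
    · exact htwo hB₁ hB₃ h13 (hcover hk₁₂ m₁ m₂) s₁ s₂ s₃ hV₃ c₃
  · by_cases h13 : B₁ = B₃
    · subst h13
      exact htwo hB₁ hB₂ h12 (hcover (hk hj₁ hj₃ h₁₃ l₁ l₃ p₁ p₃ m₁ m₃) m₁ m₃) s₁ s₃ s₂ hV₂ c₂
    · by_cases h23 : B₂ = B₃
      · subst h23
        exact htwo hB₂ hB₁ (Ne.symm h12) (hcover (hk hj₂ hj₃ h₂₃ l₂ l₃ p₂ p₃ m₂ m₃) m₂ m₃)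
          s₂ s₃ s₁ hV₁ c₁
      · have a1 := card_le_card (inter_subset_inter hV₁ hV₂)
        have a2 := card_le_card (inter_subset_inter hV₁ hV₃)
        have a3 := card_le_card (inter_subset_inter hV₂ hV₃)
        have b1 := hlin _ hB₁ _ hB₂ h12
        have b2 := hlin _ hB₁ _ hB₃ h13
        have b3 := hlin _ hB₂ _ hB₃ h23
        have d1 := card_union_add_card_inter V₁ V₂
        have d2 := card_union_add_card_inter (V₁ ∪ V₂) V₃
        have d3 : #((V₁ ∪ V₂) ∩ V₃) ≤ #(V₁ ∩ V₃) + #(V₂ ∩ V₃) := by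
          rw [union_inter_distrib_right]
          exact card_union_le _ _
        have d4 := card_le_card (union_subset (union_subset s₁ s₂) s₃)
        omega

end Coloring

section Decomposition

/-- The edges of `G` can be partitioned into cliques whose sizes belong to `K`. -/
def CliqueDecomposable {V : Type*} (K : Set ℕ) (G : SimpleGraph V) : Prop :=
  ∃ 𝓑 : Set (Finset V), (∀ B ∈ 𝓑, #B ∈ K ∧ G.IsClique B) ∧
    ∀ x y, G.Adj x y → ∃! B, B ∈ 𝓑 ∧ x ∈ B ∧ y ∈ B

/-- The complete multipartite graph with parts `{i} × W`. -/
abbrev multipartite (V W : Type*) : SimpleGraph (V × W) := (⊤ : SimpleGraph V).comap Prod.fst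

/-- The complete graph on `B`, with the other points isolated. -/
def cliqueOn {V : Type*} (B : Finset V) : SimpleGraph V where
  Adj x y := x ≠ y ∧ x ∈ B ∧ y ∈ B
  symm := ⟨fun _ _ h => ⟨h.1.symm, h.2.2, h.2.1⟩⟩
  loopless := ⟨fun _ h => h.1 rfl⟩

variable {V W Y : Type*} {K K' : Set ℕ}

/-- An edge-disjoint union of decomposable graphs is decomposable. -/
theorem CliqueDecomposable.of_partition {ι : Type*} {G : SimpleGraph V} (H : ι → SimpleGraph V)
    (hle : ∀ i, H i ≤ G) (huniq : ∀ x y, G.Adj x y → ∃! i, (H i).Adj x y)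
    (h : ∀ i, CliqueDecomposable K (H i)) : CliqueDecomposable K G := by
  choose 𝓑 h₁ h₂ using h
  refine ⟨⋃ i, 𝓑 i, fun B hB => ?_, fun x y hxy => ?_⟩
  · obtain ⟨i, hi⟩ := Set.mem_iUnion.1 hB
    exact ⟨(h₁ i B hi).1, (h₁ i B hi).2.mono (hle i)⟩
  · obtain ⟨i, hi, hi'⟩ := huniq x y hxy
    obtain ⟨B, ⟨hB, hx, hy⟩, hB'⟩ := h₂ i x y hi
    refine ⟨B, ⟨Set.mem_iUnion.2 ⟨i, hB⟩, hx, hy⟩, ?_⟩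
    rintro C ⟨hC, hxC, hyC⟩
    obtain ⟨j, hj⟩ := Set.mem_iUnion.1 hC
    obtain rfl := hi' j ((h₁ j C hj).2 hxC hyC hxy.ne)
    exact hB' C ⟨hj, hxC, hyC⟩

/-- Decompositions can be transported along embeddings, adding isolated points. -/
theorem CliqueDecomposable.of_embedding {G : SimpleGraph V} {H : SimpleGraph Y} (f : V ↪ Y)
    (hadj : ∀ x y, H.Adj (f x) (f y) ↔ G.Adj x y)
    (hsupp : ∀ x y, H.Adj x y → x ∈ Set.range f) (h : CliqueDecomposable K G) :
    CliqueDecomposable K H := by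
  obtain ⟨𝓑, h₁, h₂⟩ := h
  refine ⟨(fun B => B.map f) '' 𝓑, ?_, fun x y hxy => ?_⟩
  · rintro _ ⟨B, hB, rfl⟩
    refine ⟨by simpa using (h₁ B hB).1, ?_⟩
    intro x hx y hy hne
    simp only [coe_map, Set.mem_image, mem_coe] at hx hy
    obtain ⟨x, hx, rfl⟩ := hx
    obtain ⟨y, hy, rfl⟩ := hy
    exact (hadj x y).2 ((h₁ B hB).2 hx hy fun h => hne (by rw [h]))
  · obtain ⟨x, rfl⟩ := hsupp x y hxy
    obtain ⟨y, rfl⟩ := hsupp y _ hxy.symm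
    obtain ⟨B, ⟨hB, hx, hy⟩, hB'⟩ := h₂ x y ((hadj x y).1 hxy)
    refine ⟨B.map f, ⟨⟨B, hB, rfl⟩, by simpa using hx, by simpa using hy⟩, ?_⟩
    rintro _ ⟨⟨C, hC, rfl⟩, hxC, hyC⟩
    simp only [mem_map'] at hxC hyC
    rw [hB' C ⟨hC, hxC, hyC⟩]

/-- Points of a decomposed graph may be blown up, provided that every blown-up clique can be
decomposed. -/
theorem CliqueDecomposable.comap {G : SimpleGraph V} (h : CliqueDecomposable K G) (f : Y → V)
    (hK : ∀ B : Finset V, #B ∈ K → CliqueDecomposable K' ((cliqueOn B).comap f)) :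
    CliqueDecomposable K' (G.comap f) := by
  obtain ⟨𝓑, h₁, h₂⟩ := h
  refine .of_partition (fun B : 𝓑 => (cliqueOn B.1).comap f) ?_ ?_ fun B => hK _ (h₁ _ B.2).1
  · rintro ⟨B, hB⟩ x y ⟨hne, hx, hy⟩
    exact (h₁ B hB).2 hx hy hne
  · intro x y hxy
    obtain ⟨B, ⟨hB, hx, hy⟩, hB'⟩ := h₂ _ _ hxy
    refine ⟨⟨B, hB⟩, ⟨G.ne_of_adj hxy, hx, hy⟩, ?_⟩
    rintro ⟨C, hC⟩ ⟨-, hxC, hyC⟩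
    exact Subtype.ext (hB' C ⟨hC, hxC, hyC⟩)

theorem cliqueDecomposable_cliqueOn {B : Finset V}
    (h : CliqueDecomposable K (⊤ : SimpleGraph (Fin #B))) : CliqueDecomposable K (cliqueOn B) := by
  refine h.of_embedding (B.equivFin.symm.toEmbedding.trans (.subtype _)) ?_ ?_
  · intro x y
    simp [cliqueOn]
  · rintro x y ⟨-, hx, -⟩
    exact ⟨B.equivFin ⟨x, hx⟩, by simp⟩

theorem cliqueDecomposable_cliqueOn_comap_fst {B : Finset V}
    (h : CliqueDecomposable K (multipartite (Fin #B) W)) :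
    CliqueDecomposable K ((cliqueOn B).comap (Prod.fst : V × W → V)) := by
  refine h.of_embedding ((B.equivFin.symm.toEmbedding.trans (.subtype _)).prodMap (.refl W)) ?_ ?_
  · rintro ⟨x, a⟩ ⟨y, b⟩
    simp [cliqueOn]
  · rintro ⟨x, a⟩ ⟨y, b⟩ ⟨-, hx, -⟩
    exact ⟨(B.equivFin ⟨x, hx⟩, a), by simp⟩

theorem CliqueDecomposable.multipartite (h : CliqueDecomposable K (⊤ : SimpleGraph V))
    (hK : ∀ k ∈ K, CliqueDecomposable K' (multipartite (Fin k) W)) :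
    CliqueDecomposable K' (multipartite V W) :=
  h.comap Prod.fst fun _ hB => cliqueDecomposable_cliqueOn_comap_fst (hK _ hB)

theorem CliqueDecomposable.top_of_equiv (h : CliqueDecomposable K (⊤ : SimpleGraph V)) (e : V ≃ Y) :
    CliqueDecomposable K (⊤ : SimpleGraph Y) :=
  h.of_embedding e.toEmbedding (by simp) fun x _ _ => e.surjective x

theorem cliqueDecomposable_of_subsingleton [Subsingleton V] (G : SimpleGraph V) :
    CliqueDecomposable K G :=
  ⟨∅, by simp, fun x y h => absurd (Subsingleton.elim x y) h.ne⟩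

/-- A (partial) transversal design: words `T t` over `W`, any two of whose letters determine the
word, induce a decomposition of every induced subgraph of the complete multipartite graph. -/
theorem cliqueDecomposable_of_words [DecidableEq W] {I : Type*} {k : ℕ} (T : I → Fin k → W)
    (hT : ∀ i j, i ≠ j → ∀ x y, ∃! t, T t i = x ∧ T t j = y) (P : Finset (Fin k × W))
    (hK : ∀ t, #{i | (i, T t i) ∈ P} ∈ K) :
    CliqueDecomposable K ((⊤ : SimpleGraph (Fin k)).comap fun p : P => p.1.1) := by
  refine ⟨Set.range fun t => univ.filter fun p : P => p.1.2 = T t p.1.1, ?_, ?_⟩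
  · rintro _ ⟨t, rfl⟩
    constructor
    · convert hK t using 1
      refine card_bij (fun p _ => p.1.1) ?_ ?_ ?_
      · rintro ⟨⟨i, x⟩, hp⟩ h
        obtain rfl : x = T t i := by simpa using h
        simpa using hp
      · rintro ⟨⟨i, x⟩, hp⟩ h ⟨⟨j, y⟩, hq⟩ h' hij
        simp_all
      · intro i hi
        exact ⟨⟨(i, T t i), by simpa using hi⟩, by simp, rfl⟩
    · rintro ⟨⟨i, x⟩, hp⟩ h ⟨⟨j, y⟩, hq⟩ h' hne
      simp only [coe_filter, mem_univ, true_and, Set.mem_ofPred_eq] at h h'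
      simp only [SimpleGraph.comap_adj, SimpleGraph.top_adj]
      rintro rfl
      exact hne (by simp [h, h'])
  · rintro ⟨⟨i, x⟩, hp⟩ ⟨⟨j, y⟩, hq⟩ hadj
    obtain ⟨t, ⟨h₁, h₂⟩, ht⟩ := hT i j hadj x y
    refine ⟨_, ⟨⟨t, rfl⟩, by simp [h₁], by simp [h₂]⟩, ?_⟩
    rintro _ ⟨⟨t', rfl⟩, h₁', h₂'⟩
    simp only [mem_filter, mem_univ, true_and] at h₁' h₂'
    rw [ht t' ⟨h₁'.symm, h₂'.symm⟩]

/-- The words of length `k + 1` formed by the values `a + i b` of an affine function at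
`0, …, k - 1` together with its slope `b`. -/
def affineWord {m : ℕ} (k : ℕ) (t : ZMod m × ZMod m) : Fin (k + 1) → ZMod m :=
  Fin.lastCases t.2 fun i : Fin k => t.1 + (i : ℕ) * t.2

theorem affineWord_existsUnique {m k : ℕ}
    (hm : ∀ d, 0 < d → d < k → Nat.Coprime d m) (i j : Fin (k + 1)) (hij : i ≠ j) (x y : ZMod m) :
    ∃! t : ZMod m × ZMod m, affineWord k t i = x ∧ affineWord k t j = y := by
  have hinc : ∀ (i j : Fin k), i < j → ∀ x y : ZMod m,
      ∃! t : ZMod m × ZMod m, t.1 + (i : ℕ) * t.2 = x ∧ t.1 + (j : ℕ) * t.2 = y := by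
    intro i j hij x y
    obtain ⟨d, hd⟩ := Nat.exists_eq_add_of_lt hij
    have hu : IsUnit ((d + 1 : ℕ) : ZMod m) :=
      (ZMod.isUnit_iff_coprime _ _).2 (hm _ (by omega) (by omega))
    obtain ⟨u, hu⟩ := hu.exists_right_inv
    have hj : ((j : ℕ) : ZMod m) = (i : ℕ) + ((d + 1 : ℕ) : ZMod m) := by
      rw [hd]; push_cast; ring
    rw [hj]
    generalize ((d + 1 : ℕ) : ZMod m) = e at hu
    refine ⟨(x - (i : ℕ) * (u * (y - x)), u * (y - x)), ⟨by ring, ?_⟩, ?_⟩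
    · linear_combination (y - x) * hu
    · rintro ⟨a, b⟩ ⟨h₁, h₂⟩
      have hb : b = u * (y - x) := by
        simp only at h₁ h₂
        rw [← h₁, ← h₂]
        linear_combination -b * hu
      refine Prod.ext ?_ hb
      simp only at h₁ ⊢
      rw [← hb, ← h₁]
      ring
  have hlast : ∀ (i : Fin k) (x y : ZMod m),
      ∃! t : ZMod m × ZMod m, t.1 + (i : ℕ) * t.2 = x ∧ t.2 = y := by
    intro i x y
    refine ⟨(x - (i : ℕ) * y, y), by simp, ?_⟩
    rintro ⟨a, b⟩ ⟨h₁, h₂⟩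
    simp only at h₁ h₂
    simp [← h₁, ← h₂]
  induction i using Fin.lastCases with
  | last =>
    induction j using Fin.lastCases with
    | last => exact absurd rfl hij
    | cast j => simpa [affineWord, and_comm] using hlast j y x
  | cast i =>
    induction j using Fin.lastCases with
    | last => simpa [affineWord] using hlast i x y
    | cast j =>
      rcases lt_trichotomy i j with h | rfl | h
      · simpa [affineWord] using hinc i j h x y
      · exact absurd rfl hij
      · simpa [affineWord, and_comm] using hinc j i h y x

/-- Filling the groups of a transversal design with seven groups, one of them truncated. -/
theorem cliqueDecomposable_top_six_mul_add {m u : ℕ} (hm : Nat.Coprime 30 m) (hu : u ≤ m)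
    (h₁ : CliqueDecomposable {6, 7} (⊤ : SimpleGraph (Fin m)))
    (h₂ : CliqueDecomposable {6, 7} (⊤ : SimpleGraph (Fin u))) :
    CliqueDecomposable {6, 7} (⊤ : SimpleGraph (Fin (6 * m + u))) := by
  have : NeZero m := ⟨by rintro rfl; simp at hm⟩
  obtain ⟨U, -, hU⟩ := exists_subset_card_eq (s := (univ : Finset (ZMod m))) (n := u)
    (by simpa [ZMod.card] using hu)
  let P : Finset (Fin 7 × ZMod m) := univ.filter fun p => p.1 = Fin.last 6 → p.2 ∈ U
  have hgroup : ∀ i : Fin 7, #(univ.filter fun p : P => p.1.1 = i) =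
      if i = Fin.last 6 then u else m := by
    intro i
    have : #(univ.filter fun p : P => p.1.1 = i) = #{x | i = Fin.last 6 → x ∈ U} := by
      refine card_bij (fun p _ => p.1.2) ?_ ?_ ?_
      · rintro ⟨⟨j, x⟩, hp⟩ h
        simp only [mem_filter, mem_univ, true_and] at h
        subst h
        simpa [P] using hp
      · rintro ⟨⟨j, x⟩, hp⟩ h ⟨⟨j', y⟩, hq⟩ h' hxy
        simp_all
      · intro x hx
        exact ⟨⟨(i, x), by simpa [P] using hx⟩, by simp, rfl⟩
    rw [this]
    split_ifs with hi
    · simp [hi, hU]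
    · simp only [hi, false_imp_iff, filter_true, card_univ, ZMod.card]
  have hcard : Fintype.card P = 6 * m + u := by
    rw [← card_univ, card_eq_sum_card_fiberwise (f := fun p : P => p.1.1) (t := univ) (by simp)]
    simp only [hgroup, Fin.sum_univ_castSucc (n := 6), Fin.castSucc_ne_last, if_false, if_true,
      sum_const, card_univ, Fintype.card_fin, smul_eq_mul]
  refine CliqueDecomposable.top_of_equiv (V := P) ?_ (Fintype.equivFinOfCardEq hcard)
  refine .of_partition (fun o : Option (Fin 7) =>
    o.elim ((⊤ : SimpleGraph (Fin 7)).comap fun p : P => p.1.1)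
      fun i => cliqueOn (univ.filter fun p : P => p.1.1 = i)) (fun _ => le_top) ?_ ?_
  · intro p q hpq
    by_cases h : p.1.1 = q.1.1
    · refine ⟨some p.1.1, ⟨hpq, by simp, by simp [h]⟩, ?_⟩
      rintro (_ | i) hi
      · exact absurd h hi
      · simpa using (mem_filter.1 hi.2.1).2.symm
    · refine ⟨none, h, ?_⟩
      rintro (_ | i) hi
      · rfl
      · exact absurd ((mem_filter.1 hi.2.1).2.trans (mem_filter.1 hi.2.2).2.symm) h
  · rintro (_ | i)
    · refine cliqueDecomposable_of_words (affineWord 6) (affineWord_existsUnique ?_) P ?_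
      · intro d hd hd'
        refine Nat.Coprime.coprime_dvd_left ?_ (Nat.Coprime.mul_left hm hm)
        interval_cases d <;> decide
      · intro t
        have : univ.filter (fun i => (i, affineWord 6 t i) ∈ P) =
            univ.filter fun i => i = Fin.last 6 → t.2 ∈ U := by
          refine filter_congr fun i _ => ?_
          simp only [P, mem_filter, mem_univ, true_and]
          refine forall_congr' fun hi => ?_
          rw [hi, affineWord, Fin.lastCases_last]
        rw [this]
        by_cases h : t.2 ∈ U
        · right
          simp [h]
        · left
          simp only [h, imp_false, filter_ne', mem_univ, card_erase_of_mem, card_univ,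
            Fintype.card_fin]
    · refine cliqueDecomposable_cliqueOn ?_
      rw [hgroup]
      by_cases hi : i = Fin.last 6
      · rwa [if_pos hi]
      · rwa [if_neg hi]

/-- The complete multipartite graph with six parts of size `m` decomposes into `K_6`s. -/
theorem cliqueDecomposable_multipartite_six {m : ℕ} [NeZero m] (hm : Nat.Coprime 6 m)
    (e : ZMod m ≃ W) :
    CliqueDecomposable {6} (multipartite (Fin 6) W) := by
  refine CliqueDecomposable.of_embedding (V := (univ : Finset (Fin 6 × ZMod m)))
    ((Function.Embedding.subtype _).trans ((Equiv.refl (Fin 6)).prodCongr e).toEmbedding) ?_ ?_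
    (cliqueDecomposable_of_words (affineWord 5) (affineWord_existsUnique ?_) univ ?_)
  · simp
  · rintro ⟨i, x⟩ - -
    exact ⟨⟨(i, e.symm x), mem_univ _⟩, by simp⟩
  · intro d hd hd'
    refine Nat.Coprime.coprime_dvd_left ?_ (Nat.Coprime.mul_left hm hm)
    interval_cases d <;> decide
  · simp

/-- Base blocks, by their graphs over the nonzero residues mod 7, of a difference family in
`ZMod 7 × ZMod 5 × ZMod 5` relative to `ZMod 5 × ZMod 5`. -/
def baseBlock : Fin 5 → ZMod 7 → ZMod 5 × ZMod 5 :=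
  ![![(0, 0), (4, 0), (0, 4), (2, 3), (1, 1), (1, 3), (2, 4)],
    ![(0, 0), (1, 1), (4, 0), (1, 0), (0, 4), (4, 4), (0, 1)],
    ![(0, 0), (0, 0), (0, 1), (0, 0), (3, 3), (4, 3), (2, 0)],
    ![(0, 0), (2, 0), (0, 0), (2, 1), (4, 4), (0, 2), (0, 0)],
    ![(0, 0), (1, 0), (0, 2), (3, 3), (0, 0), (0, 0), (4, 1)]]

theorem baseBlock_difference : ∀ d : ZMod 7, d ≠ 0 → ∀ w : ZMod 5 × ZMod 5,
    ∃! s : Fin 5 × ZMod 7, s.2 ≠ 0 ∧ s.2 ≠ d ∧ baseBlock s.1 s.2 - baseBlock s.1 (s.2 - d) = w := by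
  unfold ExistsUnique
  decide +kernel

/-- The complete multipartite graph with seven parts of size 25 decomposes into `K_6`s. -/
theorem cliqueDecomposable_multipartite_seven :
    CliqueDecomposable {6} (multipartite (Fin 7) (ZMod 5 × ZMod 5)) := by
  change CliqueDecomposable {6} (multipartite (ZMod 7) (ZMod 5 × ZMod 5))
  refine ⟨Set.range fun s : Fin 5 × ZMod 7 × (ZMod 5 × ZMod 5) => univ.filter fun p =>
    p.1 ≠ s.2.1 ∧ p.2 = baseBlock s.1 (p.1 - s.2.1) + s.2.2, ?_, ?_⟩
  · rintro _ ⟨⟨i, t, w⟩, rfl⟩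
    constructor
    · have : #{x : ZMod 7 | x ≠ t} = 6 := by
        rw [filter_ne', card_erase_of_mem (mem_univ _)]
        rfl
      refine Eq.trans ?_ this
      refine card_bij (fun p _ => p.1) ?_ ?_ ?_
      · simp
      · rintro ⟨x, y⟩ h ⟨x', y'⟩ h' hxx
        simp_all
      · intro x hx
        exact ⟨(x, baseBlock i (x - t) + w), by simpa using hx, rfl⟩
    · rintro ⟨x, y⟩ h ⟨x', y'⟩ h' hne
      simp only [coe_filter, mem_univ, true_and, Set.mem_ofPred_eq] at h h'
      simp only [SimpleGraph.comap_adj, SimpleGraph.top_adj]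
      rintro rfl
      exact hne (by rw [h.2, h'.2])
  · rintro ⟨x, y⟩ ⟨x', y'⟩ hadj
    simp only [SimpleGraph.comap_adj, SimpleGraph.top_adj] at hadj
    obtain ⟨⟨i, p⟩, ⟨h₁, h₂, h₃⟩, huniq⟩ :=
      baseBlock_difference (x - x') (sub_ne_zero.2 hadj) (y - y')
    simp only at h₁ h₂ h₃
    have hp : x' - (x - p) = p - (x - x') := by ring
    refine ⟨_, ⟨⟨(i, x - p, y - baseBlock i p), rfl⟩, ?_, ?_⟩, ?_⟩
    · simp only [mem_filter, mem_univ, true_and, sub_sub_cancel, add_sub_cancel, and_true]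
      exact fun h => h₁ (sub_eq_self.1 h.symm)
    · simp only [mem_filter, mem_univ, true_and]
      refine ⟨fun h => h₂ ?_, ?_⟩
      · rw [h]; ring
      · rw [hp, ← sub_eq_zero, ← sub_eq_zero.2 h₃]
        abel
    · rintro _ ⟨⟨⟨j, t, w⟩, rfl⟩, hx, hx'⟩
      simp only [mem_filter, mem_univ, true_and] at hx hx'
      have := huniq (j, x - t) ⟨sub_ne_zero.2 hx.1, fun h => hx'.1 (sub_right_injective h).symm, ?_⟩
      · simp only [Prod.mk.injEq] at this
        obtain ⟨rfl, rfl⟩ := this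
        simp [hx.2]
      · have : x - t - (x - x') = x' - t := by ring
        simp only [this, hx.2, hx'.2]
        abel

end Decomposition

section Gaps

variable {S : Set ℕ}

theorem seven_pow_mul_mem (h₁ : 1 ∈ S)
    (hS : ∀ m ∈ S, ∀ u ∈ S, Nat.Coprime 30 m → u ≤ m → 6 * m + u ∈ S) (a b : ℕ) :
    7 ^ a * 43 ^ b ∈ S := by
  have hcop : ∀ a b, Nat.Coprime 30 (7 ^ a * 43 ^ b) := fun a b =>
    Nat.Coprime.mul_right (Nat.Coprime.pow_right _ (by norm_num))
      (Nat.Coprime.pow_right _ (by norm_num))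
  have hseven : ∀ a b, 7 ^ a * 43 ^ b ∈ S → 7 ^ (a + 1) * 43 ^ b ∈ S := fun a b h => by
    convert hS _ h _ h (hcop a b) le_rfl using 1
    ring
  induction b with
  | zero =>
    induction a with
    | zero => simpa using h₁
    | succ a ih => exact hseven a 0 ih
  | succ b ih =>
    convert hS _ (hseven a b ih) _ ih (hcop _ b)
      (Nat.mul_le_mul_right _ (Nat.pow_le_pow_right (by norm_num) a.le_succ)) using 1
    ring

/-- Since `7 ^ 29 / 43 ^ 15` is slightly larger than `1`, the products of powers of `7` and `43` in
a residue class mod `5` have small gaps on a long interval. -/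
theorem exists_gap_of_le (h₁ : 1 ∈ S)
    (hS : ∀ m ∈ S, ∀ u ∈ S, Nat.Coprime 30 m → u ≤ m → 6 * m + u ∈ S) :
    ∃ D, 18 ≤ D ∧ ∀ x ≤ 50 * D, ∀ c, 1 ≤ c → c < 5 →
      ∃ s ∈ S, s % 6 = 1 ∧ s % 5 = c ∧ x ≤ s ∧ s ≤ x + D := by
  obtain ⟨N, hN⟩ : ∃ N : ℕ, 50 * (343 * (43 ^ 15) ^ N) ≤ (7 ^ 29) ^ N := by
    obtain ⟨N, hN⟩ := pow_unbounded_of_one_lt (17150 : ℚ) (y := 7 ^ 29 / 43 ^ 15) (by norm_num)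
    refine ⟨N, ?_⟩
    rw [div_pow, lt_div_iff₀ (by positivity)] at hN
    have : (17150 : ℚ) * (43 ^ 15) ^ N ≤ (7 ^ 29) ^ N := hN.le
    have h' : 17150 * (43 ^ 15) ^ N ≤ (7 ^ 29) ^ N := by exact_mod_cast this
    omega
  refine ⟨343 * (43 ^ 15) ^ N, ?_, ?_⟩
  · have : 0 < (43 ^ 15) ^ N := by positivity
    omega
  intro x hx c hc hc'
  obtain ⟨j, hj, hjc⟩ : ∃ j < 4, 7 ^ j * 2 ^ N % 5 = c := by
    have hpow : ∀ n, 2 ^ n % 5 = 1 ∨ 2 ^ n % 5 = 2 ∨ 2 ^ n % 5 = 3 ∨ 2 ^ n % 5 = 4 := fun n => by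
      induction n with
      | zero => simp
      | succ n ih => rw [pow_succ]; omega
    have hex : ∃ j < 4, 7 ^ j * (2 ^ N % 5) % 5 = c := by
      rcases hpow N with h | h | h | h <;> rw [h] <;> clear h hx <;> interval_cases c <;> decide
    simpa only [Nat.mul_mod_mod] using hex
  have hj343 : 7 ^ j ≤ 343 := by interval_cases j <;> norm_num
  let e : ℕ → ℕ := fun i => 7 ^ j * ((7 ^ 29) ^ i * (43 ^ 15) ^ (N - i))
  have heS : ∀ i, e i ∈ S := fun i => by
    have := seven_pow_mul_mem h₁ hS (j + 29 * i) (15 * (N - i))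
    rwa [pow_add, pow_mul, pow_mul, mul_assoc] at this
  have he6 : ∀ i, e i % 6 = 1 := fun i => by
    have : e i ≡ 1 ^ j * ((1 ^ 29) ^ i * (1 ^ 15) ^ (N - i)) [MOD 6] :=
      .mul (.pow _ rfl) (.mul (.pow _ (.pow _ rfl)) (.pow _ (.pow _ rfl)))
    simpa [Nat.ModEq] using this
  have he5 : ∀ i ≤ N, e i % 5 = c := fun i hi => by
    have : e i ≡ 7 ^ j * (2 ^ i * 2 ^ (N - i)) [MOD 5] :=
      .mul rfl (.mul (.pow _ (by decide)) (.pow _ (by decide)))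
    rwa [← pow_add, Nat.add_sub_cancel' hi, Nat.ModEq, hjc] at this
  have hex : ∃ i, x ≤ e i ∧ i ≤ N := by
    refine ⟨N, hx.trans (hN.trans ?_), le_rfl⟩
    simp only [e, Nat.sub_self, pow_zero, mul_one]
    exact Nat.le_mul_of_pos_left _ (by positivity)
  obtain ⟨hxi, hiN⟩ := Nat.find_spec hex
  refine ⟨e (Nat.find hex), heS _, he6 _, he5 _ hiN, hxi, ?_⟩
  rcases hi : Nat.find hex with _ | i
  · have : e 0 ≤ 343 * (43 ^ 15) ^ N := by
      simp only [e, pow_zero, one_mul, Nat.sub_zero]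
      exact Nat.mul_le_mul_right _ hj343
    omega
  · rw [hi] at hiN
    have hlt : e i < x := by
      by_contra! h
      exact Nat.find_min hex (m := i) (by omega) ⟨h, by omega⟩
    have hratio : 50 * e (i + 1) ≤ 51 * e i := by
      obtain ⟨M, hM⟩ : ∃ M, N - i = M + 1 := ⟨N - i - 1, by omega⟩
      have hM' : N - (i + 1) = M := by omega
      simp only [e, hM, hM']
      rw [pow_succ, pow_succ (43 ^ 15)]
      have : 50 * 7 ^ 29 ≤ 51 * 43 ^ 15 := by norm_num
      calc _ = (7 ^ j * ((7 ^ 29) ^ i * (43 ^ 15) ^ M)) * (50 * 7 ^ 29) := by ring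
        _ ≤ (7 ^ j * ((7 ^ 29) ^ i * (43 ^ 15) ^ M)) * (51 * 43 ^ 15) := Nat.mul_le_mul_left _ this
        _ = _ := by ring
    omega

theorem exists_bounded_gaps (h₁ : 1 ∈ S)
    (hS : ∀ m ∈ S, ∀ u ∈ S, Nat.Coprime 30 m → u ≤ m → 6 * m + u ∈ S) :
    ∃ D, ∀ x, ∃ s ∈ S, x ≤ s ∧ s ≤ x + D := by
  obtain ⟨D, hD, hsmall⟩ := exists_gap_of_le h₁ hS
  have key : ∀ x c, 1 ≤ c → c < 5 → ∃ s ∈ S, s % 6 = 1 ∧ s % 5 = c ∧ x ≤ s ∧ s ≤ x + D := by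
    intro x
    induction x using Nat.strong_induction_on with
    | _ x ih =>
      intro c hc hc'
      by_cases hx : x ≤ 50 * D
      · exact hsmall x hx c hc hc'
      · obtain ⟨m, hmS, hm6, hm5, hm, hm'⟩ := ih (x / 6 - D) (by omega) (3 * c % 5)
          (by omega) (by omega)
        obtain ⟨u, huS, hu6, hu5, hu, hu'⟩ := ih (x - 6 * m) (by omega) (3 * c % 5)
          (by omega) (by omega)
        have hcop : Nat.Coprime 30 m := by
          have h6 : Nat.Coprime 6 m := by
            rw [Nat.coprime_iff_gcd_eq_one, Nat.gcd_rec, hm6]; rfl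
          have h5 : Nat.Coprime 5 m := by
            refine (Nat.Prime.coprime_iff_not_dvd (by norm_num)).2 fun h => ?_
            omega
          exact Nat.Coprime.mul_left h6 h5
        exact ⟨6 * m + u, hS m hmS u huS hcop (by omega), by omega, by omega, by omega, by omega⟩
  refine ⟨D, fun x => ?_⟩
  obtain ⟨s, hs, -, -, h⟩ := key x 1 le_rfl (by norm_num)
  exact ⟨s, hs, h⟩

end Gaps

section Assembly

/-- A decomposition of the edges of a complete multipartite graph with parts of bounded size into
copies of `K_6` yields a coloring of the complete graph with few colors. -/
theorem exists_coloring_of_multipartite {V W : Type*} [Fintype V] [Fintype W]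
    (h : CliqueDecomposable {6} (multipartite V W)) :
    ∃ c : Sym2 (V × W) → ℕ,
      (∀ a b d, a ≠ b → a ≠ d → b ≠ d → c s(a, b) ≠ c s(a, d)) ∧
      (∀ v : ℕ → V × W, (∀ i j, i < 8 → j < 8 → v i = v j → i = j) →
        5 ≤ #((range 7).image fun i => c s(v i, v (i + 1)))) ∧
      ∃ T : Finset ℕ, (∀ e, c e ∈ T) ∧
        30 * #T ≤ 7 * (Fintype.card V * Fintype.card W) ^ 2 +
          30 * (Fintype.card V * Fintype.card W ^ 2) := by
  classical
  obtain ⟨𝓢, hclique, hcover⟩ := h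
  let 𝓑 : Finset (Finset (V × W)) := univ.filter (· ∈ 𝓢)
  have hmem : ∀ B, B ∈ 𝓑 ↔ B ∈ 𝓢 := by simp [𝓑]
  have hcard : ∀ B ∈ 𝓑, #B = 6 := fun B hB => (hclique B ((hmem B).1 hB)).1
  have hunique : ∀ B ∈ 𝓑, ∀ B' ∈ 𝓑, ∀ x y, x ≠ y → x ∈ B → y ∈ B → x ∈ B' → y ∈ B' → B = B' :=
    fun B hB B' hB' x y hxy hx hy hx' hy' =>
      (hcover x y ((hclique B ((hmem B).1 hB)).2 hx hy hxy)).unique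
        ⟨(hmem B).1 hB, hx, hy⟩ ⟨(hmem B').1 hB', hx', hy'⟩
  have hlin : ∀ B ∈ 𝓑, ∀ B' ∈ 𝓑, B ≠ B' → #(B ∩ B') ≤ 1 := by
    intro B hB B' hB' hne
    by_contra! hlt
    obtain ⟨x, hx, y, hy, hxy⟩ := one_lt_card.1 hlt
    rw [mem_inter] at hx hy
    exact hne (hunique B hB B' hB' x y hxy hx.1 hy.1 hx.2 hy.2)
  have hlabels : ∀ B : Finset (V × W), ∃ l : V × W → Fin 6, B ∈ 𝓑 → Set.InjOn l B := by
    intro B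
    by_cases hB : B ∈ 𝓑
    · refine ⟨fun x => if hx : x ∈ B then B.equivFinOfCardEq (hcard B hB) ⟨x, hx⟩ else 0,
        fun _ x hx y hy hxy => ?_⟩
      rw [mem_coe] at hx hy
      simpa [hx, hy] using hxy
    · exact ⟨fun _ => 0, fun h => absurd h hB⟩
  choose label hlabel using hlabels
  let col := blockColor 𝓑 label
  let enc : (Finset (V × W) × Fin 7) ⊕ Sym2 (V × W) → ℕ := fun x => Fintype.equivFin _ x
  have henc : Function.Injective enc := Fin.val_injective.comp (Equiv.injective _)
  let T : Finset ((Finset (V × W) × Fin 7) ⊕ Sym2 (V × W)) :=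
    (𝓑 ×ˢ univ).image Sum.inl ∪
      (univ : Finset (V × W × W)).image fun p => Sum.inr s((p.1, p.2.1), (p.1, p.2.2))
  have hT : ∀ e, col e ∈ T := by
    intro e
    by_cases he : ∃ B ∈ 𝓑, ∀ x ∈ e, x ∈ B
    · refine mem_union_left _ ?_
      rw [show col e = Sum.inl (he.choose, sixColor (e.map (label he.choose))) from dif_pos he]
      exact mem_image_of_mem _ (mem_product.2 ⟨he.choose_spec.1, mem_univ _⟩)
    · refine mem_union_right _ ?_
      rw [show col e = Sum.inr e from dif_neg he]
      induction e with
      | _ x y =>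
        obtain ⟨i, a⟩ := x
        obtain ⟨j, b⟩ := y
        have hij : i = j := by
          by_contra hij
          obtain ⟨B, ⟨hB, hx, hy⟩, -⟩ := hcover (i, a) (j, b) hij
          refine he ⟨B, (hmem B).2 hB, fun z hz => ?_⟩
          rcases Sym2.mem_iff.1 hz with rfl | rfl <;> assumption
        subst hij
        exact mem_image.2 ⟨(i, a, b), mem_univ _, rfl⟩
  have hblocks : 30 * #𝓑 ≤ (Fintype.card V * Fintype.card W) ^ 2 := by
    have hdisj : (𝓑 : Set (Finset (V × W))).PairwiseDisjoint offDiag := by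
      intro B hB B' hB' hne
      refine disjoint_left.2 fun p hp hp' => hne ?_
      rw [mem_offDiag] at hp hp'
      exact hunique B hB B' hB' p.1 p.2 hp.2.2 hp.1 hp.2.1 hp'.1 hp'.2.1
    calc 30 * #𝓑 = ∑ B ∈ 𝓑, #B.offDiag := by
          rw [sum_congr rfl fun B hB => by rw [offDiag_card, hcard B hB]]
          simp [mul_comm]
      _ = #(𝓑.biUnion offDiag) := (card_biUnion hdisj).symm
      _ ≤ Fintype.card ((V × W) × (V × W)) := card_le_univ _
      _ = _ := by simp only [Fintype.card_prod]; ring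
  refine ⟨fun e => enc (col e), ?_, ?_, T.image enc, fun e => mem_image_of_mem _ (hT e), ?_⟩
  · exact fun a b d hab had hbd =>
      henc.ne (blockColor_proper (fun B hB => hlabel B hB) hab had hbd)
  · intro v hv
    have := five_le_card_blockColor (fun B hB => hlabel B hB) hcard hlin v hv
    rwa [← card_image_of_injective _ henc, image_image] at this
  · have hcardT : #T ≤ #𝓑 * 7 + Fintype.card V * Fintype.card W ^ 2 := by
      refine (card_union_le _ _).trans
        (add_le_add (card_image_le.trans ?_) (card_image_le.trans ?_))
      · simp
      · simp [sq]
    rw [card_image_of_injective _ henc]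
    omega

/-- Colorings restrict to smaller vertex sets. -/
theorem exists_coloring_fin {X : Type*} [Fintype X] {n : ℕ} (hn : n ≤ Fintype.card X)
    (c : Sym2 X → ℕ) (hc : ∀ a b d, a ≠ b → a ≠ d → b ≠ d → c s(a, b) ≠ c s(a, d))
    (hpath : ∀ v : ℕ → X, (∀ i j, i < 8 → j < 8 → v i = v j → i = j) →
      5 ≤ #((range 7).image fun i => c s(v i, v (i + 1))))
    (T : Finset ℕ) (hT : ∀ e, c e ∈ T) :
    ∃ c' : Sym2 (Fin n) → ℕ,
      (∀ a b d, a ≠ b → a ≠ d → b ≠ d → c' s(a, b) ≠ c' s(a, d)) ∧ usedColors n c' ≤ #T ∧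
      ∀ v : ℕ → Fin n, InjOnFirst n 8 v → 5 ≤ pathColorCount n 8 c' v := by
  obtain ⟨f⟩ : Nonempty (Fin n ↪ X) :=
    Function.Embedding.nonempty_of_card_le (by simpa using hn)
  refine ⟨fun e => c (e.map f), fun a b d hab had hbd => ?_, ?_, fun v hv => ?_⟩
  · exact hc _ _ _ (f.injective.ne hab) (f.injective.ne had) (f.injective.ne hbd)
  · exact card_le_card (image_subset_iff.2 fun e _ => hT _)
  · exact hpath (fun i => f (v i)) fun i j hi hj h => hv i j hi hj (f.injective h)

theorem exists_cliqueDecomposable_multipartite :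
    ∃ D, ∀ x, ∃ v, x ≤ v ∧ v ≤ x + D ∧
      CliqueDecomposable {6} (multipartite (Fin v) (ZMod 5 × ZMod 5)) := by
  obtain ⟨D, hD⟩ := exists_bounded_gaps
    (S := {v | CliqueDecomposable {6, 7} (⊤ : SimpleGraph (Fin v))})
    (cliqueDecomposable_of_subsingleton (V := Fin 1) ⊤)
    fun m hm u hu hcop hle => cliqueDecomposable_top_six_mul_add hcop hle hm hu
  refine ⟨D, fun x => ?_⟩
  obtain ⟨v, hv, hxv, hvD⟩ := hD x
  refine ⟨v, hxv, hvD, CliqueDecomposable.multipartite hv fun k hk => ?_⟩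
  rcases hk with rfl | rfl
  · exact cliqueDecomposable_multipartite_six (m := 25) (by norm_num)
      (Fintype.equivOfCardEq (by simp [ZMod.card]))
  · exact cliqueDecomposable_multipartite_seven

end Assembly

/-- There is a constant `C` such that for all `n ≥ 8` there is a proper
edge-coloring of `K_n` with at most `7n²/30 + C·n` colors in which every path on 8
vertices receives at least 5 distinct colors. -/
theorem generalized_ramsey_proper_P8_upper :
    ∃ C : ℝ, ∀ n : ℕ, 8 ≤ n →
      ∃ c : Sym2 (Fin n) → ℕ,
        (∀ a b d : Fin n, a ≠ b → a ≠ d → b ≠ d → c s(a, b) ≠ c s(a, d)) ∧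
        (usedColors n c : ℝ) ≤ 7 * (n : ℝ) ^ 2 / 30 + C * n ∧
        ∀ v : ℕ → Fin n, InjOnFirst n 8 v → 5 ≤ pathColorCount n 8 c v := by
  obtain ⟨D, hD⟩ := exists_cliqueDecomposable_multipartite
  let E : ℝ := 25 * (D + 1)
  refine ⟨7 * (2 * E + E ^ 2) / 30 + 25 * (1 + E), fun n hn => ?_⟩
  obtain ⟨v, hv, hvD, hdec⟩ := hD (n / 25 + 1)
  have hcardX : Fintype.card (Fin v × (ZMod 5 × ZMod 5)) = 25 * v := by
    simp [ZMod.card, mul_comm]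
  obtain ⟨c, hc, hpath, T, hT, hTcard⟩ := exists_coloring_of_multipartite hdec
  obtain ⟨c', hc', hused, hpath'⟩ :=
    exists_coloring_fin (n := n) (by rw [hcardX]; omega) c hc hpath T hT
  refine ⟨c', hc', ?_, hpath'⟩
  simp only [Fintype.card_fin, Fintype.card_prod, ZMod.card] at hTcard
  have hTreal : 30 * (#T : ℝ) ≤ 7 * (25 * v : ℝ) ^ 2 + 30 * (25 * (25 * v)) := by
    have h := Nat.cast_le (α := ℝ).2 hTcard
    push_cast at h
    linarith
  have hvle : (25 * v : ℝ) ≤ n + E := by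
    have : ((25 * v : ℕ) : ℝ) ≤ (n + 25 * (D + 1) : ℕ) := Nat.cast_le.2 (by omega)
    simpa [E] using this
  have hsq : (25 * v : ℝ) ^ 2 ≤ (n + E) ^ 2 := by gcongr
  have hn1 : (1 : ℝ) ≤ n := by exact_mod_cast (by omega : 1 ≤ n)
  have hE : 0 ≤ E := by positivity
  have hE1 : E ≤ E * n := le_mul_of_one_le_right hE hn1
  have hE2 : E ^ 2 ≤ E ^ 2 * n := le_mul_of_one_le_right (sq_nonneg E) hn1
  have husedT : (usedColors n c' : ℝ) ≤ #T := by exact_mod_cast hused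
  linarith
end

section
/- For all n ≥ 8, every proper edge-coloring of K_n in which each path on 8 vertices receives at least 5 distinct colors uses at least (7/15)·C(n,2) colors; that is, f_proper(K_n, P_8, 5) ≥ 7n²/30 + O(n). -/
open Finset

/-- Edges sharing exactly one vertex have different colors. -/
def IsProperColoring {n : ℕ} (c : Sym2 (Fin n) → ℕ) : Prop :=
  ∀ a b d : Fin n, a ≠ b → a ≠ d → b ≠ d → c s(a, b) ≠ c s(a, d)

/-- Three pairwise disjoint edges `xx'`, `yy'`, `zz'` of color `t`. -/
def IsTripleMatching {n : ℕ} (c : Sym2 (Fin n) → ℕ) (t : ℕ) (x x' y y' z z' : Fin n) : Prop :=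
  [x, x', y, y', z, z'].Nodup ∧ c s(x, x') = t ∧ c s(y, y') = t ∧ c s(z, z') = t

/-- The color `k` appears on an edge joining two of three disjoint edges of color `t ≠ k`. -/
def IsCrossColor {n : ℕ} (c : Sym2 (Fin n) → ℕ) (t k : ℕ) : Prop :=
  k ≠ t ∧ ∃ x x' y y' z z', IsTripleMatching c t x x' y y' z z' ∧ c s(x, y) = k

/-- The edges of color `k`. -/
def colorClass {n : ℕ} (c : Sym2 (Fin n) → ℕ) (k : ℕ) : Finset (Sym2 (Fin n)) :=
  ((Finset.univ : Finset (Sym2 (Fin n))).filter fun e => ¬ e.IsDiag).filter fun e => c e = k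

section

variable {n : ℕ} {c : Sym2 (Fin n) → ℕ}

/-- An 8-vertex path whose edges have colors among four values contradicts the hypothesis that
every such path has five colors. -/
lemma false_of_path_colors
    (h : ∀ v : ℕ → Fin n, InjOnFirst n 8 v → 5 ≤ pathColorCount n 8 c v)
    {v₀ v₁ v₂ v₃ v₄ v₅ v₆ v₇ : Fin n} (hv : [v₀, v₁, v₂, v₃, v₄, v₅, v₆, v₇].Nodup)
    (A : Finset ℕ) (hA : A.card ≤ 4) (h₀ : c s(v₀, v₁) ∈ A) (h₁ : c s(v₁, v₂) ∈ A)
    (h₂ : c s(v₂, v₃) ∈ A) (h₃ : c s(v₃, v₄) ∈ A) (h₄ : c s(v₄, v₅) ∈ A)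
    (h₅ : c s(v₅, v₆) ∈ A) (h₆ : c s(v₆, v₇) ∈ A) : False := by
  have key := h (fun i => [v₀, v₁, v₂, v₃, v₄, v₅, v₆, v₇].getD i v₀) ?_
  · have hsub : ((Finset.range (8 - 1)).image fun i =>
        c s([v₀, v₁, v₂, v₃, v₄, v₅, v₆, v₇].getD i v₀,
          [v₀, v₁, v₂, v₃, v₄, v₅, v₆, v₇].getD (i + 1) v₀)) ⊆ A := by
      intro k hk
      obtain ⟨i, hi, rfl⟩ := Finset.mem_image.1 hk
      have hi' : i < 7 := Finset.mem_range.1 hi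
      interval_cases i <;> simpa
    exact absurd (key.trans (Finset.card_le_card hsub)) (by omega)
  · intro i j hi hj hij
    have hi' : i < [v₀, v₁, v₂, v₃, v₄, v₅, v₆, v₇].length := hi
    have hj' : j < [v₀, v₁, v₂, v₃, v₄, v₅, v₆, v₇].length := hj
    simp only [List.getD_eq_getElem _ _ hi', List.getD_eq_getElem _ _ hj'] at hij
    exact (hv.getElem_inj_iff).1 hij

/-- Fewer than `n` vertices leave a vertex of `Fin n` unused. -/
lemma exists_notMem_list (l : List (Fin n)) (hl : l.length < n) : ∃ w, w ∉ l := by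
  by_contra! hall
  have hcard : (Finset.univ : Finset (Fin n)).card ≤ l.toFinset.card :=
    Finset.card_le_card fun w _ => List.mem_toFinset.2 (hall w)
  have := l.toFinset_card_le
  simp at hcard
  omega

/-- Distinct edges of the same color in a proper coloring are disjoint. -/
lemma IsProperColoring.disjoint (hc : IsProperColoring c) {a b u v : Fin n} (hab : a ≠ b)
    (huv : u ≠ v) (hcol : c s(a, b) = c s(u, v)) (hne : s(a, b) ≠ s(u, v)) :
    a ≠ u ∧ a ≠ v ∧ b ≠ u ∧ b ≠ v := by
  have hswap : ∀ p q : Fin n, s(p, q) = s(q, p) := fun p q => Sym2.eq_swap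
  refine ⟨?_, ?_, ?_, ?_⟩ <;> rintro rfl
  · exact hc a b v hab huv (fun e => hne (by rw [e])) hcol
  · rw [hswap u] at hcol hne
    exact hc a b u hab huv.symm (fun e => hne (by rw [e])) hcol
  · rw [hswap a] at hcol hne
    exact hc b a v hab.symm huv (fun e => hne (by rw [e])) hcol
  · rw [hswap a, hswap u] at hcol hne
    exact hc b a u hab.symm huv.symm (fun e => hne (by rw [e])) hcol

namespace IsTripleMatching

variable {t : ℕ} {x x' y y' z z' : Fin n}

/-- The first two edges may be exchanged. -/
lemma exchange (m : IsTripleMatching c t x x' y y' z z') :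
    IsTripleMatching c t y y' x x' z z' := by
  obtain ⟨hd, h₁, h₂, h₃⟩ := m
  exact ⟨by simp at hd ⊢; grind, h₂, h₁, h₃⟩

/-- The last two edges may be exchanged. -/
lemma exchange_last (m : IsTripleMatching c t x x' y y' z z') :
    IsTripleMatching c t x x' z z' y y' := by
  obtain ⟨hd, h₁, h₂, h₃⟩ := m
  exact ⟨by simp at hd ⊢; grind, h₁, h₃, h₂⟩

/-- The first edge may be reversed. -/
lemma reverse (m : IsTripleMatching c t x x' y y' z z') :
    IsTripleMatching c t x' x y y' z z' := by
  obtain ⟨hd, h₁, h₂, h₃⟩ := m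
  exact ⟨by simp at hd ⊢; grind, by rwa [Sym2.eq_swap], h₂, h₃⟩

/-- The second edge may be reversed. -/
lemma reverse_second (m : IsTripleMatching c t x x' y y' z z') :
    IsTripleMatching c t x x' y' y z z' :=
  m.exchange.reverse.exchange

/-- The third edge may be reversed. -/
lemma reverse_last (m : IsTripleMatching c t x x' y y' z z') :
    IsTripleMatching c t x x' y y' z' z :=
  m.exchange_last.reverse_second.exchange_last

/-- An edge leaving the three disjoint edges has a different color from a cross edge. -/
lemma ne_of_leaves (hn : 8 ≤ n)
    (h : ∀ v : ℕ → Fin n, InjOnFirst n 8 v → 5 ≤ pathColorCount n 8 c v)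
    (m : IsTripleMatching c t x x' y y' z z') {v : Fin n} (hv : v ∉ [x, x', y, y', z, z']) :
    c s(v, x') ≠ c s(x, y) ∧ c s(v, z) ≠ c s(x, y) := by
  obtain ⟨hd, h₁, h₂, h₃⟩ := m
  obtain ⟨w, hw⟩ := exists_notMem_list [x, x', y, y', z, z', v] (by simp; omega)
  have h₁' : c s(x', x) = t := by rwa [Sym2.eq_swap]
  constructor <;> intro hk
  · exact false_of_path_colors h (v₀ := v) (v₁ := x') (v₂ := x) (v₃ := y) (v₄ := y') (v₅ := z)
      (v₆ := z') (v₇ := w) (by simp at hd hv hw ⊢; grind)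
      {t, c s(x, y), c s(y', z), c s(z', w)} Finset.card_le_four
      (by simp [*]) (by simp [*]) (by simp [*]) (by simp [*]) (by simp [*]) (by simp [*])
      (by simp [*])
  · exact false_of_path_colors h (v₀ := v) (v₁ := z) (v₂ := z') (v₃ := x') (v₄ := x) (v₅ := y)
      (v₆ := y') (v₇ := w) (by simp at hd hv hw ⊢; grind)
      {t, c s(x, y), c s(z', x'), c s(y', w)} Finset.card_le_four
      (by simp [*]) (by simp [*]) (by simp [*]) (by simp [*]) (by simp [*]) (by simp [*])
      (by simp [*])

/-- Cross edges `xy` and `x'z` have different colors. -/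
lemma cross_ne (hn : 8 ≤ n)
    (h : ∀ v : ℕ → Fin n, InjOnFirst n 8 v → 5 ≤ pathColorCount n 8 c v)
    (m : IsTripleMatching c t x x' y y' z z') : c s(x', z) ≠ c s(x, y) := by
  obtain ⟨hd, h₁, h₂, h₃⟩ := m
  obtain ⟨w, hw⟩ := exists_notMem_list [x, x', y, y', z, z'] (by simp; omega)
  obtain ⟨w', hw'⟩ := exists_notMem_list [x, x', y, y', z, z', w] (by simp; omega)
  have h₂' : c s(y', y) = t := by rwa [Sym2.eq_swap]
  have hyx : c s(y, x) = c s(x, y) := by rw [Sym2.eq_swap]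
  intro hk
  exact false_of_path_colors h (v₀ := y') (v₁ := y) (v₂ := x) (v₃ := x') (v₄ := z) (v₅ := z')
    (v₆ := w) (v₇ := w') (by simp at hd hw hw' ⊢; grind)
    {t, c s(x, y), c s(z', w), c s(w, w')} Finset.card_le_four
    (by simp [*]) (by simp [*]) (by simp [*]) (by simp [*]) (by simp [*]) (by simp [*])
    (by simp [*])

/-- The only other edge which may have the color of the cross edge `xy` is `x'y'`. -/
lemma eq_of_color_eq (hn : 8 ≤ n) (hc : IsProperColoring c)
    (h : ∀ v : ℕ → Fin n, InjOnFirst n 8 v → 5 ≤ pathColorCount n 8 c v)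
    (m : IsTripleMatching c t x x' y y' z z') (hk : c s(x, y) ≠ t) {u v : Fin n} (huv : u ≠ v)
    (hcol : c s(u, v) = c s(x, y)) : s(u, v) = s(x, y) ∨ s(u, v) = s(x', y') := by
  by_contra! hne
  obtain ⟨hne₁, hne₂⟩ := hne
  have hxy : x ≠ y := by have := m.1; simp at this; grind
  obtain ⟨hux, huy, hvx, hvy⟩ := hc.disjoint huv hxy hcol hne₁
  have hyx : c s(y, x) = c s(x, y) := by rw [Sym2.eq_swap]
  have hzz : c s(z', z) = c s(z, z') := by rw [Sym2.eq_swap]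
  -- an edge of this color has both ends or no end in the matching
  have leave : ∀ p q : Fin n, c s(p, q) = c s(x, y) → p ∉ [x, x', y, y', z, z'] →
      q ≠ x → q ≠ y → q ∉ [x, x', y, y', z, z'] := by
    intro p q hpq hp hqx hqy hq
    have e₁ := m.ne_of_leaves hn h hp
    have e₂ := m.exchange.ne_of_leaves hn h (v := p) (by simp at hp ⊢; grind)
    have e₃ := m.reverse_last.ne_of_leaves hn h (v := p) (by simp at hp ⊢; grind)
    rw [hyx] at e₂
    simp at hq
    rcases hq with rfl | rfl | rfl | rfl | rfl | rfl <;> tauto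
  have hvu : c s(v, u) = c s(x, y) := by rw [Sym2.eq_swap, hcol]
  by_cases hu : u ∈ [x, x', y, y', z, z']
  · have hv : v ∈ [x, x', y, y', z, z'] := by
      by_contra hv
      exact leave v u hvu hv hux huy hu
    have hsw : s(y', x') = s(x', y') := Sym2.eq_swap
    have e₁ := m.cross_ne hn h
    have e₂ := m.reverse_last.cross_ne hn h
    have e₃ := m.exchange.cross_ne hn h
    have e₄ := m.exchange.reverse_last.cross_ne hn h
    rw [hyx] at e₃ e₄
    have e₅ := m.2.2.2
    simp only [List.mem_cons, List.not_mem_nil, or_false] at hu hv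
    rcases hu with rfl | rfl | rfl | rfl | rfl | rfl <;>
    rcases hv with rfl | rfl | rfl | rfl | rfl | rfl <;>
    first
    | contradiction
    | (exact absurd (hcol.symm.trans e₅) hk)
    | (exact absurd (hvu.symm.trans e₅) hk)
  · have hv := leave u v hcol hu hvx hvy
    obtain ⟨hd, h₁, h₂, h₃⟩ := m
    have h₁' : c s(x', x) = t := by rwa [Sym2.eq_swap]
    exact false_of_path_colors h (v₀ := u) (v₁ := v) (v₂ := x') (v₃ := x) (v₄ := y) (v₅ := y')
      (v₆ := z) (v₇ := z') (by simp at hd hu hv ⊢; grind)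
      {t, c s(x, y), c s(v, x'), c s(y', z)} Finset.card_le_four
      (by simp [*]) (by simp [*]) (by simp [*]) (by simp [*]) (by simp [*]) (by simp [*])
      (by simp [*])

end IsTripleMatching

/-- A cross color is not the color of three disjoint edges. -/
lemma IsCrossColor.card_colorClass_le (hn : 8 ≤ n) (hc : IsProperColoring c)
    (h : ∀ v : ℕ → Fin n, InjOnFirst n 8 v → 5 ≤ pathColorCount n 8 c v) {t k : ℕ}
    (hk : IsCrossColor c t k) : (colorClass c k).card ≤ 2 := by
  obtain ⟨hkt, x, x', y, y', z, z', m, rfl⟩ := hk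
  refine (Finset.card_le_card (t := {s(x, y), s(x', y')}) ?_).trans Finset.card_le_two
  intro e he
  induction e with
  | h u v =>
    simp only [colorClass, Finset.mem_filter, Finset.mem_univ, true_and, Sym2.mk_isDiag_iff] at he
    simpa using m.eq_of_color_eq hn hc h hkt he.1 he.2

/-- The color of three disjoint edges has at least three edges. -/
lemma IsTripleMatching.two_lt_card {t : ℕ} {x x' y y' z z' : Fin n}
    (m : IsTripleMatching c t x x' y y' z z') : 2 < (colorClass c t).card := by
  obtain ⟨hd, h₁, h₂, h₃⟩ := m
  simp at hd
  rw [Finset.two_lt_card]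
  refine ⟨s(x, x'), ?_, s(y, y'), ?_, s(z, z'), ?_, ?_, ?_, ?_⟩ <;>
    simp [colorClass, *]

/-- A color class with at least three edges contains three disjoint edges. -/
lemma exists_isTripleMatching (hc : IsProperColoring c) {t : ℕ}
    (ht : 2 < (colorClass c t).card) : ∃ x x' y y' z z',
      IsTripleMatching c t x x' y y' z z' := by
  obtain ⟨e₁, h₁, e₂, h₂, e₃, h₃, h₁₂, h₁₃, h₂₃⟩ := Finset.two_lt_card.1 ht
  induction e₁ with | h x x' =>
  induction e₂ with | h y y' =>
  induction e₃ with | h z z' =>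
  simp only [colorClass, Finset.mem_filter, Finset.mem_univ, true_and, Sym2.mk_isDiag_iff]
    at h₁ h₂ h₃
  have d₁ := hc.disjoint h₁.1 h₂.1 (h₁.2.trans h₂.2.symm) h₁₂
  have d₂ := hc.disjoint h₁.1 h₃.1 (h₁.2.trans h₃.2.symm) h₁₃
  have d₃ := hc.disjoint h₂.1 h₃.1 (h₂.2.trans h₃.2.symm) h₂₃
  exact ⟨x, x', y, y', z, z', by simp; grind, h₁.2, h₂.2, h₃.2⟩

/-- Every color class has at most three edges. -/
lemma card_colorClass_le_three (hc : IsProperColoring c)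
    (h : ∀ v : ℕ → Fin n, InjOnFirst n 8 v → 5 ≤ pathColorCount n 8 c v) (t : ℕ) :
    (colorClass c t).card ≤ 3 := by
  by_contra! hlt
  obtain ⟨x, x', y, y', z, z', hd, h₁, h₂, h₃⟩ := exists_isTripleMatching hc (t := t) (by omega)
  obtain ⟨e, he, hne⟩ := Finset.exists_mem_notMem_of_card_lt_card
    ((Finset.card_le_three (a := s(x, x')) (b := s(y, y')) (c := s(z, z'))).trans_lt hlt)
  induction e with | h u v =>
  simp only [colorClass, Finset.mem_filter, Finset.mem_univ, true_and, Sym2.mk_isDiag_iff,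
    Finset.mem_insert, Finset.mem_singleton, not_or] at he hne
  simp at hd
  have d₁ := hc.disjoint he.1 (u := x) (v := x') (by grind) (he.2.trans h₁.symm) hne.1
  have d₂ := hc.disjoint he.1 (u := y) (v := y') (by grind) (he.2.trans h₂.symm) hne.2.1
  have d₃ := hc.disjoint he.1 (u := z) (v := z') (by grind) (he.2.trans h₃.symm) hne.2.2
  exact false_of_path_colors h (v₀ := x) (v₁ := x') (v₂ := y) (v₃ := y') (v₄ := z) (v₅ := z')
    (v₆ := u) (v₇ := v) (by simp; grind)
    {t, c s(x', y), c s(y', z), c s(z', u)} Finset.card_le_four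
    (by simp [*]) (by simp [*]) (by simp [*]) (by simp [*]) (by simp [*]) (by simp [*])
    (by simp [*])

/-- Two matchings of three edges in different colors share no pair `x`, `y` of vertices
which is joined by a cross edge of both. -/
lemma IsTripleMatching.false_of_common_cross (hn : 8 ≤ n) (hc : IsProperColoring c)
    (h : ∀ v : ℕ → Fin n, InjOnFirst n 8 v → 5 ≤ pathColorCount n 8 c v) {t r : ℕ}
    {x x' y y' z z' a b d d' : Fin n} (htr : r ≠ t) (m : IsTripleMatching c t x x' y y' z z')
    (m' : IsTripleMatching c r x a y b d d') : False := by
  have outside : ∀ {x x' y y' a b : Fin n}, IsTripleMatching c t x x' y y' z z' →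
      IsTripleMatching c r x a y b d d' → a ∉ [x, x', y, y', z, z'] := by
    intro x x' y y' a b m m' ha
    have hcross : ¬ IsCrossColor c t r := fun hcr =>
      absurd (hcr.card_colorClass_le hn hc h) (by have := m'.two_lt_card; omega)
    have hd := m'.1
    simp at hd ha
    rcases ha with rfl | rfl | rfl | rfl | rfl | rfl
    · grind
    · exact htr (m'.2.1.symm.trans m.2.1)
    · grind
    · exact hcross ⟨htr, _, _, _, _, _, _, m.reverse_second, m'.2.1⟩
    · exact hcross ⟨htr, _, _, _, _, _, _, m.exchange_last, m'.2.1⟩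
    · exact hcross ⟨htr, _, _, _, _, _, _, m.reverse_last.exchange_last, m'.2.1⟩
  have ha := outside m m'
  have hb := outside m.exchange m'.exchange
  obtain ⟨hd, h₁, h₂, h₃⟩ := m
  obtain ⟨hd', h₁', h₂', -⟩ := m'
  rw [Sym2.eq_swap] at h₂ h₁'
  exact false_of_path_colors h (v₀ := a) (v₁ := x) (v₂ := x') (v₃ := z) (v₄ := z') (v₅ := y')
    (v₆ := y) (v₇ := b) (by simp at hd hd' ha hb ⊢; grind)
    {t, r, c s(x', z), c s(z', y')} Finset.card_le_four
    (by simp [*]) (by simp [*]) (by simp [*]) (by simp [*]) (by simp [*]) (by simp [*])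
    (by simp [*])

/-- A color is a cross color for at most one color. -/
lemma IsCrossColor.unique (hn : 8 ≤ n) (hc : IsProperColoring c)
    (h : ∀ v : ℕ → Fin n, InjOnFirst n 8 v → 5 ≤ pathColorCount n 8 c v) {t r k : ℕ}
    (hk : IsCrossColor c t k) (hk' : IsCrossColor c r k) : t = r := by
  by_contra! htr
  obtain ⟨hkt, x, x', y, y', z, z', m, rfl⟩ := hk
  obtain ⟨hkr, a, a', b, b', d, d', mr, hcol⟩ := hk'
  have hab : a ≠ b := by have := mr.1; simp at this; grind
  rcases m.eq_of_color_eq hn hc h hkt hab hcol with he | he <;>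
    rcases Sym2.eq_iff.1 he with ⟨rfl, rfl⟩ | ⟨rfl, rfl⟩
  · exact m.false_of_common_cross hn hc h htr.symm mr
  · exact m.false_of_common_cross hn hc h htr.symm mr.exchange
  · exact m.reverse.reverse_second.false_of_common_cross hn hc h htr.symm mr
  · exact m.reverse.reverse_second.false_of_common_cross hn hc h htr.symm mr.exchange

/-- A color of three disjoint edges has at least six cross colors. -/
lemma IsTripleMatching.exists_cross_colors (hn : 8 ≤ n) (hc : IsProperColoring c)
    (h : ∀ v : ℕ → Fin n, InjOnFirst n 8 v → 5 ≤ pathColorCount n 8 c v) {t : ℕ}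
    {x x' y y' z z' : Fin n} (m : IsTripleMatching c t x x' y y' z z') :
    ∃ D : Finset ℕ, D.card = 6 ∧ ∀ k ∈ D, IsCrossColor c t k := by
  have hd := m.1
  simp at hd
  have cross : ∀ {x x' y y' z z' : Fin n}, IsTripleMatching c t x x' y y' z z' →
      IsCrossColor c t (c s(x, y)) := by
    intro x x' y y' z z' m
    refine ⟨fun hk => ?_, x, x', y, y', z, z', m, rfl⟩
    have hd := m.1
    simp at hd
    exact hc x y x' (by grind) (by grind) (by grind) (hk.trans m.2.1.symm)
  have adj : ∀ p q r : Fin n, p ≠ q → p ≠ r → q ≠ r → c s(p, q) ≠ c s(p, r) := hc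
  have swap : ∀ p q : Fin n, c s(p, q) = c s(q, p) := fun p q => by rw [Sym2.eq_swap]
  have e₁ := m.exchange.reverse.cross_ne hn h
  have e₂ := m.exchange.reverse.reverse_last.cross_ne hn h
  have e₃ := m.exchange_last.exchange.exchange_last.cross_ne hn h
  have e₄ := m.exchange_last.exchange.exchange_last.reverse.cross_ne hn h
  refine ⟨[c s(x, y), c s(x, y'), c s(x, z), c s(x, z'), c s(y, z), c s(y, z')].toFinset, ?_, ?_⟩
  · rw [List.toFinset_card_of_nodup]
    · rfl
    · simp only [List.nodup_cons, List.mem_cons, List.not_mem_nil, not_or]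
      grind
  · intro k hk
    simp only [List.mem_toFinset, List.mem_cons, List.not_mem_nil, or_false] at hk
    rcases hk with rfl | rfl | rfl | rfl | rfl | rfl
    · exact cross m
    · exact cross m.reverse_second
    · exact cross m.exchange_last
    · exact cross m.reverse_last.exchange_last
    · exact cross m.exchange.exchange_last
    · exact cross m.exchange.reverse_last.exchange_last

end

/-- For all `n ≥ 8`, every proper edge-coloring of `K_n` in which every
path on 8 vertices receives at least 5 distinct colors uses at least `(7/15)·C(n,2)`
colors. -/
theorem generalized_ramsey_proper_P8_lower (n : ℕ) (hn : 8 ≤ n)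
    (c : Sym2 (Fin n) → ℕ)
    (hproper : ∀ a b d : Fin n, a ≠ b → a ≠ d → b ≠ d → c s(a, b) ≠ c s(a, d))
    (h : ∀ v : ℕ → Fin n, InjOnFirst n 8 v → 5 ≤ pathColorCount n 8 c v) :
    (7 / 15 : ℝ) * (n.choose 2 : ℝ) ≤ usedColors n c := by
  have hc : IsProperColoring c := hproper
  set E := (Finset.univ : Finset (Sym2 (Fin n))).filter fun e => ¬ e.IsDiag with hE
  set T := (E.image c).filter fun k => 2 < (colorClass c k).card with hT
  have hEcard : E.card = n.choose 2 := by
    rw [hE, ← Fintype.card_subtype, Sym2.card_subtype_not_diag, Fintype.card_fin]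
  have hsum : E.card ≤ 2 * (E.image c).card + T.card := by
    rw [Finset.card_eq_sum_card_image c E, hT, Finset.card_filter, mul_comm, ← smul_eq_mul,
      ← Finset.sum_const, ← Finset.sum_add_distrib]
    refine Finset.sum_le_sum fun k _ => ?_
    change (colorClass c k).card ≤ _
    have := card_colorClass_le_three hc h k
    split_ifs <;> omega
  have hexists : ∀ t, ∃ D : Finset ℕ, t ∈ T → D.card = 6 ∧ ∀ k ∈ D, IsCrossColor c t k := by
    intro t
    by_cases ht : t ∈ T
    · obtain ⟨x, x', y, y', z, z', m⟩ := exists_isTripleMatching hc (Finset.mem_filter.1 ht).2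
      obtain ⟨D, hD⟩ := m.exists_cross_colors hn hc h
      exact ⟨D, fun _ => hD⟩
    · exact ⟨∅, fun ht' => absurd ht' ht⟩
  choose D hD using hexists
  have hsub : T ∪ T.biUnion D ⊆ E.image c := by
    refine Finset.union_subset (Finset.filter_subset _ _) (Finset.biUnion_subset.2 ?_)
    intro t ht k hk
    obtain ⟨-, x, x', y, y', z, z', m, rfl⟩ := (hD t ht).2 k hk
    have hd := m.1
    simp at hd
    exact Finset.mem_image_of_mem c (by simp [hE]; grind)
  have hdisj : Disjoint T (T.biUnion D) := by
    rw [Finset.disjoint_left]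
    intro k hk hk'
    obtain ⟨t, ht, hkt⟩ := Finset.mem_biUnion.1 hk'
    have := ((hD t ht).2 k hkt).card_colorClass_le hn hc h
    have := (Finset.mem_filter.1 hk).2
    omega
  have hbi : (T.biUnion D).card = 6 * T.card := by
    rw [Finset.card_biUnion, Finset.sum_congr rfl fun t ht => (hD t ht).1, Finset.sum_const,
      smul_eq_mul, mul_comm]
    intro t ht r hr htr
    rw [Function.onFun, Finset.disjoint_left]
    exact fun k hk hk' => htr (((hD t ht).2 k hk).unique hn hc h ((hD r hr).2 k hk'))
  have hseven : 7 * T.card ≤ (E.image c).card := by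
    have := Finset.card_le_card hsub
    rw [Finset.card_union_of_disjoint hdisj, hbi] at this
    omega
  have hmain : 7 * n.choose 2 ≤ 15 * usedColors n c := by
    change _ ≤ 15 * (E.image c).card
    omega
  have hreal : (7 : ℝ) * (n.choose 2 : ℝ) ≤ 15 * (usedColors n c : ℝ) := by exact_mod_cast hmain
  linarith
end
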